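/- For every β ∈ (0,∞) and h ∈ ℝ, the iterated weak limits μ := lim_{n→∞} lim_{m→∞} μ_{β,h}^+( · | η(i,0) = −1 for all i ∈ {−m,…,−n} ) exist (the inner limits exist by monotonicity) and μ = μ_{β,h}^+. In particular, for h = 0 and β ≥ β_c, conditioning the plus phase on all minuses in the far left of the line ℤ×{0} and letting the conditioning region recede to −∞ recovers the plus phase itself, so ν_{β,0}^{+,−} = ν_{β,0}^{+,+}. -/

import Mathlib

open MeasureTheory Filter Topology ProbabilityTheory

noncomputable section

/-- Spin value of a Boolean spin: `true ↦ +1`, `false ↦ -1`. -/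
def sval (b : Bool) : ℝ := if b then 1 else -1

/-- Two-dimensional spin configurations. -/
abbrev Cfg2 := ℤ × ℤ → Bool

/-- Two-sided sequences over an alphabet `A`. -/
abbrev ZSeq (A : Type*) := ℤ → A

/-- Pasts: index `k` corresponds to the coordinate `-(k+1)`. -/
abbrev Past (A : Type*) := ℕ → A

/-- The four nearest neighbours of a site of `ℤ²`. -/
def nbrs (x : ℤ × ℤ) : Finset (ℤ × ℤ) :=
  {(x.1 + 1, x.2), (x.1 - 1, x.2), (x.1, x.2 + 1), (x.1, x.2 - 1)}

/-- Boltzmann weight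
`exp(β[Σ_{{x,y}⊆Λ, x∼y} ω_x ω_y + Σ_{x∈Λ, y∉Λ, x∼y} ω_x σ_y] − h Σ_{x∈Λ} ω_x)`
(the sum over unordered pairs inside `Λ` is written as half the ordered sum). -/
def isingWeight (β h : ℝ) (Λ : Finset (ℤ × ℤ)) (σ ω : Cfg2) : ℝ :=
  Real.exp (β * ((∑ x ∈ Λ, ∑ y ∈ Λ.filter (fun y => y ∈ nbrs x),
        sval (ω x) * sval (ω y)) / 2
      + ∑ x ∈ Λ, ∑ y ∈ (nbrs x).filter (fun y => y ∉ Λ), sval (ω x) * sval (σ y))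
    - h * ∑ x ∈ Λ, sval (ω x))

/-- Fill in the values `τ` inside `Λ` and `σ` outside. -/
def fill (Λ : Finset (ℤ × ℤ)) (σ : Cfg2) (τ : ↥Λ → Bool) : Cfg2 :=
  fun x => if hx : x ∈ Λ then τ ⟨x, hx⟩ else σ x

/-- The finite-volume Ising measure in `Λ` with boundary condition `σ`, viewed as a measure on
the full configuration space, the spins outside `Λ` being frozen to `σ`. -/
def isingFV (β h : ℝ) (Λ : Finset (ℤ × ℤ)) (σ : Cfg2) : Measure Cfg2 :=
  (∑ τ : ↥Λ → Bool, ENNReal.ofReal (isingWeight β h Λ σ (fill Λ σ τ)))⁻¹ •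
    ∑ τ : ↥Λ → Bool,
      ENNReal.ofReal (isingWeight β h Λ σ (fill Λ σ τ)) • Measure.dirac (fill Λ σ τ)

/-- The box `[-n,n]²`. -/
def box (n : ℕ) : Finset (ℤ × ℤ) :=
  (Finset.Icc (-(n : ℤ)) (n : ℤ)) ×ˢ (Finset.Icc (-(n : ℤ)) (n : ℤ))

/-- Convergence of a sequence of measures on a product space in the sense of convergence of the
measures of all finite-dimensional cylinder events; for probability measures on `{−1,+1}^ι`
this is exactly weak convergence. -/
def CylTendsto {ι A : Type*} [MeasurableSpace A] (μs : ℕ → Measure (ι → A))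
    (μ : Measure (ι → A)) : Prop :=
  ∀ (s : Finset ι) (f : ι → A),
    Tendsto (fun n => μs n {η | ∀ i ∈ s, η i = f i}) atTop (𝓝 (μ {η | ∀ i ∈ s, η i = f i}))

/-- `μ` is the plus phase `μ_{β,h}^+`: the weak limit of the finite-volume Ising measures on
`[-n,n]²` with all-plus boundary conditions. -/
def IsPlusPhase (β h : ℝ) (μ : Measure Cfg2) : Prop :=
  IsProbabilityMeasure μ ∧ CylTendsto (fun n => isingFV β h (box n) (fun _ => true)) μ

/-- `μ` is the minus phase `μ_{β,h}^-`. -/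
def IsMinusPhase (β h : ℝ) (μ : Measure Cfg2) : Prop :=
  IsProbabilityMeasure μ ∧ CylTendsto (fun n => isingFV β h (box n) (fun _ => false)) μ

/-- The critical inverse temperature `β_c = ln(1+√2)/2`. -/
def betaCrit : ℝ := Real.log (1 + Real.sqrt 2) / 2

/-- Projection of a two-dimensional configuration onto the line `ℤ × {0}`. -/
def lineProj (η : Cfg2) : ZSeq Bool := fun i => η (i, 0)

/-- The Schonmann projection of a measure on `{−1,+1}^{ℤ²}`. -/
def schonmann (μ : Measure Cfg2) : Measure (ZSeq Bool) := μ.map lineProj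

/-- Restriction of a two-sided sequence to its strict past; index `k` is coordinate `-(k+1)`. -/
def restrictPast {A : Type*} (ω : ZSeq A) : Past A := fun k => ω (-(k + 1 : ℤ))

/-- The shift on two-sided sequences. -/
def shiftSeq {A : Type*} : ZSeq A → ZSeq A := fun ω i => ω (i + 1)

/-- The σ-algebra `ℱ_{<0}` generated by the coordinates of negative index. -/
def pastSigma (A : Type*) [MeasurableSpace A] : MeasurableSpace (ZSeq A) :=
  MeasurableSpace.comap (fun ω : ZSeq A => restrictPast ω) inferInstance

/-- The σ-algebra generated by the coordinates in `S`. -/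
def sigmaOn {ι A : Type*} [MeasurableSpace A] (S : Set ι) : MeasurableSpace (ι → A) :=
  MeasurableSpace.comap (fun ω : ι → A => S.restrict ω) inferInstance

/-- A g-function on the alphabet `A`: measurable, `[0,1]`-valued, normalized. -/
def IsGFunction {A : Type*} [Fintype A] [MeasurableSpace A] (P : A → Past A → ℝ) : Prop :=
  (∀ a, Measurable (P a)) ∧ ∀ ω, (∑ a : A, P a ω) = 1 ∧ ∀ a, P a ω ∈ Set.Icc (0 : ℝ) 1

/-- `μ` is a translation-invariant g-measure consistent with the g-function `P`: for each `a`,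
`ω ↦ P a (restrictPast ω)` is a version of the conditional probability `μ(X₀ = a | ℱ_{<0})`. -/
def IsGMeasure {A : Type*} [MeasurableSpace A] (μ : Measure (ZSeq A))
    (P : A → Past A → ℝ) : Prop :=
  IsProbabilityMeasure μ ∧ μ.map shiftSeq = μ ∧
    ∀ a : A, (fun ω => P a (restrictPast ω))
      =ᵐ[μ] μ[Set.indicator {ω : ZSeq A | ω 0 = a} (fun _ => (1 : ℝ)) | pastSigma A]

/-- The `k`-th variation of a g-function: the supremum of `|P a ω − P a σ|` over pasts agreeing
on the coordinates `−k,…,−1`. -/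
def varG {A : Type*} (P : A → Past A → ℝ) (k : ℕ) : ℝ :=
  sSup {d : ℝ | ∃ (a : A) (ω σ' : Past A), (∀ j < k, ω j = σ' j) ∧ d = |P a ω - P a σ'|}

/-- Elementary conditional probability `μ(B | A)`, as a real number. -/
def condProbR {X : Type*} [MeasurableSpace X] (μ : Measure X) (B A : Set X) : ℝ :=
  ((μ[|A]) B).toReal

/-- The event that `η_i = ω` (suitably reindexed) for `−n ≤ i ≤ −1` and `η_i = b`
for `−(n+l) ≤ i ≤ −(n+1)`. -/
def pastEvt (n l : ℕ) (b : Bool) (ω : Past Bool) : Set (ZSeq Bool) :=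
  {η | (∀ i : ℤ, -(n : ℤ) ≤ i → i ≤ -1 → η i = ω (i.natAbs - 1)) ∧
       (∀ i : ℤ, -((n : ℤ) + l) ≤ i → i ≤ -((n : ℤ) + 1) → η i = b)}

/-- The event that `η_i = b` for `−(n+l) ≤ i ≤ −n`. -/
def blockEvt (n l : ℕ) (b : Bool) : Set (ZSeq Bool) :=
  {η | ∀ i : ℤ, -((n : ℤ) + l) ≤ i → i ≤ -(n : ℤ) → η i = b}

/-- The event that `η_i = b` for `−n ≤ i ≤ −1`. -/
def allBlock (n : ℕ) (b : Bool) : Set (ZSeq Bool) :=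
  {η | ∀ i : ℤ, -(n : ℤ) ≤ i → i ≤ -1 → η i = b}

/-- `P` is the g-function `P^{+,b}` obtained from `ν` by conditioning on the symbol `b`
in the far past: `P(a|ω) = lim_n lim_l ν(η₀ = a | η = b on [−(n+l),−(n+1)], η = ω on [−n,−1])`,
both iterated limits being required to exist. -/
def IsCondG (ν : Measure (ZSeq Bool)) (b : Bool) (P : Bool → Past Bool → ℝ) : Prop :=
  ∀ (a : Bool) (ω : Past Bool), ∃ L : ℕ → ℝ,
    (∀ n, Tendsto (fun l => condProbR ν {η | η 0 = a} (pastEvt n l b ω)) atTop (𝓝 (L n))) ∧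
    Tendsto L atTop (𝓝 (P a ω))

/-- `ν'` is the iterated weak limit `lim_n lim_l ν( · | η = b on [−(n+l),−n])`. -/
def IsCondLimitMeasure (ν : Measure (ZSeq Bool)) (b : Bool) (ν' : Measure (ZSeq Bool)) : Prop :=
  ∃ νseq : ℕ → Measure (ZSeq Bool),
    (∀ n, CylTendsto (fun l => ν[|blockEvt n l b]) (νseq n)) ∧ CylTendsto νseq ν'

/-- Stochastic domination: `ν ≤ μ` iff `ν B ≤ μ B` for every increasing measurable event `B`. -/
def StochDom {A : Type*} [MeasurableSpace A] [Preorder A]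
    (ν μ : Measure (ZSeq A)) : Prop :=
  ∀ B : Set (ZSeq A), MeasurableSet B → (∀ ⦃x y : ZSeq A⦄, x ≤ y → x ∈ B → y ∈ B) → ν B ≤ μ B

/-- `π` is the i.i.d. product measure with `π(η_i = +1) = ρ` for each coordinate. -/
def IsBernoulliProd (ρ : ℝ) (π : Measure (ZSeq Bool)) : Prop :=
  IsProbabilityMeasure π ∧ ∀ (s : Finset ℤ) (f : ℤ → Bool),
    π {η | ∀ i ∈ s, η i = f i} = ∏ i ∈ s, ENNReal.ofReal (if f i then ρ else 1 - ρ)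

/-- Splicing of pasts: coordinates `−k,…,−1` (indices `< k`) from `ω`, the rest from `σ`. -/
def splice {A : Type*} (σ ω : Past A) (k : ℕ) : Past A := fun j => if j < k then ω j else σ j

/-- `ν'` is an extreme point of the convex set of g-measures consistent with `P`. -/
def ExtremeGMeasure (ν' : Measure (ZSeq Bool)) (P : Bool → Past Bool → ℝ) : Prop :=
  IsGMeasure ν' P ∧
  ∀ ν₁ ν₂ : Measure (ZSeq Bool), IsGMeasure ν₁ P → IsGMeasure ν₂ P →
    ∀ t : ℝ, t ∈ Set.Ioo (0 : ℝ) 1 →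
      ν' = ENNReal.ofReal t • ν₁ + ENNReal.ofReal (1 - t) • ν₂ → ν₁ = ν' ∧ ν₂ = ν'

/-- The event that the spins on the line are `−1` on `{−m,…,−n} × {0}`. -/
def lineMinusEvt (n m : ℕ) : Set Cfg2 :=
  {η | ∀ i : ℤ, -(m : ℤ) ≤ i → i ≤ -(n : ℤ) → η (i, 0) = false}

/-- Nearest-neighbour adjacency in `ℤ²` (`‖x−y‖₁ = 1`). -/
def adj2 (x y : ℤ × ℤ) : Prop := (x.1 - y.1).natAbs + (x.2 - y.2).natAbs = 1

/-- The event `A_n`: there is an infinite nearest-neighbour path of `+1` spins starting at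
`(n,0)` entirely contained in the half-plane `{x ≤ n}`. -/
def plusPathEvt (n : ℕ) : Set Cfg2 :=
  {η | ∃ γ : ℕ → ℤ × ℤ, γ 0 = ((n : ℤ), 0) ∧ (∀ j, adj2 (γ j) (γ (j + 1))) ∧
    Function.Injective γ ∧ (∀ j, (γ j).1 ≤ (n : ℤ)) ∧ ∀ j, η (γ j) = true}

/-- The block map for the decimation `ν_{l,k}`: the `j`-th letter consists of the spins on
`[j(k+l), j(k+l)+l−1]`. -/
def blockMap (l k : ℕ) (η : ZSeq Bool) : ZSeq (Fin l → Bool) :=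
  fun j r => η (j * ((k : ℤ) + l) + r)

end

noncomputable section

lemma sval_true : sval true = 1 := by simp [sval]
lemma sval_false : sval false = -1 := by simp [sval]
lemma sval_mono : Monotone sval := by
  intro a b; cases a <;> cases b <;> simp [sval]
lemma abs_sval (b : Bool) : |sval b| = 1 := by cases b <;> simp [sval]

/-- Boltzmann weight of a configuration in the volume `Λ`, its own outside values being the
boundary condition. -/
def wt (β h : ℝ) (Λ : Finset (ℤ × ℤ)) (η : Cfg2) : ℝ := isingWeight β h Λ η η

/-- Indicator that the bond `{x, y}` touches `Λ`. -/
def touch (Λ : Finset (ℤ × ℤ)) (x y : ℤ × ℤ) : ℝ := if x ∈ Λ ∨ y ∈ Λ then 1 else 0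

/-- Bond energy attached to the site `x`: the bonds from `x` to the right and upwards. -/
def bondE (Λ : Finset (ℤ × ℤ)) (η : Cfg2) (x : ℤ × ℤ) : ℝ :=
  touch Λ x (x + (1, 0)) * (sval (η x) * sval (η (x + (1, 0)))) +
    touch Λ x (x + (0, 1)) * (sval (η x) * sval (η (x + (0, 1))))

/-- The sites carrying a bond that touches `Λ`. -/
def bondSites (Λ : Finset (ℤ × ℤ)) : Finset (ℤ × ℤ) :=
  Λ ∪ Λ.image (fun x => x - (1, 0)) ∪ Λ.image (fun x => x - (0, 1))

lemma bondE_eq_zero {Λ : Finset (ℤ × ℤ)} {η : Cfg2} {x : ℤ × ℤ} (hx : x ∉ bondSites Λ) :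
    bondE Λ η x = 0 := by
  simp only [bondSites, Finset.mem_union, Finset.mem_image, not_or, not_exists, not_and] at hx
  obtain ⟨⟨h1, h2⟩, h3⟩ := hx
  have h2' : x + (1, 0) ∉ Λ := fun h => h2 _ h (by simp)
  have h3' : x + (0, 1) ∉ Λ := fun h => h3 _ h (by simp)
  simp [bondE, touch, h1, h2', h3']

lemma sum_nbrs (x : ℤ × ℤ) (φ : ℤ × ℤ → ℝ) :
    ∑ y ∈ nbrs x, φ y = φ (x + (1, 0)) + φ (x + (0, 1)) + φ (x - (1, 0)) + φ (x - (0, 1)) := by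
  obtain ⟨a, b⟩ := x
  have h1 : ((a + 1, b) : ℤ × ℤ) ∉ ({(a - 1, b), (a, b + 1), (a, b - 1)} : Finset (ℤ × ℤ)) := by
    simp; omega
  have h2 : ((a - 1, b) : ℤ × ℤ) ∉ ({(a, b + 1), (a, b - 1)} : Finset (ℤ × ℤ)) := by
    simp
  have h3 : ((a, b + 1) : ℤ × ℤ) ∉ ({(a, b - 1)} : Finset (ℤ × ℤ)) := by
    simp; omega
  simp only [nbrs]
  rw [Finset.sum_insert h1, Finset.sum_insert h2, Finset.sum_insert h3, Finset.sum_singleton]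
  simp; ring

lemma energy_eq_finsum (Λ : Finset (ℤ × ℤ)) (η : Cfg2) :
    (∑ x ∈ Λ, ∑ y ∈ Λ.filter (fun y => y ∈ nbrs x), sval (η x) * sval (η y)) / 2
      + ∑ x ∈ Λ, ∑ y ∈ (nbrs x).filter (fun y => y ∉ Λ), sval (η x) * sval (η y)
      = ∑ᶠ x, bondE Λ η x := by
  set c : ℤ × ℤ → ℝ := fun y => if y ∈ Λ then 1 / 2 else 1 with hc
  set u : ℤ × ℤ → ℝ := fun y => if y ∈ Λ then 1 else 0 with hu
  set s : ℤ × ℤ → ℝ := fun y => sval (η y) with hs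
  have h1 : (∑ x ∈ Λ, ∑ y ∈ Λ.filter (fun y => y ∈ nbrs x), sval (η x) * sval (η y)) / 2
      + ∑ x ∈ Λ, ∑ y ∈ (nbrs x).filter (fun y => y ∉ Λ), sval (η x) * sval (η y)
      = ∑ x ∈ Λ, ∑ y ∈ nbrs x, c y * (s x * s y) := by
    rw [Finset.sum_div, ← Finset.sum_add_distrib]
    refine Finset.sum_congr rfl fun x _ => ?_
    have : Λ.filter (fun y => y ∈ nbrs x) = (nbrs x).filter (fun y => y ∈ Λ) := by
      ext y; simp [and_comm]
    rw [this, Finset.sum_filter, Finset.sum_filter, Finset.sum_div, ← Finset.sum_add_distrib]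
    refine Finset.sum_congr rfl fun y _ => ?_
    by_cases hy : y ∈ Λ <;> simp [hc, hs, hy]; ring
  rw [h1]
  simp only [sum_nbrs]
  have fin : ∀ (g : ℤ × ℤ → ℤ × ℤ) (hg : Function.Injective g) (f : ℤ × ℤ → ℝ),
      (Function.support fun x => u (g x) * f x).Finite := by
    intro g hg f
    refine (Λ.finite_toSet.preimage hg.injOn).subset ?_
    intro x hx
    by_contra hxx
    exact hx (by simp at hxx; simp [hu, hxx])
  have i0 := fin id Function.injective_id
  have i1 := fin (fun x => x + (1, 0)) (add_left_injective _)
  have i2 := fin (fun x => x + (0, 1)) (add_left_injective _)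
  simp only [id] at i0
  have h2 : ∀ f : ℤ × ℤ → ℝ, ∑ x ∈ Λ, f x = ∑ᶠ x, u x * f x := by
    intro f
    rw [finsum_eq_sum_of_support_subset (s := Λ)]
    · refine Finset.sum_congr rfl fun x hx => by simp [hu, hx]
    · intro x hx
      by_contra hxx
      exact hx (by simp at hxx; simp [hu, hxx])
  have h3 : ∀ (d : ℤ × ℤ) (f : ℤ × ℤ → ℝ), ∑ᶠ x, u x * f x = ∑ᶠ x, u (x + d) * f (x + d) := by
    intro d f
    exact (finsum_comp_equiv (Equiv.addRight d) (f := fun x => u x * f x)).symm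
  simp only [Finset.sum_add_distrib]
  rw [h2, h2, h2, h2]
  rw [h3 (1, 0) fun x => c (x - (1, 0)) * (s x * s (x - (1, 0))),
    h3 (0, 1) fun x => c (x - (0, 1)) * (s x * s (x - (0, 1)))]
  rw [← finsum_add_distrib (i0 _) (i0 _), ← finsum_add_distrib _ (i1 _),
    ← finsum_add_distrib _ (i2 _)]
  · refine finsum_congr fun x => ?_
    simp only [bondE, touch, add_sub_cancel_right, hc, hu]
    by_cases a : x ∈ Λ <;> by_cases b : x + (1, 0) ∈ Λ <;> by_cases d : x + (0, 1) ∈ Λ <;>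
      simp only [a, b, d, if_true, if_false, or_true, or_self, or_false, hs] <;> ring
  · refine ((((i0 _).union (i0 _)).union (i1 _))).subset (Function.support_add _ _ |>.trans
      (Set.union_subset_union_left _ (Function.support_add _ _)))
  · exact ((i0 _).union (i0 _)).subset (Function.support_add _ _)

/-- The Boltzmann weight as a product over bonds, each bond listed once. -/
lemma wt_eq (β h : ℝ) (Λ B : Finset (ℤ × ℤ)) (hB : bondSites Λ ⊆ B) (η : Cfg2) :
    wt β h Λ η = Real.exp (β * ∑ x ∈ B, bondE Λ η x - h * ∑ x ∈ Λ, sval (η x)) := by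
  unfold wt isingWeight
  rw [energy_eq_finsum, finsum_eq_sum_of_support_subset (s := B)]
  intro x hx
  by_contra hxx
  exact hx (bondE_eq_zero fun h' => hxx (hB h'))

lemma isingWeight_fill (β h : ℝ) (Λ : Finset (ℤ × ℤ)) (σ : Cfg2) (τ : ↥Λ → Bool) :
    isingWeight β h Λ σ (fill Λ σ τ) = wt β h Λ (fill Λ σ τ) := by
  unfold wt isingWeight
  congr 4
  refine Finset.sum_congr rfl fun x _ => Finset.sum_congr rfl fun y hy => ?_
  simp at hy
  simp [fill, hy.2]

lemma wt_pos (β h : ℝ) (Λ : Finset (ℤ × ℤ)) (η : Cfg2) : 0 < wt β h Λ η := Real.exp_pos _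

lemma sval_supermodular (a b c d : Bool) : sval a * sval b + sval c * sval d ≤
    sval (a ⊓ c) * sval (b ⊓ d) + sval (a ⊔ c) * sval (b ⊔ d) := by
  cases a <;> cases b <;> cases c <;> cases d <;> norm_num [sval]

lemma sval_modular (a c : Bool) : sval a + sval c = sval (a ⊓ c) + sval (a ⊔ c) := by
  cases a <;> cases c <;> norm_num [sval]

lemma touch_nonneg (Λ : Finset (ℤ × ℤ)) (x y : ℤ × ℤ) : 0 ≤ touch Λ x y := by
  unfold touch; split_ifs <;> norm_num

lemma bondE_supermodular (Λ : Finset (ℤ × ℤ)) (η ζ : Cfg2) (x : ℤ × ℤ) :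
    bondE Λ η x + bondE Λ ζ x ≤ bondE Λ (η ⊓ ζ) x + bondE Λ (η ⊔ ζ) x := by
  unfold bondE
  have h1 := mul_le_mul_of_nonneg_left
    (sval_supermodular (η x) (η (x + (1, 0))) (ζ x) (ζ (x + (1, 0))))
    (touch_nonneg Λ x (x + (1, 0)))
  have h2 := mul_le_mul_of_nonneg_left
    (sval_supermodular (η x) (η (x + (0, 1))) (ζ x) (ζ (x + (0, 1))))
    (touch_nonneg Λ x (x + (0, 1)))
  simp only [Pi.inf_apply, Pi.sup_apply]
  linarith

/-- Log-supermodularity of a nonnegative function on configurations. -/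
def SuperMod (F : Cfg2 → ℝ) : Prop :=
  (∀ a, 0 ≤ F a) ∧ ∀ a b, F a * F b ≤ F (a ⊓ b) * F (a ⊔ b)

lemma wt_superMod {β : ℝ} (hβ : 0 ≤ β) (h : ℝ) (Λ : Finset (ℤ × ℤ)) : SuperMod (wt β h Λ) := by
  refine ⟨fun a => (wt_pos _ _ _ _).le, fun a b => ?_⟩
  simp only [wt_eq β h Λ _ subset_rfl, ← Real.exp_add]
  apply Real.exp_le_exp.2
  have h1 : ∑ x ∈ bondSites Λ, bondE Λ a x + ∑ x ∈ bondSites Λ, bondE Λ b x ≤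
      ∑ x ∈ bondSites Λ, bondE Λ (a ⊓ b) x + ∑ x ∈ bondSites Λ, bondE Λ (a ⊔ b) x := by
    rw [← Finset.sum_add_distrib, ← Finset.sum_add_distrib]
    exact Finset.sum_le_sum fun x _ => bondE_supermodular Λ a b x
  have h2 : ∑ x ∈ Λ, sval (a x) + ∑ x ∈ Λ, sval (b x) =
      ∑ x ∈ Λ, sval ((a ⊓ b) x) + ∑ x ∈ Λ, sval ((a ⊔ b) x) := by
    rw [← Finset.sum_add_distrib, ← Finset.sum_add_distrib]
    exact Finset.sum_congr rfl fun x _ => sval_modular _ _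
  have h3 := mul_le_mul_of_nonneg_left h1 hβ
  have h4 : h * (∑ x ∈ Λ, sval (a x) + ∑ x ∈ Λ, sval (b x)) = h * (∑ x ∈ Λ, sval ((a ⊓ b) x) + ∑ x ∈ Λ, sval ((a ⊔ b) x)) := by rw [h2]
  linarith

lemma SuperMod.mul {F G : Cfg2 → ℝ} (hF : SuperMod F) (hG : SuperMod G) :
    SuperMod (fun a => F a * G a) := by
  refine ⟨fun a => mul_nonneg (hF.1 a) (hG.1 a), fun a b => ?_⟩
  calc F a * G a * (F b * G b) = (F a * F b) * (G a * G b) := by ring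
    _ ≤ (F (a ⊓ b) * F (a ⊔ b)) * (G (a ⊓ b) * G (a ⊔ b)) :=
        mul_le_mul (hF.2 a b) (hG.2 a b) (mul_nonneg (hG.1 _) (hG.1 _))
          (mul_nonneg (hF.1 _) (hF.1 _))
    _ = _ := by ring

lemma superMod_one : SuperMod (fun _ => 1) := ⟨fun _ => zero_le_one, fun _ _ => le_rfl⟩

lemma superMod_exp_sum (t : ℝ) (S : Finset (ℤ × ℤ)) :
    SuperMod (fun η => Real.exp (t * ∑ x ∈ S, sval (η x))) := by
  refine ⟨fun a => (Real.exp_pos _).le, fun a b => ?_⟩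
  rw [← Real.exp_add, ← Real.exp_add, ← mul_add, ← mul_add, ← Finset.sum_add_distrib,
    ← Finset.sum_add_distrib]
  refine le_of_eq ?_
  congr 2
  exact Finset.sum_congr rfl fun x _ => sval_modular _ _

open Classical in
/-- Indicator that all spins in `S` are minus. -/
def minusInd (S : Finset (ℤ × ℤ)) (η : Cfg2) : ℝ := if ∀ x ∈ S, η x = false then 1 else 0

open Classical in
/-- Indicator that all spins in `S` are plus. -/
def plusInd (S : Finset (ℤ × ℤ)) (η : Cfg2) : ℝ := if ∀ x ∈ S, η x = true then 1 else 0

lemma minusInd_antitone (S : Finset (ℤ × ℤ)) : Antitone (minusInd S) := by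
  intro a b hab
  unfold minusInd
  by_cases hb : ∀ x ∈ S, b x = false
  · have : ∀ x ∈ S, a x = false := fun x hx => by
      have := hab x; rw [hb x hx] at this; exact le_bot_iff.1 this
    rw [if_pos hb, if_pos this]
  · simp only [hb, if_false]; split_ifs <;> norm_num

lemma plusInd_monotone (S : Finset (ℤ × ℤ)) : Monotone (plusInd S) := by
  intro a b hab
  unfold plusInd
  by_cases ha : ∀ x ∈ S, a x = true
  · have : ∀ x ∈ S, b x = true := fun x hx => by
      have := hab x; rw [ha x hx] at this; exact top_le_iff.1 this
    rw [if_pos ha, if_pos this]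
  · simp only [ha, if_false]; split_ifs <;> norm_num

lemma minusInd_nonneg (S : Finset (ℤ × ℤ)) (η : Cfg2) : 0 ≤ minusInd S η := by
  unfold minusInd; split_ifs <;> norm_num

lemma minusInd_le_one (S : Finset (ℤ × ℤ)) (η : Cfg2) : minusInd S η ≤ 1 := by
  unfold minusInd; split_ifs <;> norm_num

lemma plusInd_nonneg (S : Finset (ℤ × ℤ)) (η : Cfg2) : 0 ≤ plusInd S η := by
  unfold plusInd; split_ifs <;> norm_num

lemma minusInd_union (S T : Finset (ℤ × ℤ)) (η : Cfg2) :
    minusInd (S ∪ T) η = minusInd S η * minusInd T η := by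
  have h : (∀ x ∈ S ∪ T, η x = false) ↔ (∀ x ∈ S, η x = false) ∧ ∀ x ∈ T, η x = false := by
    simp only [Finset.mem_union, or_imp, forall_and]
  unfold minusInd
  simp only [h]
  split_ifs <;> simp_all

lemma superMod_minusInd (S : Finset (ℤ × ℤ)) : SuperMod (minusInd S) := by
  refine ⟨minusInd_nonneg S, fun a b => ?_⟩
  by_cases ha : ∀ x ∈ S, a x = false <;> by_cases hb : ∀ x ∈ S, b x = false
  · have h1 : ∀ x ∈ S, (a ⊓ b) x = false := fun x hx => by simp [ha x hx]
    have h2 : ∀ x ∈ S, (a ⊔ b) x = false := fun x hx => by simp [ha x hx, hb x hx]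
    simp only [minusInd]; rw [if_pos ha, if_pos hb, if_pos h1, if_pos h2]
  all_goals
    refine le_trans (le_of_eq ?_) (mul_nonneg (minusInd_nonneg _ _) (minusInd_nonneg _ _))
    simp only [minusInd, ha, hb]; simp

lemma fill_of_mem {Λ : Finset (ℤ × ℤ)} {x : ℤ × ℤ} (hx : x ∈ Λ) (σ : Cfg2) (τ : ↥Λ → Bool) :
    fill Λ σ τ x = τ ⟨x, hx⟩ := by simp [fill, hx]

lemma fill_of_notMem {Λ : Finset (ℤ × ℤ)} {x : ℤ × ℤ} (hx : x ∉ Λ) (σ : Cfg2) (τ : ↥Λ → Bool) :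
    fill Λ σ τ x = σ x := by simp [fill, hx]

lemma fill_inf (Λ : Finset (ℤ × ℤ)) (σ σ' : Cfg2) (τ τ' : ↥Λ → Bool) :
    fill Λ σ τ ⊓ fill Λ σ' τ' = fill Λ (σ ⊓ σ') (τ ⊓ τ') := by
  ext x; by_cases hx : x ∈ Λ <;> simp [fill, hx]

lemma fill_sup (Λ : Finset (ℤ × ℤ)) (σ σ' : Cfg2) (τ τ' : ↥Λ → Bool) :
    fill Λ σ τ ⊔ fill Λ σ' τ' = fill Λ (σ ⊔ σ') (τ ⊔ τ') := by
  ext x; by_cases hx : x ∈ Λ <;> simp [fill, hx]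

lemma fill_mono {Λ : Finset (ℤ × ℤ)} {σ σ' : Cfg2} {τ τ' : ↥Λ → Bool} (h : σ ≤ σ') (h' : τ ≤ τ') :
    fill Λ σ τ ≤ fill Λ σ' τ' := by
  intro x; by_cases hx : x ∈ Λ
  · simpa only [fill_of_mem hx] using h' _
  · simpa only [fill_of_notMem hx] using h _

/-- Partition function. -/
def Zf (β h : ℝ) (Λ : Finset (ℤ × ℤ)) (σ : Cfg2) : ℝ := ∑ τ : ↥Λ → Bool, wt β h Λ (fill Λ σ τ)

/-- Expectation in the finite-volume Ising measure. -/
def Ex (β h : ℝ) (Λ : Finset (ℤ × ℤ)) (σ : Cfg2) (f : Cfg2 → ℝ) : ℝ :=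
  (∑ τ : ↥Λ → Bool, wt β h Λ (fill Λ σ τ) * f (fill Λ σ τ)) / Zf β h Λ σ

section
variable {β h : ℝ} {Λ Λ' : Finset (ℤ × ℤ)} {σ σ' : Cfg2} {f g : Cfg2 → ℝ}

lemma Zf_pos : 0 < Zf β h Λ σ := Finset.sum_pos (fun _ _ => wt_pos _ _ _ _) Finset.univ_nonempty

lemma Ex_mul_Zf : Ex β h Λ σ f * Zf β h Λ σ =
    ∑ τ : ↥Λ → Bool, wt β h Λ (fill Λ σ τ) * f (fill Λ σ τ) :=
  div_mul_cancel₀ _ Zf_pos.ne'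

lemma Ex_const (c : ℝ) : Ex β h Λ σ (fun _ => c) = c := by
  rw [Ex, ← Finset.sum_mul]; exact mul_div_cancel_left₀ _ Zf_pos.ne'

lemma Ex_add : Ex β h Λ σ (fun η => f η + g η) = Ex β h Λ σ f + Ex β h Λ σ g := by
  simp only [Ex, mul_add, Finset.sum_add_distrib, add_div]

lemma Ex_mul_left (c : ℝ) : Ex β h Λ σ (fun η => c * f η) = c * Ex β h Λ σ f := by
  simp only [Ex]
  rw [← mul_div_assoc, Finset.mul_sum]
  congr 1
  exact Finset.sum_congr rfl fun _ _ => by ring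

lemma Ex_neg : Ex β h Λ σ (fun η => - f η) = - Ex β h Λ σ f := by
  simpa using Ex_mul_left (β := β) (h := h) (Λ := Λ) (σ := σ) (f := f) (-1)

lemma Ex_sub : Ex β h Λ σ (fun η => f η - g η) = Ex β h Λ σ f - Ex β h Λ σ g := by
  simp only [sub_eq_add_neg, Ex_add, Ex_neg]

lemma Ex_sum {ι : Type*} (s : Finset ι) (F : ι → Cfg2 → ℝ) :
    Ex β h Λ σ (fun η => ∑ i ∈ s, F i η) = ∑ i ∈ s, Ex β h Λ σ (F i) := by
  classical
  induction s using Finset.induction with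
  | empty => simpa using Ex_const (β := β) (h := h) (Λ := Λ) (σ := σ) 0
  | insert a s ha ih => simp only [Finset.sum_insert ha, Ex_add, ih]

lemma Ex_mono (hfg : ∀ η, (∀ x ∉ Λ, η x = σ x) → f η ≤ g η) : Ex β h Λ σ f ≤ Ex β h Λ σ g := by
  refine div_le_div_of_nonneg_right (Finset.sum_le_sum fun τ _ => ?_) Zf_pos.le
  exact mul_le_mul_of_nonneg_left (hfg _ fun x hx => fill_of_notMem hx _ _) (wt_pos _ _ _ _).le

lemma Ex_congr (hfg : ∀ η, (∀ x ∉ Λ, η x = σ x) → f η = g η) : Ex β h Λ σ f = Ex β h Λ σ g :=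
  le_antisymm (Ex_mono fun η hη => (hfg η hη).le) (Ex_mono fun η hη => (hfg η hη).ge)

end

/-- The FKG inequality on a finite lattice for monotone functions of arbitrary sign. -/
lemma fkg_sum {α : Type*} [DistribLattice α] [Fintype α] {w f g : α → ℝ} (hw : ∀ a, 0 ≤ w a)
    (hsm : ∀ a b, w a * w b ≤ w (a ⊓ b) * w (a ⊔ b)) (hf : Monotone f) (hg : Monotone g) :
    (∑ a, w a * f a) * ∑ a, w a * g a ≤ (∑ a, w a) * ∑ a, w a * (f a * g a) := by
  obtain ⟨c, hc⟩ : ∃ c, ∀ a, 0 ≤ f a + c :=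
    ⟨∑ a, |f a|, fun a => by
      have := Finset.single_le_sum (f := fun a => |f a|) (fun i _ => abs_nonneg _)
        (Finset.mem_univ a)
      have := neg_abs_le (f a); linarith⟩
  obtain ⟨d, hd⟩ : ∃ c, ∀ a, 0 ≤ g a + c :=
    ⟨∑ a, |g a|, fun a => by
      have := Finset.single_le_sum (f := fun a => |g a|) (fun i _ => abs_nonneg _)
        (Finset.mem_univ a)
      have := neg_abs_le (g a); linarith⟩
  have key := fkg (μ := w) (f := fun a => f a + c) (g := fun a => g a + d) hw hc hd
    (fun a b hab => by simpa using hf hab) (fun a b hab => by simpa using hg hab) hsm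
  have e1 : ∑ a, w a * (f a + c) = ∑ a, w a * f a + c * ∑ a, w a := by
    rw [Finset.mul_sum, ← Finset.sum_add_distrib]; exact Finset.sum_congr rfl fun _ _ => by ring
  have e2 : ∑ a, w a * (g a + d) = ∑ a, w a * g a + d * ∑ a, w a := by
    rw [Finset.mul_sum, ← Finset.sum_add_distrib]; exact Finset.sum_congr rfl fun _ _ => by ring
  have e3 : ∑ a, w a * ((f a + c) * (g a + d)) = ∑ a, w a * (f a * g a) + d * ∑ a, w a * f a +
      c * ∑ a, w a * g a + c * d * ∑ a, w a := by
    simp only [Finset.mul_sum, ← Finset.sum_add_distrib]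
    exact Finset.sum_congr rfl fun _ _ => by ring
  simp only [e1, e2, e3] at key
  nlinarith [key]

section
variable {β h : ℝ} {Λ Λ' : Finset (ℤ × ℤ)} {σ σ' : Cfg2} {f g F : Cfg2 → ℝ}

lemma fill_fun_mono (hf : Monotone f) : Monotone fun τ : ↥Λ → Bool => f (fill Λ σ τ) :=
  fun _ _ h => hf (fill_mono le_rfl h)

lemma Ex_fkg (hβ : 0 ≤ β) (hF : SuperMod F) (hf : Monotone f) (hg : Monotone g) :
    Ex β h Λ σ (fun η => F η * f η) * Ex β h Λ σ (fun η => F η * g η) ≤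
      Ex β h Λ σ F * Ex β h Λ σ (fun η => F η * (f η * g η)) := by
  have hs := (wt_superMod hβ h Λ).mul hF
  have key := fkg_sum (w := fun τ : ↥Λ → Bool => wt β h Λ (fill Λ σ τ) * F (fill Λ σ τ))
    (fun τ => hs.1 _) (fun a b => by
      have := hs.2 (fill Λ σ a) (fill Λ σ b)
      rwa [fill_inf, fill_sup, inf_idem, sup_idem] at this)
    (fill_fun_mono (σ := σ) hf) (fill_fun_mono (σ := σ) hg)
  simp only [Ex]
  rw [div_mul_div_comm, div_mul_div_comm]
  refine div_le_div_of_nonneg_right ?_ (mul_pos Zf_pos Zf_pos).le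
  simpa only [mul_assoc] using key

lemma Ex_bc_mono (hβ : 0 ≤ β) (hσ : σ ≤ σ') (hf : Monotone f) :
    Ex β h Λ σ f ≤ Ex β h Λ σ' f := by
  set r : (↥Λ → Bool) → ℝ := fun τ => wt β h Λ (fill Λ σ' τ) / wt β h Λ (fill Λ σ τ) with hr
  have hrm : Monotone r := by
    intro a b hab
    have := (wt_superMod hβ h Λ).2 (fill Λ σ b) (fill Λ σ' a)
    rw [fill_inf, fill_sup, inf_eq_left.2 hσ, sup_eq_right.2 hσ, inf_eq_right.2 hab,
      sup_eq_left.2 hab] at this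
    rw [hr, div_le_div_iff₀ (wt_pos _ _ _ _) (wt_pos _ _ _ _)]
    linarith
  have key := fkg_sum (w := fun τ : ↥Λ → Bool => wt β h Λ (fill Λ σ τ))
    (fun τ => (wt_pos _ _ _ _).le) (fun a b => by
      have := (wt_superMod hβ h Λ).2 (fill Λ σ a) (fill Λ σ b)
      rwa [fill_inf, fill_sup, inf_idem, sup_idem] at this)
    (fill_fun_mono (σ := σ) hf) hrm
  have e1 : ∀ τ : ↥Λ → Bool, wt β h Λ (fill Λ σ τ) * r τ = wt β h Λ (fill Λ σ' τ) := fun τ =>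
    mul_div_cancel₀ _ (wt_pos _ _ _ _).ne'
  have e2 : ∀ τ : ↥Λ → Bool, wt β h Λ (fill Λ σ τ) * (f (fill Λ σ τ) * r τ) =
      wt β h Λ (fill Λ σ' τ) * f (fill Λ σ τ) := fun τ => by rw [← e1 τ]; ring
  simp only [e1, e2] at key
  have h2 : ∑ τ : ↥Λ → Bool, wt β h Λ (fill Λ σ' τ) * f (fill Λ σ τ) ≤
      ∑ τ : ↥Λ → Bool, wt β h Λ (fill Λ σ' τ) * f (fill Λ σ' τ) :=
    Finset.sum_le_sum fun τ _ =>
      mul_le_mul_of_nonneg_left (hf (fill_mono hσ le_rfl)) (wt_pos _ _ _ _).le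
  rw [Ex, Ex, div_le_div_iff₀ Zf_pos Zf_pos]
  have h3 := mul_le_mul_of_nonneg_left h2 (Zf_pos (β := β) (h := h) (Λ := Λ) (σ := σ)).le
  unfold Zf at *
  linarith

/-- Detailed balance between volumes. -/
lemma wt_swap (hΛ : Λ ⊆ Λ') {η ζ : Cfg2} (hηζ : ∀ x ∉ Λ, η x = ζ x) :
    wt β h Λ' η * wt β h Λ ζ = wt β h Λ' ζ * wt β h Λ η := by
  have hB : bondSites Λ ⊆ bondSites Λ' := by
    unfold bondSites
    exact Finset.union_subset_union (Finset.union_subset_union hΛ (Finset.image_subset_image hΛ))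
      (Finset.image_subset_image hΛ)
  rw [wt_eq β h Λ' _ subset_rfl, wt_eq β h Λ' _ subset_rfl, wt_eq β h Λ _ hB, wt_eq β h Λ _ hB,
    ← Real.exp_add, ← Real.exp_add]
  congr 1
  have t : ∀ x y, (touch Λ' x y - touch Λ x y) * (sval (η x) * sval (η y)) =
      (touch Λ' x y - touch Λ x y) * (sval (ζ x) * sval (ζ y)) := by
    intro x y
    by_cases hxy : x ∈ Λ ∨ y ∈ Λ
    · have h2 : x ∈ Λ' ∨ y ∈ Λ' := hxy.imp (fun h => hΛ h) (fun h => hΛ h)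
      simp [touch, hxy, h2]
    · rw [not_or] at hxy
      rw [hηζ x hxy.1, hηζ y hxy.2]
  have h1 : ∑ x ∈ bondSites Λ', bondE Λ' η x - ∑ x ∈ bondSites Λ', bondE Λ η x =
      ∑ x ∈ bondSites Λ', bondE Λ' ζ x - ∑ x ∈ bondSites Λ', bondE Λ ζ x := by
    rw [← Finset.sum_sub_distrib, ← Finset.sum_sub_distrib]
    refine Finset.sum_congr rfl fun x _ => ?_
    unfold bondE
    linear_combination t x (x + (1, 0)) + t x (x + (0, 1))
  have h2 : ∑ x ∈ Λ', sval (η x) - ∑ x ∈ Λ, sval (η x) =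
      ∑ x ∈ Λ', sval (ζ x) - ∑ x ∈ Λ, sval (ζ x) := by
    rw [← Finset.sum_sdiff hΛ, ← Finset.sum_sdiff hΛ]
    simp only [add_sub_cancel_right]
    exact Finset.sum_congr rfl fun x hx => by rw [hηζ x (Finset.mem_sdiff.1 hx).2]
  linear_combination β * h1 - h * h2

lemma Zf_congr (hσ : ∀ x ∉ Λ, σ x = σ' x) : Zf β h Λ σ = Zf β h Λ σ' := by
  have : ∀ τ : ↥Λ → Bool, fill Λ σ τ = fill Λ σ' τ := by
    intro τ; ext x; by_cases hx : x ∈ Λ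
    · simp [fill, hx]
    · simp [fill, hx, hσ x hx]
  simp only [Zf, this]

/-- Consistency of the finite-volume measures. -/
lemma Ex_dlr (hΛ : Λ ⊆ Λ') : Ex β h Λ' σ (fun η => Ex β h Λ η f) = Ex β h Λ' σ f := by
  rw [Ex, Ex]
  congr 1
  let N : (↥Λ' → Bool) → (↥Λ → Bool) → (↥Λ' → Bool) := fun τ' τ x =>
    if hx : (x : ℤ × ℤ) ∈ Λ then τ ⟨x, hx⟩ else τ' x
  let R : (↥Λ' → Bool) → (↥Λ → Bool) := fun τ' x => τ' ⟨x, hΛ x.2⟩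
  have hN : ∀ τ' τ, fill Λ (fill Λ' σ τ') τ = fill Λ' σ (N τ' τ) := by
    intro τ' τ; ext x
    by_cases hx : x ∈ Λ
    · simp [fill, hx, hΛ hx, N]
    · by_cases hx' : x ∈ Λ' <;> simp [fill, hx, hx', N]
  let e : (↥Λ' → Bool) × (↥Λ → Bool) ≃ (↥Λ' → Bool) × (↥Λ → Bool) :=
    { toFun := fun p => (N p.1 p.2, R p.1)
      invFun := fun p => (N p.1 p.2, R p.1)
      left_inv := by
        intro ⟨a, b⟩
        simp only [N, R, Prod.mk.injEq]
        constructor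
        · ext x; by_cases hx : (x : ℤ × ℤ) ∈ Λ <;> simp [hx]
        · ext x; simp
      right_inv := by
        intro ⟨a, b⟩
        simp only [N, R, Prod.mk.injEq]
        constructor
        · ext x; by_cases hx : (x : ℤ × ℤ) ∈ Λ <;> simp [hx]
        · ext x; simp }
  have hNR : ∀ τ' τ, N (N τ' τ) (R τ') = τ' := by
    intro a b
    ext x; by_cases hx : (x : ℤ × ℤ) ∈ Λ <;> simp [N, R, hx]
  have off : ∀ τ' τ, ∀ x ∉ Λ, fill Λ' σ (N τ' τ) x = fill Λ' σ τ' x := by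
    intro τ' τ x hx
    rw [← hN, fill_of_notMem hx]
  have step : ∀ τ', wt β h Λ' (fill Λ' σ τ') * Ex β h Λ (fill Λ' σ τ') f =
      ∑ τ, wt β h Λ' (fill Λ' σ τ') * wt β h Λ (fill Λ' σ (N τ' τ)) * f (fill Λ' σ (N τ' τ)) /
        Zf β h Λ (fill Λ' σ τ') := by
    intro τ'
    rw [Ex, ← mul_div_assoc, Finset.mul_sum, Finset.sum_div]
    exact Finset.sum_congr rfl fun τ _ => by rw [hN]; ring
  simp only [step]
  rw [← Fintype.sum_prod_type', ← e.sum_comp]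
  simp only [e, Equiv.coe_fn_mk, hNR]
  rw [Fintype.sum_prod_type]
  refine Finset.sum_congr rfl fun τ' _ => ?_
  have : ∀ τ, wt β h Λ' (fill Λ' σ (N τ' τ)) * wt β h Λ (fill Λ' σ τ') * f (fill Λ' σ τ') /
        Zf β h Λ (fill Λ' σ (N τ' τ)) = wt β h Λ' (fill Λ' σ τ') * f (fill Λ' σ τ') /
        Zf β h Λ (fill Λ' σ τ') * wt β h Λ (fill Λ (fill Λ' σ τ') τ) := by
    intro τ
    rw [wt_swap hΛ (off τ' τ), Zf_congr (off τ' τ), hN]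
    ring
  simp only [this]
  rw [← Finset.mul_sum]
  exact div_mul_cancel₀ _ Zf_pos.ne'

lemma Ex_domain_anti (hβ : 0 ≤ β) (hΛ : Λ ⊆ Λ') (hf : Monotone f) :
    Ex β h Λ' (fun _ => true) f ≤ Ex β h Λ (fun _ => true) f := by
  rw [← Ex_dlr hΛ]
  refine (Ex_mono (g := fun _ => Ex β h Λ (fun _ => true) f) fun η _ => ?_).trans_eq (Ex_const _)
  exact Ex_bc_mono hβ (fun _ => le_top) hf

lemma Ex_local_mul (hg : ∀ η ζ : Cfg2, (∀ x ∉ Λ, η x = ζ x) → g η = g ζ) :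
    Ex β h Λ σ (fun η => g η * f η) = g σ * Ex β h Λ σ f := by
  rw [← Ex_mul_left]
  exact Ex_congr fun η hη => by rw [hg η σ hη]

/-- Spatial Markov bounds against a nonnegative function of the outside spins. -/
lemma Ex_mul_le (hβ : 0 ≤ β) (hΛ : Λ ⊆ Λ') (hf : Monotone f)
    (hg : ∀ η ζ : Cfg2, (∀ x ∉ Λ, η x = ζ x) → g η = g ζ) (hg0 : ∀ η, 0 ≤ g η) :
    Ex β h Λ' σ (fun η => g η * f η) ≤ Ex β h Λ' σ g * Ex β h Λ (fun _ => true) f := by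
  rw [← Ex_dlr hΛ, mul_comm, ← Ex_mul_left]
  refine Ex_mono fun η _ => ?_
  rw [Ex_local_mul hg, mul_comm]
  exact mul_le_mul_of_nonneg_right (Ex_bc_mono hβ (fun _ => le_top) hf) (hg0 _)

lemma le_Ex_mul (hβ : 0 ≤ β) (hΛ : Λ ⊆ Λ') (hf : Monotone f)
    (hg : ∀ η ζ : Cfg2, (∀ x ∉ Λ, η x = ζ x) → g η = g ζ) (hg0 : ∀ η, 0 ≤ g η) :
    Ex β h Λ' σ g * Ex β h Λ (fun _ => false) f ≤ Ex β h Λ' σ (fun η => g η * f η) := by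
  rw [← Ex_dlr (f := fun η => g η * f η) hΛ, mul_comm, ← Ex_mul_left]
  refine Ex_mono fun η _ => ?_
  rw [Ex_local_mul hg, mul_comm]
  exact mul_le_mul_of_nonneg_left (Ex_bc_mono hβ (fun _ => bot_le) hf) (hg0 _)

end

/-- `f` depends only on the spins in `S`. -/
def Loc (S : Finset (ℤ × ℤ)) (f : Cfg2 → ℝ) : Prop :=
  ∀ η ζ : Cfg2, (∀ x ∈ S, η x = ζ x) → f η = f ζ

lemma Loc.mono {S T : Finset (ℤ × ℤ)} {f : Cfg2 → ℝ} (hf : Loc S f) (h : S ⊆ T) : Loc T f :=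
  fun η ζ hh => hf η ζ fun x hx => hh x (h hx)

lemma Loc.mul {S T : Finset (ℤ × ℤ)} {f g : Cfg2 → ℝ} (hf : Loc S f) (hg : Loc T g) :
    Loc (S ∪ T) (fun η => f η * g η) := fun η ζ hh => by
  simp only
  rw [hf η ζ fun x hx => hh x (Finset.mem_union_left _ hx),
    hg η ζ fun x hx => hh x (Finset.mem_union_right _ hx)]

lemma Loc.add {S T : Finset (ℤ × ℤ)} {f g : Cfg2 → ℝ} (hf : Loc S f) (hg : Loc T g) :
    Loc (S ∪ T) (fun η => f η + g η) := fun η ζ hh => by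
  simp only
  rw [hf η ζ fun x hx => hh x (Finset.mem_union_left _ hx),
    hg η ζ fun x hx => hh x (Finset.mem_union_right _ hx)]

lemma Loc.comp {S : Finset (ℤ × ℤ)} {f : Cfg2 → ℝ} (hf : Loc S f) (φ : ℝ → ℝ) :
    Loc S (fun η => φ (f η)) := fun η ζ hh => by
  simp only
  rw [hf η ζ hh]

lemma loc_const (c : ℝ) : Loc ∅ (fun _ => c) := fun _ _ _ => rfl

lemma loc_sum {ι : Type*} (s : Finset ι) {S : Finset (ℤ × ℤ)} {F : ι → Cfg2 → ℝ}
    (h : ∀ i ∈ s, Loc S (F i)) : Loc S (fun η => ∑ i ∈ s, F i η) := fun η ζ hh =>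
  Finset.sum_congr rfl fun i hi => h i hi η ζ hh

lemma loc_sval {S : Finset (ℤ × ℤ)} {x : ℤ × ℤ} (hx : x ∈ S) : Loc S (fun η => sval (η x)) :=
  fun η ζ hh => by simp only; rw [hh x hx]

lemma loc_minusInd (S : Finset (ℤ × ℤ)) : Loc S (minusInd S) := fun η ζ hh => by
  have : (∀ x ∈ S, η x = false) ↔ ∀ x ∈ S, ζ x = false :=
    forall₂_congr fun x hx => by rw [hh x hx]
  simp only [minusInd, this]

lemma loc_plusInd (S : Finset (ℤ × ℤ)) : Loc S (plusInd S) := fun η ζ hh => by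
  have : (∀ x ∈ S, η x = true) ↔ ∀ x ∈ S, ζ x = true :=
    forall₂_congr fun x hx => by rw [hh x hx]
  simp only [plusInd, this]

/-- The cylinder event that `η = ζ` on `S`. -/
def cyl {ι : Type*} (S : Finset ι) (ζ : ι → Bool) : Set (ι → Bool) := {η | ∀ i ∈ S, η i = ζ i}

lemma measurableSet_cyl {ι : Type*} (S : Finset ι) (ζ : ι → Bool) : MeasurableSet (cyl S ζ) := by
  have : cyl S ζ = ⋂ i ∈ S, (fun η : ι → Bool => η i) ⁻¹' {ζ i} := by
    ext η; simp [cyl]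
  rw [this]
  exact Finset.measurableSet_biInter _ fun i _ => measurable_pi_apply i (measurableSet_singleton _)

lemma Loc.eq_sum {S : Finset (ℤ × ℤ)} {f : Cfg2 → ℝ} (hf : Loc S f) (η : Cfg2) :
    f η = ∑ τ : ↥S → Bool, f (fill S (fun _ => true) τ) *
      (cyl S (fill S (fun _ => true) τ)).indicator (fun _ => (1 : ℝ)) η := by
  classical
  rw [Finset.sum_eq_single (fun x : ↥S => η x)]
  · rw [Set.indicator_of_mem, mul_one]
    · exact hf _ _ fun x hx => by simp [fill, hx]
    · intro x hx; simp [fill, hx]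
  · intro τ _ hτ
    rw [Set.indicator_of_notMem, mul_zero]
    intro hη
    apply hτ
    ext x
    have := hη x x.2
    simp [fill] at this
    rw [this]
  · simp

lemma isingFV_cyl (β h : ℝ) (Λ : Finset (ℤ × ℤ)) (σ : Cfg2) (A : Set Cfg2) (hA : MeasurableSet A) :
    (isingFV β h Λ σ A).toReal = Ex β h Λ σ (A.indicator fun _ => 1) := by
  classical
  unfold isingFV
  simp only [isingWeight_fill, Measure.smul_apply, Measure.finsetSum_apply, smul_eq_mul,
    Measure.dirac_apply' _ hA]
  rw [ENNReal.toReal_mul, ENNReal.toReal_inv, ENNReal.toReal_sum (by simp), ENNReal.toReal_sum]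
  · rw [Ex, div_eq_inv_mul]
    congr 1
    · congr 1
      exact Finset.sum_congr rfl fun τ _ => ENNReal.toReal_ofReal (wt_pos _ _ _ _).le
    · refine Finset.sum_congr rfl fun τ _ => ?_
      rw [ENNReal.toReal_mul, ENNReal.toReal_ofReal (wt_pos _ _ _ _).le]
      congr 1
      by_cases h : fill Λ σ τ ∈ A <;> simp [h]
  · intro τ _
    refine ENNReal.mul_ne_top ENNReal.ofReal_ne_top ?_
    by_cases h : fill Λ σ τ ∈ A <;> simp [h]

/-- Expectation in the infinite-volume measure. -/
def Ev (μ : Measure Cfg2) (f : Cfg2 → ℝ) : ℝ := ∫ η, f η ∂μ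

lemma Loc.integrable {S : Finset (ℤ × ℤ)} {f : Cfg2 → ℝ} (hf : Loc S f) (μ : Measure Cfg2)
    [IsFiniteMeasure μ] : Integrable f μ := by
  have : f = fun η => ∑ τ : ↥S → Bool, f (fill S (fun _ => true) τ) *
      (cyl S (fill S (fun _ => true) τ)).indicator (fun _ => (1 : ℝ)) η := funext hf.eq_sum
  rw [this]
  refine integrable_finsetSum _ fun τ _ => Integrable.const_mul ?_ _
  exact (integrable_const 1).indicator (measurableSet_cyl _ _)

lemma Ev_eq_sum {S : Finset (ℤ × ℤ)} {f : Cfg2 → ℝ} (hf : Loc S f) (μ : Measure Cfg2)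
    [IsFiniteMeasure μ] : Ev μ f = ∑ τ : ↥S → Bool, f (fill S (fun _ => true) τ) *
      (μ (cyl S (fill S (fun _ => true) τ))).toReal := by
  unfold Ev
  rw [integral_congr_ae (Eventually.of_forall hf.eq_sum), integral_finsetSum]
  · refine Finset.sum_congr rfl fun τ _ => ?_
    rw [integral_const_mul, integral_indicator_const _ (measurableSet_cyl _ _)]
    simp [Measure.real]
  · intro τ _
    refine Integrable.const_mul ?_ _
    exact (integrable_const 1).indicator (measurableSet_cyl _ _)

lemma Ex_tendsto {β h : ℝ} {μ : Measure Cfg2} (hμ : IsPlusPhase β h μ) {S : Finset (ℤ × ℤ)}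
    {f : Cfg2 → ℝ} (hf : Loc S f) :
    Tendsto (fun n => Ex β h (box n) (fun _ => true) f) atTop (𝓝 (Ev μ f)) := by
  have := hμ.1
  rw [Ev_eq_sum hf]
  have e : ∀ n, Ex β h (box n) (fun _ => true) f = ∑ τ : ↥S → Bool,
      f (fill S (fun _ => true) τ) *
        (isingFV β h (box n) (fun _ => true) (cyl S (fill S (fun _ => true) τ))).toReal := by
    intro n
    simp_rw [isingFV_cyl _ _ _ _ _ (measurableSet_cyl _ _), ← Ex_mul_left]
    rw [← Ex_sum]
    exact Ex_congr fun η _ => hf.eq_sum η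
  simp_rw [e]
  refine tendsto_finsetSum _ fun τ _ => Tendsto.const_mul _ ?_
  exact (ENNReal.tendsto_toReal (measure_ne_top _ _)).comp (hμ.2 S _)

lemma box_mono {m n : ℕ} (h : m ≤ n) : box m ⊆ box n := by
  unfold box
  have : (m : ℤ) ≤ n := by exact_mod_cast h
  exact Finset.product_subset_product (Finset.Icc_subset_Icc (by omega) this)
    (Finset.Icc_subset_Icc (by omega) this)

lemma mem_box {n : ℕ} {x : ℤ × ℤ} : x ∈ box n ↔ x.1.natAbs ≤ n ∧ x.2.natAbs ≤ n := by
  simp only [box, Finset.mem_product, Finset.mem_Icc]; omega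

lemma exists_subset_box (S : Finset (ℤ × ℤ)) : ∃ n, S ⊆ box n := by
  refine ⟨S.sup fun x => max x.1.natAbs x.2.natAbs, fun x hx => ?_⟩
  have := Finset.le_sup (f := fun x : ℤ × ℤ => max x.1.natAbs x.2.natAbs) hx
  rw [mem_box]
  exact ⟨(le_max_left _ _).trans this, (le_max_right _ _).trans this⟩

lemma eventually_subset_box (S : Finset (ℤ × ℤ)) : ∀ᶠ n in atTop, S ⊆ box n := by
  obtain ⟨n, hn⟩ := exists_subset_box S
  filter_upwards [eventually_ge_atTop n] with m hm using hn.trans (box_mono hm)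

section
variable {β h : ℝ} {μ : Measure Cfg2} {Λ S T U : Finset (ℤ × ℤ)} {f g F : Cfg2 → ℝ}

lemma Ev_const (hμ : IsPlusPhase β h μ) (c : ℝ) : Ev μ (fun _ => c) = c := by
  have := hμ.1
  simp [Ev]

lemma Ev_add (hμ : IsPlusPhase β h μ) (hf : Loc S f) (hg : Loc T g) :
    Ev μ (fun η => f η + g η) = Ev μ f + Ev μ g := by
  have := hμ.1
  exact integral_add (hf.integrable μ) (hg.integrable μ)

lemma Ev_mul_left (c : ℝ) : Ev μ (fun η => c * f η) = c * Ev μ f := integral_const_mul _ _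

lemma Ev_neg : Ev μ (fun η => - f η) = - Ev μ f := integral_neg _

lemma Ev_sum (hμ : IsPlusPhase β h μ) {ι : Type*} (s : Finset ι) {F : ι → Cfg2 → ℝ}
    (hF : ∀ i ∈ s, Loc S (F i)) :
    Ev μ (fun η => ∑ i ∈ s, F i η) = ∑ i ∈ s, Ev μ (F i) := by
  have := hμ.1
  exact integral_finsetSum _ fun i hi => (hF i hi).integrable μ

lemma Ev_mono (hμ : IsPlusPhase β h μ) (hf : Loc S f) (hg : Loc T g) (hfg : ∀ η, f η ≤ g η) :
    Ev μ f ≤ Ev μ g := by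
  have := hμ.1
  exact integral_mono (hf.integrable μ) (hg.integrable μ) hfg

lemma Ev_nonneg (hf : ∀ η, 0 ≤ f η) : 0 ≤ Ev μ f := integral_nonneg hf

lemma Ev_fkg (hμ : IsPlusPhase β h μ) (hβ : 0 ≤ β) (hF : SuperMod F) (hf : Monotone f)
    (hg : Monotone g) (hFl : Loc U F) (hfl : Loc S f) (hgl : Loc T g) :
    Ev μ (fun η => F η * f η) * Ev μ (fun η => F η * g η) ≤
      Ev μ F * Ev μ (fun η => F η * (f η * g η)) :=
  le_of_tendsto_of_tendsto' ((Ex_tendsto hμ (hFl.mul hfl)).mul (Ex_tendsto hμ (hFl.mul hgl)))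
    ((Ex_tendsto hμ hFl).mul (Ex_tendsto hμ (hFl.mul (hfl.mul hgl))))
    fun _ => Ex_fkg hβ hF hf hg

lemma Ev_le_Ex (hμ : IsPlusPhase β h μ) (hβ : 0 ≤ β) (hf : Monotone f) (hfl : Loc S f)
    (Λ : Finset (ℤ × ℤ)) : Ev μ f ≤ Ex β h Λ (fun _ => true) f := by
  refine le_of_tendsto (Ex_tendsto hμ hfl) ?_
  filter_upwards [eventually_subset_box Λ] with n hn using Ex_domain_anti hβ hn hf

lemma Loc.off (hg : Loc S g) (hS : Disjoint S Λ) :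
    ∀ η ζ : Cfg2, (∀ x ∉ Λ, η x = ζ x) → g η = g ζ :=
  fun η ζ h => hg η ζ fun x hx => h x (Finset.disjoint_left.1 hS hx)

lemma Ev_mul_le (hμ : IsPlusPhase β h μ) (hβ : 0 ≤ β) (hf : Monotone f) (hfl : Loc S f)
    (hgl : Loc T g) (hT : Disjoint T Λ) (hg0 : ∀ η, 0 ≤ g η) :
    Ev μ (fun η => g η * f η) ≤ Ev μ g * Ex β h Λ (fun _ => true) f := by
  refine le_of_tendsto_of_tendsto (Ex_tendsto hμ (hgl.mul hfl))
    ((Ex_tendsto hμ hgl).mul_const _) ?_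
  filter_upwards [eventually_subset_box Λ] with n hn using
    Ex_mul_le hβ hn hf (hgl.off hT) hg0

lemma le_Ev_mul (hμ : IsPlusPhase β h μ) (hβ : 0 ≤ β) (hf : Monotone f) (hfl : Loc S f)
    (hgl : Loc T g) (hT : Disjoint T Λ) (hg0 : ∀ η, 0 ≤ g η) :
    Ev μ g * Ex β h Λ (fun _ => false) f ≤ Ev μ (fun η => g η * f η) := by
  refine le_of_tendsto_of_tendsto
    ((Ex_tendsto hμ hgl).mul_const _) (Ex_tendsto hμ (hgl.mul hfl)) ?_
  filter_upwards [eventually_subset_box Λ] with n hn using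
    le_Ex_mul hβ hn hf (hgl.off hT) hg0

/-- The configuration moved by `d`. -/
def shiftC (d : ℤ × ℤ) (η : Cfg2) : Cfg2 := fun x => η (x + d)

lemma wt_shift (d : ℤ × ℤ) (η : Cfg2) :
    wt β h (Λ.image (· + d)) η = wt β h Λ (shiftC d η) := by
  have hi : Function.Injective (fun x : ℤ × ℤ => x + d) := add_left_injective d
  have hm : ∀ x, x + d ∈ Λ.image (· + d) ↔ x ∈ Λ := fun x => by
    simp
  have hs : bondSites (Λ.image (· + d)) = (bondSites Λ).image (· + d) := by
    simp only [bondSites, Finset.image_union, Finset.image_image]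
    congr 1
    · congr 1
      refine Finset.image_congr fun x _ => by simp only [Function.comp]; abel
    · refine Finset.image_congr fun x _ => by simp only [Function.comp]; abel
  rw [wt_eq β h _ _ subset_rfl, wt_eq β h _ _ subset_rfl, hs, Finset.sum_image (hi.injOn),
    Finset.sum_image (hi.injOn)]
  congr 3
  refine Finset.sum_congr rfl fun x _ => ?_
  have h1 : x + d + (1, 0) = x + (1, 0) + d := by abel
  have h2 : x + d + (0, 1) = x + (0, 1) + d := by abel
  simp only [bondE, touch, shiftC, h1, h2, hm]

lemma Ex_shift (d : ℤ × ℤ) (σ : Cfg2) :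
    Ex β h (Λ.image (· + d)) σ f = Ex β h Λ (shiftC d σ) (fun η => f (shiftC (-d) η)) := by
  have hi : Function.Injective (fun x : ℤ × ℤ => x + d) := add_left_injective d
  let e : ↥Λ ≃ ↥(Λ.image (· + d)) :=
    { toFun := fun x => ⟨x + d, Finset.mem_image_of_mem _ x.2⟩
      invFun := fun x => ⟨x - d, by
        obtain ⟨y, hy, h⟩ := Finset.mem_image.1 x.2
        rw [← h]; simpa using hy⟩
      left_inv := fun x => by simp
      right_inv := fun x => by simp }
  have hf : ∀ τ : ↥Λ → Bool, shiftC d (fill (Λ.image (· + d)) σ (e.arrowCongr (Equiv.refl _) τ)) =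
      fill Λ (shiftC d σ) τ := by
    intro τ; ext x
    by_cases hx : x ∈ Λ
    · have : x + d ∈ Λ.image (· + d) := Finset.mem_image_of_mem _ hx
      rw [fill_of_mem hx]
      show fill (Λ.image (· + d)) σ _ (x + d) = _
      rw [fill_of_mem this]
      simp [e]
    · have : x + d ∉ Λ.image (· + d) := by simpa using hx
      rw [fill_of_notMem hx]
      show fill (Λ.image (· + d)) σ _ (x + d) = _
      rw [fill_of_notMem this]; rfl
  have hinv : ∀ η, shiftC (-d) (shiftC d η) = η := fun η => by ext x; simp [shiftC]
  rw [Ex, Ex, Zf, Zf, ← (e.arrowCongr (Equiv.refl Bool)).sum_comp,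
    ← (e.arrowCongr (Equiv.refl Bool)).sum_comp]
  simp only [wt_shift, ← hf, hinv]

lemma Loc.shift (hf : Loc S f) (d : ℤ × ℤ) :
    Loc (S.image (· + d)) (fun η => f (shiftC d η)) := fun _ _ h =>
  hf _ _ fun _ hx => h _ (Finset.mem_image_of_mem _ hx)

lemma shiftC_mono (d : ℤ × ℤ) : Monotone (shiftC d) := fun _ _ h x => h (x + d)

lemma Ev_shift_le (hμ : IsPlusPhase β h μ) (hβ : 0 ≤ β) (hf : Monotone f) (hfl : Loc S f)
    (d : ℤ × ℤ) : Ev μ (fun η => f (shiftC d η)) ≤ Ev μ f := by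
  refine ge_of_tendsto' (Ex_tendsto hμ hfl) fun n => ?_
  have := Ev_le_Ex hμ hβ (hf.comp (shiftC_mono d)) (hfl.shift d) ((box n).image (· + d))
  rw [Ex_shift] at this
  refine this.trans_eq ?_
  have h1 : shiftC d (fun _ => true) = fun _ => true := rfl
  rw [h1]
  refine Ex_congr fun η _ => ?_
  simp only [Function.comp]
  congr 1; ext x; simp [shiftC]

/-- Translation invariance of the plus phase on local monotone functions. -/
lemma Ev_shift (hμ : IsPlusPhase β h μ) (hβ : 0 ≤ β) (hf : Monotone f) (hfl : Loc S f)
    (d : ℤ × ℤ) : Ev μ (fun η => f (shiftC d η)) = Ev μ f := by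
  refine le_antisymm (Ev_shift_le hμ hβ hf hfl d) ?_
  have := Ev_shift_le hμ hβ (hf.comp (shiftC_mono d)) (hfl.shift d) (-d)
  refine le_trans (le_of_eq ?_) this
  congr 1; ext η; simp only [Function.comp]; congr 1; ext x; simp [shiftC]

end

/-- Probability that all spins in `S` are minus. -/
def Pm (μ : Measure Cfg2) (S : Finset (ℤ × ℤ)) : ℝ := Ev μ (minusInd S)

/-- Expectation conditioned with the density `G`. -/
def cE (μ : Measure Cfg2) (G f : Cfg2 → ℝ) : ℝ := Ev μ (fun η => G η * f η) / Ev μ G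

/-- The sites `(i, 0)` with `-m ≤ i ≤ -n`. -/
def slit (n m : ℕ) : Finset (ℤ × ℤ) := (Finset.Icc (-(m : ℤ)) (-(n : ℤ))).image fun i => (i, 0)

section
variable {β h : ℝ} {μ : Measure Cfg2} {Λ S T U A B : Finset (ℤ × ℤ)} {f g F G : Cfg2 → ℝ}

lemma neg_mono_of_antitone (hf : Antitone f) : Monotone fun η => - f η := fun _ _ h => neg_le_neg (hf h)

lemma Ex_le_Ev (hμ : IsPlusPhase β h μ) (hβ : 0 ≤ β) (hf : Antitone f) (hfl : Loc S f)
    (Λ : Finset (ℤ × ℤ)) : Ex β h Λ (fun _ => true) f ≤ Ev μ f := by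
  have := Ev_le_Ex hμ hβ (neg_mono_of_antitone hf) (hfl.comp fun x => -x) Λ
  rw [Ev_neg, Ex_neg] at this
  linarith

lemma Ex_pos_of_nonneg {σ : Cfg2} (hf : ∀ η, 0 ≤ f η) (τ : ↥Λ → Bool) (hτ : 0 < f (fill Λ σ τ)) :
    0 < Ex β h Λ σ f := by
  refine div_pos (Finset.sum_pos' (fun τ _ => mul_nonneg (wt_pos _ _ _ _).le (hf _)) ?_) Zf_pos
  exact ⟨τ, Finset.mem_univ _, mul_pos (wt_pos _ _ _ _) hτ⟩

lemma Pm_pos (hμ : IsPlusPhase β h μ) (hβ : 0 ≤ β) (S : Finset (ℤ × ℤ)) : 0 < Pm μ S := by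
  refine lt_of_lt_of_le ?_ (Ex_le_Ev hμ hβ (minusInd_antitone S) (loc_minusInd S) S)
  refine Ex_pos_of_nonneg (minusInd_nonneg S) (fun _ => false) ?_
  unfold minusInd
  rw [if_pos fun x hx => by simp [fill, hx]]
  exact one_pos

/-- Conditioning on more minuses increases decreasing observables. -/
lemma cE_mono (hμ : IsPlusPhase β h μ) (hβ : 0 ≤ β) (hAB : A ⊆ B) (hf : Antitone f)
    (hfl : Loc S f) : cE μ (minusInd A) f ≤ cE μ (minusInd B) f := by
  have pA : 0 < Ev μ (minusInd A) := Pm_pos hμ hβ A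
  have pB : 0 < Ev μ (minusInd B) := Pm_pos hμ hβ B
  rw [cE, cE, div_le_div_iff₀ pA pB]
  have key := Ev_fkg hμ hβ (superMod_minusInd A) (neg_mono_of_antitone hf)
    (neg_mono_of_antitone (minusInd_antitone B)) (loc_minusInd A) (hfl.comp fun x => -x)
    ((loc_minusInd B).comp fun x => -x)
  have e : ∀ η, minusInd A η * minusInd B η = minusInd B η := fun η => by
    rw [← minusInd_union, Finset.union_eq_right.2 hAB]
  have e1 : (fun η => minusInd A η * - minusInd B η) = fun η => - minusInd B η := by
    ext η; rw [mul_neg, e]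
  have e2 : (fun η => minusInd A η * (- f η * - minusInd B η)) =
      fun η => minusInd B η * f η := by
    ext η; rw [neg_mul_neg, ← mul_assoc, mul_right_comm, e]
  have e3 : (fun η => minusInd A η * - f η) = fun η => - (minusInd A η * f η) := by
    ext η; ring
  rw [e1, e2, e3, Ev_neg, Ev_neg] at key
  linarith

lemma cE_empty (hμ : IsPlusPhase β h μ) : cE μ (minusInd ∅) f = Ev μ f := by
  have : (minusInd ∅ : Cfg2 → ℝ) = fun _ => 1 := by ext; simp [minusInd]
  simp [cE, this, Ev_const hμ]

lemma Ev_le_cE (hμ : IsPlusPhase β h μ) (hβ : 0 ≤ β) (hf : Antitone f)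
    (hfl : Loc S f) : Ev μ f ≤ cE μ (minusInd A) f := by
  rw [← cE_empty hμ]; exact cE_mono hμ hβ (Finset.empty_subset _) hf hfl

lemma cE_add (hμ : IsPlusPhase β h μ) (hG : Loc U G) (hf : Loc S f) (hg : Loc T g) :
    cE μ G (fun η => f η + g η) = cE μ G f + cE μ G g := by
  simp only [cE, mul_add]
  rw [Ev_add hμ (hG.mul hf) (hG.mul hg), add_div]

lemma cE_mul_left (c : ℝ) : cE μ G (fun η => c * f η) = c * cE μ G f := by
  simp only [cE, mul_left_comm _ c]
  rw [Ev_mul_left, mul_div_assoc]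

lemma cE_sum (hμ : IsPlusPhase β h μ) (hG : Loc U G) {ι : Type*} (s : Finset ι)
    {F : ι → Cfg2 → ℝ} (hF : ∀ i ∈ s, Loc S (F i)) :
    cE μ G (fun η => ∑ i ∈ s, F i η) = ∑ i ∈ s, cE μ G (F i) := by
  simp only [cE, Finset.mul_sum]
  rw [Ev_sum hμ s fun i hi => hG.mul (hF i hi), Finset.sum_div]

lemma minusInd_singleton (x : ℤ × ℤ) (η : Cfg2) : minusInd {x} η = (1 - sval (η x)) / 2 := by
  unfold minusInd
  cases hx : η x <;> simp [hx, sval]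

/-- The sum of the site indicators minus the joint indicator is decreasing. -/
lemma antitone_sum_sub (S : Finset (ℤ × ℤ)) :
    Antitone fun η => ∑ x ∈ S, minusInd {x} η - minusInd S η := by
  intro a b hab
  simp only
  have h1 : ∀ x ∈ S, minusInd {x} b ≤ minusInd {x} a := fun x _ => minusInd_antitone {x} hab
  by_cases hS : ∀ x ∈ S, b x = false
  · have : minusInd S b = 1 := if_pos hS
    have := minusInd_le_one S a
    have := Finset.sum_le_sum h1
    linarith
  by_cases hSa : ∀ x ∈ S, a x = false
  · rw [not_forall] at hS
    obtain ⟨x, hx⟩ := hS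
    rw [not_forall] at hx
    obtain ⟨hxS, hx⟩ := hx
    have e1 : minusInd S b = 0 := if_neg fun h => hx (h x hxS)
    have e2 : minusInd S a = 1 := if_pos hSa
    have e3 : minusInd {x} b = 0 := if_neg fun h => hx (h x (Finset.mem_singleton_self x))
    have e4 : minusInd {x} a = 1 := if_pos fun y hy => by
      rw [Finset.mem_singleton] at hy; rw [hy]; exact hSa x hxS
    rw [← Finset.add_sum_erase _ _ hxS, ← Finset.add_sum_erase _ _ hxS]
    have := Finset.sum_le_sum fun y hy => h1 y (Finset.mem_of_mem_erase (a := x) hy)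
    linarith
  · have e1 : minusInd S b = 0 := if_neg hS
    have e2 : minusInd S a = 0 := if_neg hSa
    have := Finset.sum_le_sum h1
    linarith

lemma loc_sum_minusInd (S : Finset (ℤ × ℤ)) : Loc S (fun η => ∑ x ∈ S, minusInd {x} η) :=
  loc_sum S fun x hx => (loc_minusInd {x}).mono (Finset.singleton_subset_iff.2 hx)

lemma cE_le_sum (hμ : IsPlusPhase β h μ) (hβ : 0 ≤ β) (A S : Finset (ℤ × ℤ)) :
    cE μ (minusInd A) (minusInd S) - Pm μ S ≤
      ∑ x ∈ S, (cE μ (minusInd A) (minusInd {x}) - Pm μ {x}) := by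
  have hl : ∀ x ∈ S, Loc S (minusInd {x}) := fun x hx =>
    (loc_minusInd {x}).mono (Finset.singleton_subset_iff.2 hx)
  have e0 : ∀ η, ∑ x ∈ S, minusInd {x} η - minusInd S η =
    ∑ x ∈ S, minusInd {x} η + (-1) * minusInd S η := fun η => by ring
  have key := Ev_le_cE (A := A) hμ hβ (antitone_sum_sub S)
    ((loc_sum_minusInd S).add (((loc_minusInd S).comp fun x => -x)))
  simp only [e0] at key
  rw [cE_add hμ (loc_minusInd A) (loc_sum_minusInd S) ((loc_minusInd S).comp fun x => -1 * x),
    Ev_add hμ (loc_sum_minusInd S) ((loc_minusInd S).comp fun x => -1 * x), cE_mul_left,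
    Ev_mul_left, cE_sum hμ (loc_minusInd A) S hl, Ev_sum hμ S hl] at key
  rw [Finset.sum_sub_distrib]
  unfold Pm
  linarith

/-- Single-site convergence at `x` of the measures conditioned on receding slits. -/
def SiteConv (μ : Measure Cfg2) (x : ℤ × ℤ) : Prop :=
  ∀ ε > 0, ∃ n₀, ∀ n ≥ n₀, ∀ m, cE μ (minusInd (slit n m)) (minusInd {x}) ≤ Pm μ {x} + ε

lemma mem_slit {n m : ℕ} {x : ℤ × ℤ} : x ∈ slit n m ↔ -(m : ℤ) ≤ x.1 ∧ x.1 ≤ -(n : ℤ) ∧ x.2 = 0 := by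
  obtain ⟨a, b⟩ := x
  simp only [slit, Finset.mem_image, Finset.mem_Icc, Prod.mk.injEq]
  constructor
  · rintro ⟨i, h, rfl, rfl⟩; exact ⟨h.1, h.2, rfl⟩
  · rintro ⟨h1, h2, h3⟩; exact ⟨a, ⟨h1, h2⟩, rfl, h3.symm⟩

lemma eventually_disjoint_slit (S : Finset (ℤ × ℤ)) :
    ∃ n₀, ∀ n ≥ n₀, ∀ m, Disjoint (slit n m) S := by
  obtain ⟨k, hk⟩ := exists_subset_box S
  refine ⟨k + 1, fun n hn m => Finset.disjoint_left.2 fun x hx hS => ?_⟩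
  have h1 := mem_box.1 (hk hS)
  have h2 := mem_slit.1 hx
  omega

lemma sum_singleton_fun {x : ℤ × ℤ} (F : (↥({x} : Finset (ℤ × ℤ)) → Bool) → ℝ) :
    ∑ τ, F τ = F (fun _ => true) + F (fun _ => false) := by
  have : Unique ↥({x} : Finset (ℤ × ℤ)) :=
    ⟨⟨⟨x, Finset.mem_singleton_self x⟩⟩, fun y => Subtype.ext (Finset.mem_singleton.1 y.2)⟩
  rw [← (Equiv.funUnique ↥({x} : Finset (ℤ × ℤ)) Bool).symm.sum_comp]
  simp only [Fintype.sum_bool]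
  rfl

/-- The sum of the neighbouring spins. -/
def nbrSum (x : ℤ × ℤ) (η : Cfg2) : ℝ := ∑ y ∈ nbrs x, sval (η y)

lemma notMem_nbrs (x : ℤ × ℤ) : x ∉ nbrs x := by
  obtain ⟨a, b⟩ := x
  simp only [nbrs, Finset.mem_insert, Finset.mem_singleton, Prod.mk.injEq]
  omega

lemma wt_singleton (x : ℤ × ℤ) (η : Cfg2) :
    wt β h {x} η = Real.exp (sval (η x) * (β * nbrSum x η - h)) := by
  unfold wt isingWeight
  congr 1
  have h1 : ({x} : Finset (ℤ × ℤ)).filter (fun y => y ∈ nbrs x) = ∅ := by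
    ext y
    simp only [Finset.mem_filter, Finset.mem_singleton, Finset.notMem_empty, iff_false, not_and]
    rintro rfl; exact notMem_nbrs _
  have h2 : (nbrs x).filter (fun y => y ∉ ({x} : Finset (ℤ × ℤ))) = nbrs x := by
    refine Finset.filter_true_of_mem fun y hy hyx => ?_
    rw [Finset.mem_singleton] at hyx
    exact notMem_nbrs x (hyx ▸ hy)
  simp only [Finset.sum_singleton, h1, h2, Finset.sum_empty, nbrSum, ← Finset.mul_sum]
  ring

lemma nbrSum_fill (x : ℤ × ℤ) (η : Cfg2) (τ) : nbrSum x (fill {x} η τ) = nbrSum x η := by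
  unfold nbrSum
  refine Finset.sum_congr rfl fun y hy => ?_
  have : y ∉ ({x} : Finset (ℤ × ℤ)) := by
    rw [Finset.mem_singleton]; rintro rfl; exact notMem_nbrs _ hy
  rw [fill_of_notMem this]

lemma Ex_singleton (x : ℤ × ℤ) (η : Cfg2) : Ex β h {x} η (minusInd {x}) =
    1 / (1 + Real.exp (2 * (β * nbrSum x η - h))) := by
  unfold Ex Zf
  rw [sum_singleton_fun, sum_singleton_fun]
  have hx : x ∈ ({x} : Finset (ℤ × ℤ)) := Finset.mem_singleton_self x
  simp only [minusInd_singleton, wt_singleton, fill_of_mem hx, nbrSum_fill, sval_true, sval_false]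
  set a := β * nbrSum x η - h
  have : Real.exp (2 * a) = Real.exp (1 * a) / Real.exp (-1 * a) := by
    rw [← Real.exp_sub]; congr 1; ring
  rw [this]
  have := Real.exp_pos (-1 * a)
  have := Real.exp_pos (1 * a)
  field_simp
  ring

lemma nbrSum_bound (x : ℤ × ℤ) (η : Cfg2) : |nbrSum x η| ≤ 4 := by
  unfold nbrSum
  rw [sum_nbrs x (fun y => sval (η y))]
  have h1 := abs_sval (η (x + (1, 0)))
  have h2 := abs_sval (η (x + (0, 1)))
  have h3 := abs_sval (η (x - (1, 0)))
  have h4 := abs_sval (η (x - (0, 1)))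
  refine (abs_add_le _ _).trans ?_
  have := (abs_add_le (sval (η (x + (1, 0))) + sval (η (x + (0, 1)))) (sval (η (x - (1, 0)))))
  have := (abs_add_le (sval (η (x + (1, 0)))) (sval (η (x + (0, 1)))))
  linarith

/-- The single-site conditional probability reacts to its neighbours by at least a constant. -/
lemma exists_antitone_margin (hβ : 0 < β) (h : ℝ) (x : ℤ × ℤ) : ∃ c > 0,
    Antitone fun η : Cfg2 => Ex β h {x} η (minusInd {x}) - c * ∑ y ∈ nbrs x, minusInd {y} η := by
  set M := Real.exp (2 * (β * 4 - h)) with hM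
  set m := Real.exp (2 * (β * (-4) - h)) with hm
  have hMp : 0 < M := Real.exp_pos _
  have hmp : 0 < m := Real.exp_pos _
  refine ⟨4 * β * m / ((1 + M) * (1 + M)), by positivity, fun a b hab => ?_⟩
  have hs : ∑ y ∈ nbrs x, minusInd {y} a - ∑ y ∈ nbrs x, minusInd {y} b =
      (nbrSum x b - nbrSum x a) / 2 := by
    unfold nbrSum
    rw [← Finset.sum_sub_distrib, ← Finset.sum_sub_distrib, Finset.sum_div]
    exact Finset.sum_congr rfl fun y _ => by rw [minusInd_singleton, minusInd_singleton]; ring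
  have hle : nbrSum x a ≤ nbrSum x b := Finset.sum_le_sum fun y _ => sval_mono (hab y)
  have ba := abs_le.1 (nbrSum_bound x a)
  have bb := abs_le.1 (nbrSum_bound x b)
  simp only [Ex_singleton]
  set u := nbrSum x a
  set v := nbrSum x b
  set X := Real.exp (2 * (β * u - h)) with hX
  set Y := Real.exp (2 * (β * v - h)) with hY
  have hX0 : 0 < X := Real.exp_pos _
  have hY0 : 0 < Y := Real.exp_pos _
  have hXm : m ≤ X := Real.exp_le_exp.2 (by nlinarith)
  have hXM : X ≤ M := Real.exp_le_exp.2 (by nlinarith)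
  have hYM : Y ≤ M := Real.exp_le_exp.2 (by nlinarith)
  have hYX : X * (1 + 2 * β * (v - u)) ≤ Y := by
    have : Y = X * Real.exp (2 * β * (v - u)) := by
      rw [hX, hY, ← Real.exp_add]; congr 1; ring
    rw [this]
    refine mul_le_mul_of_nonneg_left ?_ hX0.le
    have := Real.add_one_le_exp (2 * β * (v - u)); linarith
  have hd : 0 ≤ v - u := by linarith
  have key : 4 * β * m / ((1 + M) * (1 + M)) * ((v - u) / 2) ≤ 1 / (1 + X) - 1 / (1 + Y) := by
    have e : 1 / (1 + X) - 1 / (1 + Y) = (Y - X) / ((1 + X) * (1 + Y)) := by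
      field_simp; ring
    rw [e]
    calc 4 * β * m / ((1 + M) * (1 + M)) * ((v - u) / 2) =
        (2 * β * (v - u) * m) / ((1 + M) * (1 + M)) := by ring
      _ ≤ (Y - X) / ((1 + M) * (1 + M)) := by
        refine div_le_div_of_nonneg_right ?_ (by positivity)
        have : 2 * β * (v - u) * m ≤ 2 * β * (v - u) * X :=
          mul_le_mul_of_nonneg_left hXm (by positivity)
        linarith
      _ ≤ _ := by
        refine div_le_div_of_nonneg_left ?_ (by positivity) (by gcongr)
        have : 0 ≤ X * (2 * β * (v - u)) := by positivity
        linarith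
  have : 4 * β * m / ((1 + M) * (1 + M)) * (∑ y ∈ nbrs x, minusInd {y} a) =
    4 * β * m / ((1 + M) * (1 + M)) * (∑ y ∈ nbrs x, minusInd {y} b) +
    4 * β * m / ((1 + M) * (1 + M)) * ((v - u) / 2) := by rw [← hs]; ring
  linarith

lemma loc_Ex (x : ℤ × ℤ) : Loc (nbrs x) (fun η => Ex β h {x} η (minusInd {x})) := by
  intro η ζ hh
  simp only [Ex_singleton]
  have : nbrSum x η = nbrSum x ζ := Finset.sum_congr rfl fun y hy => by rw [hh y hy]
  rw [this]

lemma Ev_dlr (hμ : IsPlusPhase β h μ) (x : ℤ × ℤ) (hgl : Loc T g) (hx : x ∉ T) :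
    Ev μ (fun η => g η * minusInd {x} η) =
      Ev μ (fun η => g η * Ex β h {x} η (minusInd {x})) := by
  refine tendsto_nhds_unique (Ex_tendsto hμ (hgl.mul (loc_minusInd {x}))) ?_
  refine (Ex_tendsto hμ (hgl.mul (loc_Ex x))).congr' ?_
  filter_upwards [eventually_subset_box {x}] with n hn
  rw [← Ex_dlr (f := fun η => g η * minusInd {x} η) hn]
  refine Ex_congr fun η _ => ?_
  rw [Ex_local_mul (hgl.off (by simpa using hx))]

lemma SiteConv.nbr (hμ : IsPlusPhase β h μ) (hβ : 0 < β) {x y : ℤ × ℤ} (hx : SiteConv μ x)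
    (hy : y ∈ nbrs x) : SiteConv μ y := by
  obtain ⟨c, hc, hanti⟩ := exists_antitone_margin hβ h x
  intro ε hε
  obtain ⟨n₀, hn₀⟩ := hx (c * ε) (by positivity)
  obtain ⟨n₁, hn₁⟩ := eventually_disjoint_slit {x}
  refine ⟨max n₀ n₁, fun n hn m => ?_⟩
  have h0 := hn₀ n ((le_max_left _ _).trans hn) m
  have h1 := hn₁ n ((le_max_right _ _).trans hn) m
  rw [Finset.disjoint_singleton_right] at h1
  set A := slit n m
  have hl : ∀ z ∈ nbrs x, Loc (nbrs x) (minusInd {z}) := fun z hz =>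
    (loc_minusInd {z}).mono (Finset.singleton_subset_iff.2 hz)
  have hls : Loc (nbrs x) (fun η => -c * ∑ z ∈ nbrs x, minusInd {z} η) :=
    (loc_sum_minusInd (nbrs x)).comp fun t => -c * t
  have e0 : ∀ η : Cfg2, Ex β h {x} η (minusInd {x}) - c * ∑ y ∈ nbrs x, minusInd {y} η =
    Ex β h {x} η (minusInd {x}) + -c * ∑ y ∈ nbrs x, minusInd {y} η := fun η => by ring
  simp only [e0] at hanti
  have key := Ev_le_cE (A := A) hμ hβ.le hanti ((loc_Ex x).add hls)
  rw [cE_add hμ (loc_minusInd A) (loc_Ex x) hls, Ev_add hμ (loc_Ex x) hls, cE_mul_left,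
    Ev_mul_left, cE_sum hμ (loc_minusInd A) _ hl, Ev_sum hμ _ hl] at key
  have e1 : cE μ (minusInd A) (fun η => Ex β h {x} η (minusInd {x})) =
      cE μ (minusInd A) (minusInd {x}) := by
    rw [cE, cE, Ev_dlr hμ x (loc_minusInd A) h1]
  have e2 : Ev μ (fun η => Ex β h {x} η (minusInd {x})) = Pm μ {x} := by
    have := Ev_dlr hμ x (loc_const 1) (Finset.notMem_empty x)
    simpa [Pm] using this.symm
  rw [e1, e2] at key
  have e3 : cE μ (minusInd A) (minusInd {y}) - Ev μ (minusInd {y}) ≤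
      ∑ z ∈ nbrs x, (cE μ (minusInd A) (minusInd {z}) - Ev μ (minusInd {z})) :=
    Finset.single_le_sum (f := fun z => cE μ (minusInd A) (minusInd {z}) - Ev μ (minusInd {z}))
      (fun z _ => sub_nonneg.2 (Ev_le_cE hμ hβ.le (minusInd_antitone {z}) (loc_minusInd {z}))) hy
  rw [Finset.sum_sub_distrib] at e3
  have e4 := mul_le_mul_of_nonneg_left e3 hc.le
  have : c * (cE μ (minusInd A) (minusInd {y}) - Ev μ (minusInd {y})) ≤ c * ε := by linarith
  have := le_of_mul_le_mul_left this hc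
  unfold Pm
  linarith

lemma SiteConv.all (hμ : IsPlusPhase β h μ) (hβ : 0 < β) (h0 : SiteConv μ 0) (x : ℤ × ℤ) :
    SiteConv μ x := by
  obtain ⟨a, b⟩ := x
  have ha : SiteConv μ (a, 0) := by
    induction a using Int.induction_on with
    | zero => exact h0
    | succ i ih => exact ih.nbr hμ hβ (by simp [nbrs])
    | pred i ih => exact ih.nbr hμ hβ (by simp [nbrs])
  induction b using Int.induction_on with
  | zero => exact ha
  | succ i ih => exact ih.nbr hμ hβ (by simp [nbrs])
  | pred i ih => exact ih.nbr hμ hβ (by simp [nbrs])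

/-- Convergence of conditioned expectations along receding conditionings. -/
def CondConv (μ : Measure Cfg2) (G : ℕ → ℕ → Cfg2 → ℝ) (f : Cfg2 → ℝ) : Prop :=
  ∀ ε > 0, ∃ n₀, ∀ n ≥ n₀, ∀ m, |cE μ (G n m) f - Ev μ f| ≤ ε

lemma condConv_minusInd (hμ : IsPlusPhase β h μ) (hβ : 0 < β) (h0 : SiteConv μ 0)
    (S : Finset (ℤ × ℤ)) : CondConv μ (fun n m => minusInd (slit n m)) (minusInd S) := by
  intro ε hε
  have : ∀ x, ∃ n₀, ∀ n ≥ n₀, ∀ m, cE μ (minusInd (slit n m)) (minusInd {x}) ≤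
      Pm μ {x} + ε / (S.card + 1) := fun x => h0.all hμ hβ x _ (by positivity)
  choose N hN using this
  refine ⟨S.sup N, fun n hn m => ?_⟩
  have h1 := cE_le_sum hμ hβ.le (slit n m) S
  have h2 : ∑ x ∈ S, (cE μ (minusInd (slit n m)) (minusInd {x}) - Pm μ {x}) ≤
      ∑ x ∈ S, ε / (S.card + 1) := Finset.sum_le_sum fun x hx => by
    have := hN x n ((Finset.le_sup hx).trans hn) m; linarith
  rw [Finset.sum_const, nsmul_eq_mul] at h2
  have h3 : S.card * (ε / (S.card + 1)) ≤ ε := by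
    rw [mul_div_assoc', div_le_iff₀ (by positivity)]; nlinarith
  have h4 := Ev_le_cE (A := slit n m) hμ hβ.le (minusInd_antitone S) (loc_minusInd S)
  rw [abs_of_nonneg (by linarith)]
  unfold Pm at h1 h2
  linarith

end

section
variable {β h : ℝ} {μ : Measure Cfg2} {Λ S T U A B : Finset (ℤ × ℤ)} {f g F G : Cfg2 → ℝ}

lemma cyl_indicator_induction {Q : (Cfg2 → ℝ) → Prop} (hadd : ∀ (S T : Finset (ℤ × ℤ))
    (f g : Cfg2 → ℝ), Loc S f → Loc T g → Q f → Q g → Q (fun η => f η + g η))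
    (hmul : ∀ (c : ℝ) f, Q f → Q (fun η => c * f η)) (hm : ∀ T, Q (minusInd T))
    (ζ : Cfg2) (S : Finset (ℤ × ℤ)) : ∀ T, Q (fun η => minusInd T η *
      ∏ x ∈ S, (if ζ x = false then minusInd {x} η else 1 - minusInd {x} η)) := by
  have hloc : ∀ S T : Finset (ℤ × ℤ), Loc (T ∪ S) (fun η => minusInd T η *
      ∏ x ∈ S, (if ζ x = false then minusInd {x} η else 1 - minusInd {x} η)) := by
    intro S T
    refine (loc_minusInd T).mul fun η η' hh => ?_
    refine Finset.prod_congr rfl fun x hx => ?_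
    rw [loc_minusInd {x} η η' fun y hy => hh y (by rw [Finset.mem_singleton.1 hy]; exact hx)]
  induction S using Finset.induction with
  | empty => intro T; simpa using hm T
  | insert a S ha ih =>
    intro T
    simp only [Finset.prod_insert ha]
    have e : ∀ η, minusInd (T ∪ {a}) η = minusInd T η * minusInd {a} η := minusInd_union T {a}
    by_cases hζ : ζ a = false
    · simpa only [hζ, if_true, e, mul_assoc] using ih (T ∪ {a})
    · have h1 := hadd _ _ _ _ (hloc S T) ((hloc S (T ∪ {a})).comp fun t => -1 * t) (ih T)
        (hmul (-1) _ (ih (T ∪ {a})))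
      refine cast (congrArg Q ?_) h1
      ext η
      rw [e, if_neg hζ]; ring

lemma cyl_indicator_eq (S : Finset (ℤ × ℤ)) (ζ η : Cfg2) :
    (cyl S ζ).indicator (fun _ => (1 : ℝ)) η =
      ∏ x ∈ S, (if ζ x = false then minusInd {x} η else 1 - minusInd {x} η) := by
  classical
  have : ∀ x, (if ζ x = false then minusInd {x} η else 1 - minusInd {x} η) =
      if η x = ζ x then 1 else 0 := by
    intro x
    rw [minusInd_singleton]
    cases ζ x <;> cases η x <;> norm_num [sval]
  simp only [this, Finset.prod_ite_zero, Finset.prod_const_one]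
  simp only [Set.indicator, cyl, Set.mem_setOf_eq]

/-- Linear induction over the indicators of cylinder events. -/
lemma indicator_induction {Q : (Cfg2 → ℝ) → Prop} (hadd : ∀ (S T : Finset (ℤ × ℤ))
    (f g : Cfg2 → ℝ), Loc S f → Loc T g → Q f → Q g → Q (fun η => f η + g η))
    (hmul : ∀ (c : ℝ) f, Q f → Q (fun η => c * f η)) (hm : ∀ T, Q (minusInd T))
    (ζ : Cfg2) (S : Finset (ℤ × ℤ)) : Q ((cyl S ζ).indicator fun _ => 1) := by
  refine cast (congrArg Q ?_) (cyl_indicator_induction hadd hmul hm ζ S ∅)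
  ext η
  rw [cyl_indicator_eq]; simp [minusInd]

lemma condConv_cyl (hμ : IsPlusPhase β h μ) {G : ℕ → ℕ → Cfg2 → ℝ} {V : ℕ → ℕ → Finset (ℤ × ℤ)}
    (hG : ∀ n m, Loc (V n m) (G n m)) (hm : ∀ T, CondConv μ G (minusInd T)) (ζ : Cfg2)
    (S : Finset (ℤ × ℤ)) : CondConv μ G ((cyl S ζ).indicator fun _ => 1) := by
  refine indicator_induction (Q := CondConv μ G) ?_ ?_ hm ζ S
  · intro S T f g hf hg hfQ hgQ ε hε
    obtain ⟨n₁, h₁⟩ := hfQ (ε / 2) (by positivity)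
    obtain ⟨n₂, h₂⟩ := hgQ (ε / 2) (by positivity)
    refine ⟨max n₁ n₂, fun n hn m => ?_⟩
    rw [cE_add hμ (hG n m) hf hg, Ev_add hμ hf hg, add_sub_add_comm]
    refine (abs_add_le _ _).trans ?_
    linarith [h₁ n ((le_max_left _ _).trans hn) m, h₂ n ((le_max_right _ _).trans hn) m]
  · intro c f hfQ ε hε
    obtain ⟨n₁, h₁⟩ := hfQ (ε / (|c| + 1)) (by positivity)
    refine ⟨n₁, fun n hn m => ?_⟩
    rw [cE_mul_left, Ev_mul_left, ← mul_sub, abs_mul]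
    calc |c| * |cE μ (G n m) f - Ev μ f| ≤ |c| * (ε / (|c| + 1)) :=
          mul_le_mul_of_nonneg_left (h₁ n hn m) (abs_nonneg _)
      _ ≤ ε := by
          rw [mul_div_assoc', div_le_iff₀ (by positivity)]; nlinarith [abs_nonneg c]

lemma slit_mono {n m m' : ℕ} (h : m ≤ m') : slit n m ⊆ slit n m' := fun x hx => by
  rw [mem_slit] at *; omega

lemma cE_le_one (hμ : IsPlusPhase β h μ) (hG : Loc U G) (hG0 : ∀ η, 0 ≤ G η)
    (hf : Loc S f) (hf1 : ∀ η, f η ≤ 1) : cE μ G f ≤ 1 := by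
  refine div_le_one_of_le₀ ?_ (Ev_nonneg hG0)
  exact Ev_mono hμ (hG.mul hf) hG fun η => by nlinarith [hG0 η, hf1 η]

lemma exists_inner_limit (hμ : IsPlusPhase β h μ) (hβ : 0 ≤ β) (n : ℕ) (ζ : Cfg2)
    (S : Finset (ℤ × ℤ)) :
    ∃ L, Tendsto (fun m => cE μ (minusInd (slit n m)) ((cyl S ζ).indicator fun _ => 1))
      atTop (𝓝 L) := by
  refine indicator_induction
    (Q := fun f => ∃ L, Tendsto (fun m => cE μ (minusInd (slit n m)) f) atTop (𝓝 L)) ?_ ?_ ?_ ζ S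
  · rintro S T f g hf hg ⟨L, hL⟩ ⟨L', hL'⟩
    refine ⟨L + L', ?_⟩
    simp only [cE_add hμ (loc_minusInd _) hf hg]
    exact hL.add hL'
  · rintro c f ⟨L, hL⟩
    refine ⟨c * L, ?_⟩
    simp only [cE_mul_left]
    exact hL.const_mul c
  · intro T
    refine ⟨_, tendsto_atTop_ciSup ?_ ?_⟩
    · intro m m' hm
      exact cE_mono hμ hβ (slit_mono hm) (minusInd_antitone T) (loc_minusInd T)
    · refine ⟨1, ?_⟩
      rintro _ ⟨m, rfl⟩
      exact cE_le_one hμ (loc_minusInd _) (minusInd_nonneg _) (loc_minusInd T) (minusInd_le_one T)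

lemma cond_eq_cE (hμ : IsPlusPhase β h μ) (A : Set Cfg2) (hA : MeasurableSet A) (S : Finset (ℤ × ℤ))
    (ζ : Cfg2) :
    (μ[|A] (cyl S ζ)).toReal = cE μ (A.indicator fun _ => 1) ((cyl S ζ).indicator fun _ => 1) := by
  have := hμ.1
  rw [cond_apply hA, ENNReal.toReal_mul, ENNReal.toReal_inv, cE, div_eq_inv_mul, Ev, Ev]
  congr 1
  · rw [integral_indicator_const _ hA]; simp [Measure.real]
  · have : (fun η => A.indicator (fun _ => (1 : ℝ)) η * (cyl S ζ).indicator (fun _ => 1) η) =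
        (A ∩ cyl S ζ).indicator fun _ => 1 := by
      ext η
      rw [← Set.inter_indicator_mul]; simp
    rw [this, integral_indicator_const _ (hA.inter (measurableSet_cyl _ _))]; simp [Measure.real]

lemma lineMinusEvt_eq (n m : ℕ) : lineMinusEvt n m = cyl (slit n m) fun _ => false := by
  ext η
  simp only [lineMinusEvt, cyl, Set.mem_setOf_eq]
  constructor
  · rintro hη ⟨a, b⟩ hx
    obtain ⟨h1, h2, h3⟩ := mem_slit.1 hx
    simp only at h1 h2 h3
    rw [h3]; exact hη a h1 h2
  · intro hη i h1 h2
    exact hη (i, 0) (mem_slit.2 ⟨h1, h2, rfl⟩)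

lemma indicator_minus (S : Finset (ℤ × ℤ)) :
    (cyl S fun _ => false).indicator (fun _ => (1 : ℝ)) = minusInd S := by
  classical
  ext η; simp only [Set.indicator, cyl, minusInd, Set.mem_setOf_eq]

lemma indicator_plus (S : Finset (ℤ × ℤ)) :
    (cyl S fun _ => true).indicator (fun _ => (1 : ℝ)) = plusInd S := by
  classical
  ext η; simp only [Set.indicator, cyl, plusInd, Set.mem_setOf_eq]

lemma cond_isProb (hμ : IsPlusPhase β h μ) (hβ : 0 ≤ β) (n m : ℕ) :
    IsProbabilityMeasure (μ[|lineMinusEvt n m]) := by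
  have := hμ.1
  refine cond_isProbabilityMeasure ?_
  intro h0
  have h1 := Pm_pos hμ hβ (slit n m)
  rw [Pm, ← indicator_minus, Ev, integral_indicator_const _ (measurableSet_cyl _ _),
    ← lineMinusEvt_eq, Measure.real, h0] at h1
  simp at h1

lemma isClopen_cyl {ι : Type*} (S : Finset ι) (ζ : ι → Bool) : IsClopen (cyl S ζ) := by
  have : cyl S ζ = ⋂ i ∈ S, (fun η : ι → Bool => η i) ⁻¹' {ζ i} := by
    ext η; simp [cyl]
  rw [this]
  exact isClopen_biInter_finset fun i _ => (isClopen_discrete _).preimage (continuous_apply i)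

lemma exists_measure_of_cyl_limits (P : ℕ → Measure Cfg2) [∀ m, IsProbabilityMeasure (P m)]
    (hP : ∀ S ζ, ∃ L, Tendsto (fun m => (P m (cyl S ζ)).toReal) atTop (𝓝 L)) :
    ∃ ν : Measure Cfg2, IsProbabilityMeasure ν ∧ CylTendsto P ν := by
  let P' : ℕ → ProbabilityMeasure Cfg2 := fun m => ⟨P m, inferInstance⟩
  obtain ⟨ν, -, hν⟩ := (isCompact_univ (X := ProbabilityMeasure Cfg2)).exists_mapClusterPt
    (f := atTop) (u := P') (by simp)
  refine ⟨ν, inferInstance, fun S ζ => ?_⟩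
  obtain ⟨L, hL⟩ := hP S ζ
  have hc : ContinuousAt (fun ρ : ProbabilityMeasure Cfg2 => (ρ : Measure Cfg2) (cyl S ζ)) ν := by
    refine ProbabilityMeasure.tendsto_measure_of_null_frontier_of_tendsto' tendsto_id ?_
    rw [(isClopen_cyl S ζ).frontier_eq, measure_empty]
  have h1 := hν.continuousAt_comp hc
  have h2 : Tendsto (fun m => P m (cyl S ζ)) atTop (𝓝 (ENNReal.ofReal L)) := by
    have := ENNReal.tendsto_ofReal hL
    simpa [ENNReal.ofReal_toReal (measure_ne_top _ _)] using this
  have h3 : (ν : Measure Cfg2) (cyl S ζ) = ENNReal.ofReal L := by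
    by_contra hne
    have hd : Disjoint (𝓝 ((ν : Measure Cfg2) (cyl S ζ))) (𝓝 (ENNReal.ofReal L)) := disjoint_nhds_nhds.2 hne
    have h4 : Tendsto (fun m => P m (cyl S ζ)) atTop (𝓝 (ENNReal.ofReal L)) := h2
    have h5 : (𝓝 ((ν : Measure Cfg2) (cyl S ζ)) ⊓ map (fun m => P m (cyl S ζ)) atTop).NeBot := h1
    exact h5.ne (le_bot_iff.1 ((inf_le_inf_left _ h4).trans hd.le_bot))
  have : {η : Cfg2 | ∀ i ∈ S, η i = ζ i} = cyl S ζ := rfl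
  rw [this, h3]; exact h2

lemma exists_iterated_limit (hμ : IsPlusPhase β h μ) (hβ : 0 < β) (h0 : SiteConv μ 0) :
    ∃ μseq : ℕ → Measure Cfg2,
        (∀ n, CylTendsto (fun m => μ[|lineMinusEvt n m]) (μseq n)) ∧ CylTendsto μseq μ := by
  have hp := hμ.1
  have e : ∀ n m S ζ, (μ[|lineMinusEvt n m] (cyl S ζ)).toReal =
      cE μ (minusInd (slit n m)) ((cyl S ζ).indicator fun _ => 1) := by
    intro n m S ζ
    rw [cond_eq_cE hμ _ (lineMinusEvt_eq n m ▸ measurableSet_cyl _ _), lineMinusEvt_eq,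
      indicator_minus]
  have hex : ∀ n, ∃ ν : Measure Cfg2, IsProbabilityMeasure ν ∧
      CylTendsto (fun m => μ[|lineMinusEvt n m]) ν := by
    intro n
    have := fun m => cond_isProb hμ hβ.le n m
    refine exists_measure_of_cyl_limits _ fun S ζ => ?_
    simp only [e]
    exact exists_inner_limit hμ hβ.le n ζ S
  choose μseq hprob hseq using hex
  refine ⟨μseq, hseq, fun S ζ => ?_⟩
  have hcc := condConv_cyl hμ (fun n m => loc_minusInd (slit n m))
    (condConv_minusInd hμ hβ h0) ζ S
  have hE : Ev μ ((cyl S ζ).indicator fun _ => 1) = (μ (cyl S ζ)).toReal := by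
    rw [Ev, integral_indicator_const _ (measurableSet_cyl _ _)]; simp [Measure.real]
  change Tendsto (fun n => μseq n (cyl S ζ)) atTop (𝓝 (μ (cyl S ζ)))
  rw [← ENNReal.tendsto_toReal_iff (fun n => measure_ne_top _ _) (measure_ne_top _ _),
    Metric.tendsto_atTop]
  intro ε hε
  obtain ⟨n₀, hn₀⟩ := hcc (ε / 2) (by positivity)
  refine ⟨n₀, fun n hn => lt_of_le_of_lt ?_ (half_lt_self hε)⟩
  have h1 : Tendsto (fun m => (μ[|lineMinusEvt n m] (cyl S ζ)).toReal) atTop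
      (𝓝 (μseq n (cyl S ζ)).toReal) :=
    (ENNReal.tendsto_toReal (measure_ne_top _ _)).comp (hseq n S ζ)
  refine le_of_tendsto (h1.dist tendsto_const_nhds) (Eventually.of_forall fun m => ?_)
  rw [e, ← hE, Real.dist_eq]
  exact hn₀ n hn m

/-- The image of a set of line sites in the plane. -/
def rowSet (S : Finset ℤ) : Finset (ℤ × ℤ) := S.image fun i => (i, 0)

lemma measurable_lineProj : Measurable lineProj :=
  measurable_pi_lambda _ fun _ => measurable_pi_apply _

lemma lineProj_preimage_cyl (S : Finset ℤ) (ζ : ZSeq Bool) :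
    lineProj ⁻¹' (cyl S ζ) = cyl (rowSet S) fun x => ζ x.1 := by
  ext η
  simp [cyl, rowSet, lineProj]

lemma blockEvt_eq (n l : ℕ) (b : Bool) :
    blockEvt n l b = cyl (Finset.Icc (-((n : ℤ) + l)) (-(n : ℤ))) fun _ => b := by
  ext η
  simp [blockEvt, cyl]

lemma rowSet_block (n l : ℕ) : rowSet (Finset.Icc (-((n : ℤ) + l)) (-(n : ℤ))) = slit n (n + l) := by
  simp [rowSet, slit]

lemma schonmann_cond (hμ : IsPlusPhase β h μ) (n l : ℕ) (b : Bool) (S : Finset ℤ) (ζ : ZSeq Bool) :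
    (((schonmann μ)[|blockEvt n l b]) (cyl S ζ)).toReal =
      cE μ ((cyl (slit n (n + l)) fun _ => b).indicator fun _ => 1)
        ((cyl (rowSet S) fun x => ζ x.1).indicator fun _ => 1) := by
  rw [← cond_eq_cE hμ _ (measurableSet_cyl _ _), cond_apply (measurableSet_cyl _ _),
    cond_apply (blockEvt_eq n l b ▸ measurableSet_cyl _ _), schonmann,
    Measure.map_apply measurable_lineProj (blockEvt_eq n l b ▸ measurableSet_cyl _ _),
    Measure.map_apply measurable_lineProj
      ((blockEvt_eq n l b ▸ measurableSet_cyl _ _).inter (measurableSet_cyl _ _)),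
    Set.preimage_inter, lineProj_preimage_cyl, blockEvt_eq, lineProj_preimage_cyl, rowSet_block]

lemma condConv_plus (hμ : IsPlusPhase β h μ) (hβ : 0 ≤ β) (T : Finset (ℤ × ℤ)) :
    CondConv μ (fun n m => plusInd (slit n m)) (minusInd T) := by
  intro ε hε
  obtain ⟨k, hk⟩ := ((Metric.tendsto_atTop.1 (Ex_tendsto hμ (loc_minusInd T))) ε hε)
  obtain ⟨n₀, hn₀⟩ := eventually_disjoint_slit (box k)
  refine ⟨n₀, fun n hn m => ?_⟩
  have hk' := hk k le_rfl
  rw [Real.dist_eq] at hk'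
  have hd := hn₀ n hn m
  set A := slit n m
  have hpos : 0 < Ev μ (plusInd A) := by
    have h1 : 0 < Ex β h A (fun _ => false) (plusInd A) := by
      refine Ex_pos_of_nonneg (plusInd_nonneg A) (fun _ => true) ?_
      unfold plusInd
      rw [if_pos fun x hx => by simp [fill, hx]]
      exact one_pos
    have h2 := le_Ev_mul (Λ := A) hμ hβ (plusInd_monotone A) (loc_plusInd A) (loc_const 1)
      (Finset.disjoint_empty_left _) (fun _ => zero_le_one)
    rw [Ev_const hμ, one_mul] at h2
    simp only [one_mul] at h2
    linarith
  have hneg := neg_mono_of_antitone (minusInd_antitone T)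
  have h1 := Ev_mul_le hμ hβ hneg ((loc_minusInd T).comp fun x => -x) (loc_plusInd A) hd
    (plusInd_nonneg A)
  have e1 : ∀ η, plusInd A η * - minusInd T η = - (plusInd A η * minusInd T η) := fun η => by ring
  have h2 := Ev_fkg hμ hβ superMod_one (plusInd_monotone A) hneg (loc_const 1) (loc_plusInd A)
    ((loc_minusInd T).comp fun x => -x)
  simp only [one_mul, e1, Ev_neg, Ex_neg, Ev_const hμ] at h1 h2
  have lo : Ex β h (box k) (fun _ => true) (minusInd T) ≤ cE μ (plusInd A) (minusInd T) := by
    rw [cE, le_div_iff₀ hpos]; linarith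
  have hi : cE μ (plusInd A) (minusInd T) ≤ Ev μ (minusInd T) := by
    rw [cE, div_le_iff₀ hpos]; linarith
  rw [abs_le]
  have := abs_lt.1 hk'
  constructor <;> linarith

lemma condLimit_cyl (hμ : IsPlusPhase β h μ) (b : Bool)
    (hconv : ∀ T, CondConv μ
      (fun n m => (cyl (slit n m) fun _ => b).indicator fun _ => 1) (minusInd T))
    {ν : Measure (ZSeq Bool)} (hν : IsCondLimitMeasure (schonmann μ) b ν) (S : Finset ℤ)
    (ζ : ZSeq Bool) : ν (cyl S ζ) = μ (cyl (rowSet S) fun x => ζ x.1) := by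
  have hp := hμ.1
  obtain ⟨νseq, h1, h2⟩ := hν
  have hl : ∀ n m, Loc (slit n m) ((cyl (slit n m) fun _ => b).indicator fun _ => 1) := by
    intro n m
    cases b
    · rw [indicator_minus]; exact loc_minusInd _
    · rw [indicator_plus]; exact loc_plusInd _
  have hcc := condConv_cyl hμ hl hconv (fun x => ζ x.1) (rowSet S)
  have hE : Ev μ ((cyl (rowSet S) fun x => ζ x.1).indicator fun _ => 1) =
      (μ (cyl (rowSet S) fun x => ζ x.1)).toReal := by
    rw [Ev, integral_indicator_const _ (measurableSet_cyl _ _)]; simp [Measure.real]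
  simp only [CondConv, hE] at hcc
  set p := (μ (cyl (rowSet S) fun x => ζ x.1)).toReal with hpdef
  have hsch : IsProbabilityMeasure (schonmann μ) :=
    Measure.isProbabilityMeasure_map measurable_lineProj.aemeasurable
  have hbd : ∀ ε > 0, ∃ n₀, ∀ n ≥ n₀, ENNReal.ofReal (p - ε) ≤ νseq n (cyl S ζ) ∧
      νseq n (cyl S ζ) ≤ ENNReal.ofReal (p + ε) := by
    intro ε hε
    obtain ⟨n₀, hn₀⟩ := hcc ε hε
    refine ⟨n₀, fun n hn => ?_⟩
    have h3 : ∀ l, ENNReal.ofReal (p - ε) ≤ (schonmann μ)[|blockEvt n l b] (cyl S ζ) ∧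
        (schonmann μ)[|blockEvt n l b] (cyl S ζ) ≤ ENNReal.ofReal (p + ε) := by
      intro l
      have h4 := hn₀ n hn (n + l)
      rw [← schonmann_cond hμ, abs_le] at h4
      rw [← ENNReal.ofReal_toReal (measure_ne_top ((schonmann μ)[|blockEvt n l b]) (cyl S ζ))]
      constructor <;> apply ENNReal.ofReal_le_ofReal <;> linarith
    exact ⟨ge_of_tendsto' (h1 n S ζ) fun l => (h3 l).1, le_of_tendsto' (h1 n S ζ) fun l => (h3 l).2⟩
  have h5 : Tendsto (fun n => νseq n (cyl S ζ)) atTop (𝓝 (ν (cyl S ζ))) := h2 S ζ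
  have h6 : ∀ ε > 0, ENNReal.ofReal (p - ε) ≤ ν (cyl S ζ) ∧ ν (cyl S ζ) ≤ ENNReal.ofReal (p + ε) := by
    intro ε hε
    obtain ⟨n₀, hn₀⟩ := hbd ε hε
    constructor
    · exact ge_of_tendsto h5 (eventually_atTop.2 ⟨n₀, fun n hn => (hn₀ n hn).1⟩)
    · exact le_of_tendsto h5 (eventually_atTop.2 ⟨n₀, fun n hn => (hn₀ n hn).2⟩)
  rw [← ENNReal.ofReal_toReal (measure_ne_top μ (cyl (rowSet S) fun x => ζ x.1)), ← hpdef]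
  refine le_antisymm ?_ ?_
  · have : Tendsto (fun ε : ℝ => ENNReal.ofReal (p + ε)) (𝓝[>] 0) (𝓝 (ENNReal.ofReal p)) := by
      refine ENNReal.tendsto_ofReal (tendsto_nhdsWithin_of_tendsto_nhds ?_)
      simpa using tendsto_const_nhds.add (tendsto_id (x := 𝓝 (0 : ℝ)))
    exact ge_of_tendsto this (eventually_nhdsWithin_of_forall fun ε hε => (h6 ε hε).2)
  · have : Tendsto (fun ε : ℝ => ENNReal.ofReal (p - ε)) (𝓝[>] 0) (𝓝 (ENNReal.ofReal p)) := by
      refine ENNReal.tendsto_ofReal (tendsto_nhdsWithin_of_tendsto_nhds ?_)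
      simpa using tendsto_const_nhds.sub (tendsto_id (x := 𝓝 (0 : ℝ)))
    exact le_of_tendsto this (eventually_nhdsWithin_of_forall fun ε hε => (h6 ε hε).1)

lemma measure_ext_cyl {ν ν' : Measure (ZSeq Bool)} [IsFiniteMeasure ν] [IsFiniteMeasure ν']
    (hc : ∀ S ζ, ν (cyl S ζ) = ν' (cyl S ζ)) : ν = ν' := by
  refine IsProjectiveLimit.unique (P := fun S : Finset ℤ => ν'.map S.restrict) (fun S => ?_)
    fun S => rfl
  refine Measure.ext_of_singleton fun τ => ?_
  have hm : Measurable (S.restrict : (ℤ → Bool) → _) := Finset.measurable_restrict S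
  rw [Measure.map_apply hm (measurableSet_singleton _), Measure.map_apply hm (measurableSet_singleton _)]
  classical
  have : (S.restrict : (ℤ → Bool) → _) ⁻¹' {τ} = cyl S fun i => if hi : i ∈ S then τ ⟨i, hi⟩ else true := by
    ext η
    simp only [Set.mem_preimage, Set.mem_singleton_iff, cyl, Set.mem_setOf_eq, funext_iff]
    constructor
    · intro h i hi; rw [dif_pos hi, ← h ⟨i, hi⟩]; rfl
    · intro h i; have := h i i.2; rw [dif_pos i.2] at this; exact this
  rw [this, hc]

lemma condLimits_eq (hμ : IsPlusPhase β h μ) (hβ : 0 < β) (h0 : SiteConv μ 0)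
    {νm νp : Measure (ZSeq Bool)} (hm : IsCondLimitMeasure (schonmann μ) false νm)
    (hp : IsCondLimitMeasure (schonmann μ) true νp) : νm = νp := by
  have hpr := hμ.1
  have c1 := condLimit_cyl hμ false (by
    simp only [indicator_minus]; exact condConv_minusInd hμ hβ h0) hm
  have c2 := condLimit_cyl hμ true (by
    simp only [indicator_plus]; exact condConv_plus hμ hβ.le) hp
  have u : ∀ (ν : Measure (ZSeq Bool)), (∀ S ζ, ν (cyl S ζ) = μ (cyl (rowSet S) fun x => ζ x.1)) →
      IsFiniteMeasure ν := fun ν hν => ⟨by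
    have := hν ∅ fun _ => true
    have e : (cyl (∅ : Finset ℤ) fun _ => true) = Set.univ := by ext; simp [cyl]
    rw [e] at this
    rw [this]; exact measure_lt_top _ _⟩
  have := u νm c1
  have := u νp c2
  exact measure_ext_cyl fun S ζ => by rw [c1, c2]

end

section
variable {β h : ℝ} {μ : Measure Cfg2} {Λ S T U A B : Finset (ℤ × ℤ)} {f g F G : Cfg2 → ℝ}

lemma siteConv_of_unique (hμ : IsPlusPhase β h μ) (hβ : 0 ≤ β)
    (H : ∀ ε > 0, ∃ Λ, Ex β h Λ (fun _ => false) (minusInd {0}) ≤ Pm μ {0} + ε) :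
    SiteConv μ 0 := by
  intro ε hε
  obtain ⟨Λ, hΛ⟩ := H ε hε
  obtain ⟨n₀, hn₀⟩ := eventually_disjoint_slit Λ
  refine ⟨n₀, fun n hn m => ?_⟩
  have pA : 0 < Ev μ (minusInd (slit n m)) := Pm_pos hμ hβ _
  have h1 := le_Ev_mul hμ hβ (neg_mono_of_antitone (minusInd_antitone {0}))
    ((loc_minusInd {0}).comp fun x => -x) (loc_minusInd (slit n m)) (hn₀ n hn m)
    (minusInd_nonneg _)
  simp only [mul_neg, Ev_neg, Ex_neg] at h1
  rw [cE, div_le_iff₀ pA]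
  nlinarith

lemma minusInd_image (S : Finset (ℤ × ℤ)) (d : ℤ × ℤ) (η : Cfg2) :
    minusInd (S.image (· + d)) η = minusInd S (shiftC d η) := by
  refine if_congr ?_ rfl rfl
  simp only [Finset.mem_image, forall_exists_index, and_imp, forall_apply_eq_imp_iff₂, shiftC]

lemma Pm_shift (hμ : IsPlusPhase β h μ) (hβ : 0 ≤ β) (S : Finset (ℤ × ℤ)) (d : ℤ × ℤ) :
    Pm μ (S.image (· + d)) = Pm μ S := by
  have := Ev_shift hμ hβ (neg_mono_of_antitone (minusInd_antitone S))
    ((loc_minusInd S).comp fun x => -x) d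
  simp only [Ev_neg, ← minusInd_image, neg_inj] at this
  exact this

lemma cE_minus (A B : Finset (ℤ × ℤ)) : cE μ (minusInd A) (minusInd B) = Pm μ (A ∪ B) / Pm μ A := by
  simp only [cE, Pm, ← minusInd_union]

/-- The horizontal segment of `k` sites starting at `(a,0)`. -/
def seg (a : ℤ) (k : ℕ) : Finset (ℤ × ℤ) := (Finset.range k).image fun i : ℕ => (a + i, 0)

lemma mem_seg {a : ℤ} {k : ℕ} {x : ℤ × ℤ} : x ∈ seg a k ↔ a ≤ x.1 ∧ x.1 < a + k ∧ x.2 = 0 := by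
  obtain ⟨u, v⟩ := x
  simp only [seg, Finset.mem_image, Finset.mem_range, Prod.mk.injEq]
  constructor
  · rintro ⟨i, hi, rfl, rfl⟩; exact ⟨by omega, by omega, rfl⟩
  · rintro ⟨h1, h2, h3⟩; exact ⟨(u - a).toNat, by omega, by omega, h3.symm⟩

lemma sum_seg (a : ℤ) (k : ℕ) (φ : ℤ × ℤ → ℝ) :
    ∑ x ∈ seg a k, φ x = ∑ i ∈ Finset.range k, φ (a + i, 0) :=
  Finset.sum_image fun i _ j _ hij => by simpa using hij

lemma slit_eq_seg (m : ℕ) : slit 1 m = seg (-m) m := by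
  ext x; rw [mem_slit, mem_seg]; push_cast; omega

lemma seg_shift (a : ℤ) (k : ℕ) (d : ℤ) : (seg a k).image (· + (d, 0)) = seg (a + d) k := by
  ext ⟨u, v⟩
  simp only [Finset.mem_image, mem_seg, Prod.exists, Prod.mk_add_mk, Prod.mk.injEq]
  constructor
  · rintro ⟨a', b, h, rfl, rfl⟩; omega
  · intro h; exact ⟨u - d, v, by omega, by omega, by omega⟩

lemma Pm_seg (hμ : IsPlusPhase β h μ) (hβ : 0 ≤ β) (a : ℤ) (k : ℕ) :
    Pm μ (seg a k) = Pm μ (seg 0 k) := by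
  rw [← Pm_shift hμ hβ (seg 0 k) (a, 0), seg_shift, zero_add]

/-- The conditional probability of extending a run of `i` minuses. -/
def runRatio (μ : Measure Cfg2) (i : ℕ) : ℝ := Pm μ (seg 0 (i + 1)) / Pm μ (seg 0 i)

lemma runRatio_pos (hμ : IsPlusPhase β h μ) (hβ : 0 ≤ β) (i : ℕ) : 0 < runRatio μ i :=
  div_pos (Pm_pos hμ hβ _) (Pm_pos hμ hβ _)

lemma runRatio_mono (hμ : IsPlusPhase β h μ) (hβ : 0 ≤ β) : Monotone (runRatio μ) := by
  have e : ∀ i, runRatio μ i = cE μ (minusInd (seg 0 i)) (minusInd {(-1, 0)}) := by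
    intro i
    rw [cE_minus, runRatio, ← Pm_seg hμ hβ (-1)]
    congr 2
    ext ⟨u, v⟩
    simp only [Finset.mem_union, mem_seg, Finset.mem_singleton, Prod.mk.injEq]
    push_cast; omega
  intro i j hij
  rw [e, e]
  refine cE_mono hμ hβ (fun x hx => ?_) (minusInd_antitone _) (loc_minusInd _)
  rw [mem_seg] at *; omega

lemma Pm_seg_succ (hμ : IsPlusPhase β h μ) (hβ : 0 ≤ β) (i : ℕ) :
    Pm μ (seg 0 (i + 1)) = runRatio μ i * Pm μ (seg 0 i) := by
  rw [runRatio, div_mul_cancel₀ _ (Pm_pos hμ hβ _).ne']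

lemma runRatio_le_one (hμ : IsPlusPhase β h μ) (hβ : 0 ≤ β) (i : ℕ) : runRatio μ i ≤ 1 := by
  rw [runRatio, div_le_one (Pm_pos hμ hβ _)]
  refine Ev_mono hμ (loc_minusInd _) (loc_minusInd _) fun η => ?_
  have : seg 0 (i + 1) = seg 0 i ∪ {((i : ℤ), 0)} := by
    ext ⟨u, v⟩
    simp only [Finset.mem_union, mem_seg, Finset.mem_singleton, Prod.mk.injEq]
    push_cast; omega
  rw [this, minusInd_union]
  exact mul_le_of_le_one_right (minusInd_nonneg _ _) (minusInd_le_one _ _)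

lemma Pm_seg_add_le (hμ : IsPlusPhase β h μ) (hβ : 0 ≤ β) {κ : ℝ} (hκ : ∀ i, runRatio μ i ≤ κ)
    (m k : ℕ) : Pm μ (seg 0 (m + k)) ≤ κ ^ k * Pm μ (seg 0 m) := by
  induction k with
  | zero => simp
  | succ k ih =>
    rw [← add_assoc, Pm_seg_succ hμ hβ, pow_succ']
    have h1 : 0 ≤ κ := (runRatio_pos hμ hβ 0).le.trans (hκ 0)
    calc _ ≤ κ * Pm μ (seg 0 (m + k)) := mul_le_mul_of_nonneg_right (hκ _) (Pm_pos hμ hβ _).le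
      _ ≤ κ * (κ ^ k * Pm μ (seg 0 m)) := mul_le_mul_of_nonneg_left ih h1
      _ = _ := by ring

lemma le_Pm_seg_add (hμ : IsPlusPhase β h μ) (hβ : 0 ≤ β) (j k : ℕ) :
    runRatio μ j ^ k * Pm μ (seg 0 j) ≤ Pm μ (seg 0 (j + k)) := by
  induction k with
  | zero => simp
  | succ k ih =>
    rw [← add_assoc, Pm_seg_succ hμ hβ, pow_succ']
    calc _ = runRatio μ j * (runRatio μ j ^ k * Pm μ (seg 0 j)) := by ring
      _ ≤ runRatio μ j * Pm μ (seg 0 (j + k)) :=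
        mul_le_mul_of_nonneg_left ih (runRatio_pos hμ hβ _).le
      _ ≤ _ := mul_le_mul_of_nonneg_right (runRatio_mono hμ hβ (by omega)) (Pm_pos hμ hβ _).le

/-- Exponential tilt by `-t` times the magnetization of a set. -/
def tilt (t : ℝ) (S : Finset (ℤ × ℤ)) (η : Cfg2) : ℝ := Real.exp (-t * ∑ x ∈ S, sval (η x))

lemma loc_tilt (t : ℝ) (S : Finset (ℤ × ℤ)) : Loc S (tilt t S) :=
  (loc_sum S fun _ hx => loc_sval hx).comp fun x => Real.exp (-t * x)

lemma minusInd_mul_tilt (t : ℝ) (a : ℤ) (k : ℕ) (η : Cfg2) :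
    tilt t (seg a k) η * minusInd (seg a k) η = Real.exp (t * k) * minusInd (seg a k) η := by
  by_cases hS : ∀ x ∈ seg a k, η x = false
  · have : ∑ x ∈ seg a k, sval (η x) = -k := by
      rw [Finset.sum_congr rfl fun x hx => by rw [hS x hx], sum_seg]
      simp [sval_false]
    rw [tilt, this]; ring_nf
  · rw [minusInd, if_neg hS, mul_zero, mul_zero]

lemma cE_tilt_le (hμ : IsPlusPhase β h μ) (hβ : 0 ≤ β) {κ : ℝ} (hκ : ∀ i, runRatio μ i ≤ κ)
    (t : ℝ) (k m : ℕ) :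
    cE μ (minusInd (slit 1 m)) (tilt t (seg 0 k)) * Pm μ (seg 0 k) ≤
      Ev μ (tilt t (seg 0 k)) * κ ^ k := by
  have key := Ev_fkg (F := tilt t (seg 0 k)) hμ hβ (superMod_exp_sum _ _)
    (neg_mono_of_antitone (minusInd_antitone (slit 1 m)))
    (neg_mono_of_antitone (minusInd_antitone (seg 0 k))) (loc_tilt t _)
    ((loc_minusInd _).comp fun x => -x) ((loc_minusInd _).comp fun x => -x)
  simp only [mul_neg, neg_mul, neg_neg, Ev_neg] at key
  have e1 : Ev μ (fun η => tilt t (seg 0 k) η * minusInd (seg 0 k) η) =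
      Real.exp (t * k) * Pm μ (seg 0 k) := by
    simp only [minusInd_mul_tilt]; exact Ev_mul_left _
  have e2 : Ev μ (fun η => tilt t (seg 0 k) η * (minusInd (slit 1 m) η * minusInd (seg 0 k) η)) =
      Real.exp (t * k) * Pm μ (seg 0 (m + k)) := by
    have : seg (-m) (m + k) = slit 1 m ∪ seg 0 k := by
      ext x; rw [Finset.mem_union, slit_eq_seg, mem_seg, mem_seg, mem_seg]; push_cast; omega
    rw [← Pm_seg hμ hβ (-m), this, Pm, ← Ev_mul_left]
    congr 1; ext η
    rw [mul_left_comm, minusInd_mul_tilt, minusInd_union]; ring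
  rw [e1, e2] at key
  have h3 := Pm_seg_add_le hμ hβ hκ m k
  have pA := Pm_pos hμ hβ (slit 1 m)
  have hA : Pm μ (slit 1 m) = Pm μ (seg 0 m) := by rw [slit_eq_seg, Pm_seg hμ hβ]
  have hF : 0 ≤ Ev μ (tilt t (seg 0 k)) := Ev_nonneg fun η => (Real.exp_pos _).le
  have hE : Ev μ (minusInd (slit 1 m)) = Pm μ (slit 1 m) := rfl
  have e3 : (fun η => tilt t (seg 0 k) η * minusInd (slit 1 m) η) =
    fun η => minusInd (slit 1 m) η * tilt t (seg 0 k) η := by ext; ring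
  rw [e3] at key
  rw [cE, hE, div_mul_eq_mul_div, div_le_iff₀ pA]
  have hx := Real.exp_pos (t * k)
  have h4 := mul_le_mul_of_nonneg_left h3 hF
  rw [hA]
  refine le_of_mul_le_mul_left ?_ hx
  calc _ = _ := by ring
    _ ≤ _ := key
    _ = Real.exp (t * k) * (Ev μ (tilt t (seg 0 k)) * Pm μ (seg 0 (m + k))) := by ring
    _ ≤ _ := mul_le_mul_of_nonneg_left h4 hx.le
    _ = _ := by ring

lemma cE_const (hμ : IsPlusPhase β h μ) (hβ : 0 ≤ β) (c : ℝ) :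
    cE μ (minusInd A) (fun _ => c) = c := by
  have pA : 0 < Ev μ (minusInd A) := Pm_pos hμ hβ A
  have : (fun η => minusInd A η * c) = fun η => c * minusInd A η := by ext; ring
  rw [cE, this, Ev_mul_left, mul_div_assoc, div_self pA.ne', mul_one]

lemma cE_le (hμ : IsPlusPhase β h μ) (hβ : 0 ≤ β) (hf : Loc S f) (hg : Loc T g)
    (hfg : ∀ η, f η ≤ g η) : cE μ (minusInd A) f ≤ cE μ (minusInd A) g :=
  div_le_div_of_nonneg_right (Ev_mono hμ ((loc_minusInd A).mul hf) ((loc_minusInd A).mul hg)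
    fun η => mul_le_mul_of_nonneg_left (hfg η) (minusInd_nonneg A η)) (Pm_pos hμ hβ A).le

/-- Jensen's inequality for the exponential under conditional expectation. -/
lemma exp_le_cE (hμ : IsPlusPhase β h μ) (hβ : 0 ≤ β) (hf : Loc S f) {c : ℝ}
    (hc : c ≤ cE μ (minusInd A) f) : Real.exp c ≤ cE μ (minusInd A) (fun η => Real.exp (f η)) := by
  have h1 : cE μ (minusInd A) (fun η => Real.exp c * (f η + (1 - c))) ≤
      cE μ (minusInd A) (fun η => Real.exp (f η)) := by
    refine cE_le hμ hβ (hf.comp fun x => Real.exp c * (x + (1 - c))) (hf.comp Real.exp) fun η => ?_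
    have := Real.add_one_le_exp (f η - c)
    rw [Real.exp_sub, le_div_iff₀ (Real.exp_pos c)] at this
    linarith
  rw [cE_mul_left, cE_add hμ (loc_minusInd A) hf (loc_const (1 - c)), cE_const hμ hβ] at h1
  refine le_trans ?_ h1
  have := Real.exp_pos c
  nlinarith

/-- Volume-order large deviation upper bound along the line, near `t = 0`. -/
def LineLD (μ : Measure Cfg2) : Prop := ∃ C ≥ 0, ∀ t > 0, ∀ k : ℕ,
  Ev μ (tilt t (seg 0 (k + 1))) ≤ Real.exp t *
    (Real.cosh t - (1 - 2 * Pm μ {0}) * Real.sinh t + C * Real.sinh t ^ 2) ^ k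

lemma le_of_pow_le_mul_pow {a b C : ℝ} (hb : 0 < b) (H : ∀ k : ℕ, a ^ k ≤ C * b ^ k) :
    a ≤ b := by
  by_contra! hab
  have h1 : 1 < a / b := (one_lt_div hb).2 hab
  obtain ⟨k, hk⟩ := pow_unbounded_of_one_lt C h1
  rw [div_pow, lt_div_iff₀ (pow_pos hb k)] at hk
  exact absurd (H k) (not_le.2 hk)

lemma Pm_le_one (hμ : IsPlusPhase β h μ) (S : Finset (ℤ × ℤ)) : Pm μ S ≤ 1 := by
  rw [← Ev_const hμ 1]
  exact Ev_mono hμ (loc_minusInd S) (loc_const 1) (minusInd_le_one S)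

lemma exp_le_of_lineLD (hμ : IsPlusPhase β h μ) (hβ : 0 ≤ β) {ε t T : ℝ} (ht : 0 < t) (hT : 0 < T)
    (H : ∀ k : ℕ, Ev μ (tilt t (seg 0 (k + 1))) ≤ Real.exp t * T ^ k)
    (hq : ∀ n₀ : ℕ, ∃ n ≥ n₀, ∃ m, Pm μ {0} + ε ≤ cE μ (minusInd (slit n m)) (minusInd {0})) :
    Real.exp (-t * (1 - 2 * (Pm μ {0} + ε))) ≤ T := by
  set e := Real.exp (-t * (1 - 2 * (Pm μ {0} + ε))) with he
  have bdd : BddAbove (Set.range (runRatio μ)) :=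
    ⟨1, by rintro _ ⟨i, rfl⟩; exact runRatio_le_one hμ hβ i⟩
  set κ := ⨆ i, runRatio μ i
  have hκ : ∀ i, runRatio μ i ≤ κ := le_ciSup bdd
  have hκ0 : 0 < κ := (runRatio_pos hμ hβ 0).trans_le (hκ 0)
  have main : ∀ k : ℕ, e ^ (k + 1) * Pm μ (seg 0 (k + 1)) ≤ Real.exp t * T ^ k * κ ^ (k + 1) := by
    intro k
    obtain ⟨n, hn, m, hm⟩ := hq (k + 1)
    have h1 := cE_tilt_le hμ hβ hκ t (k + 1) m
    have h2 : e ^ (k + 1) ≤ cE μ (minusInd (slit 1 m)) (tilt t (seg 0 (k + 1))) := by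
      rw [he, ← Real.exp_nat_mul]
      refine exp_le_cE hμ hβ ((loc_sum (seg 0 (k + 1)) fun _ hx => loc_sval hx).comp
        fun x => -t * x) ?_
      rw [cE_mul_left, cE_sum hμ (loc_minusInd _) _ fun x hx => loc_sval hx]
      have h3 : ∀ x ∈ seg 0 (k + 1), cE μ (minusInd (slit 1 m)) (fun η => sval (η x)) ≤
          1 - 2 * (Pm μ {0} + ε) := by
        intro x hx
        have e1 : (fun η : Cfg2 => sval (η x)) = fun η => -2 * minusInd {x} η + 1 := by
          ext η; rw [minusInd_singleton]; ring
        rw [e1, cE_add hμ (loc_minusInd _) ((loc_minusInd {x}).comp fun y => -2 * y)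
          (loc_const 1), cE_mul_left, cE_const hμ hβ]
        rw [mem_seg] at hx
        have h4 : cE μ (minusInd (slit n m)) (minusInd {0}) ≤
            cE μ (minusInd ((slit 1 m).image (· + (-x)))) (minusInd {0}) := by
          refine cE_mono hμ hβ (fun y hy => ?_) (minusInd_antitone _) (loc_minusInd _)
          rw [mem_slit] at hy
          refine Finset.mem_image.2 ⟨y + x, mem_slit.2 ?_, by simp⟩
          simp only [Prod.fst_add, Prod.snd_add]
          push_cast at *
          omega
        have h5 : cE μ (minusInd ((slit 1 m).image (· + (-x)))) (minusInd {0}) =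
            cE μ (minusInd (slit 1 m)) (minusInd {x}) := by
          rw [cE_minus, cE_minus, Pm_shift hμ hβ, ← Pm_shift hμ hβ (slit 1 m ∪ {x}) (-x),
            Finset.image_union]
          simp
        linarith
      have h6 := Finset.sum_le_sum h3
      rw [Finset.sum_const, nsmul_eq_mul] at h6
      have hc : (seg 0 (k + 1)).card = k + 1 := by
        rw [seg, Finset.card_image_of_injective _ (fun i j hij => by simpa using hij)]; simp
      rw [hc] at h6
      nlinarith
    calc _ ≤ _ := mul_le_mul_of_nonneg_right h2 (Pm_pos hμ hβ _).le
      _ ≤ _ := h1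
      _ ≤ _ := mul_le_mul_of_nonneg_right (H k) (pow_pos hκ0 _).le
  have hj : ∀ j, e * runRatio μ j ≤ T * κ := by
    intro j
    refine le_of_pow_le_mul_pow (C := Real.exp t * T ^ j * κ ^ (j + 1) /
      (e ^ (j + 1) * runRatio μ (j+1) * Pm μ (seg 0 (j+1))) * runRatio μ (j+1)) (by positivity) fun k => ?_
    have h1 := main (j + k)
    have h2 := le_Pm_seg_add hμ hβ (j + 1) k
    have h3 : runRatio μ j ^ k ≤ runRatio μ (j + 1) ^ k :=
      pow_le_pow_left₀ (runRatio_pos hμ hβ j).le (runRatio_mono hμ hβ (by omega)) k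
    have hp := Pm_pos hμ hβ (seg 0 (j + 1))
    have hr := runRatio_pos hμ hβ (j + 1)
    have hepos : 0 < e := Real.exp_pos _
    have e1 : Real.exp t * T ^ j * κ ^ (j + 1) /
      (e ^ (j + 1) * runRatio μ (j+1) * Pm μ (seg 0 (j+1))) * runRatio μ (j+1) * (T * κ) ^ k =
      (Real.exp t * T ^ (j + k) * κ ^ (j + k + 1)) / (e ^ (j + 1) * Pm μ (seg 0 (j+1))) := by
      field_simp; ring
    rw [e1, le_div_iff₀ (by positivity)]
    refine le_trans ?_ h1
    have e2 : j + k + 1 = j + 1 + k := by ring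
    rw [e2]
    calc _ = e ^ (j + 1 + k) * (runRatio μ j ^ k * Pm μ (seg 0 (j + 1))) := by ring
      _ ≤ e ^ (j + 1 + k) * (runRatio μ (j + 1) ^ k * Pm μ (seg 0 (j + 1))) := by gcongr
      _ ≤ _ := by gcongr
  have hepos : 0 < e := Real.exp_pos _
  have : e * κ ≤ T * κ := by
    rw [← le_div_iff₀' hepos]
    exact ciSup_le fun j => (le_div_iff₀' hepos).2 (hj j)
  exact le_of_mul_le_mul_right this hκ0

lemma siteConv_of_lineLD (hμ : IsPlusPhase β h μ) (hβ : 0 ≤ β) (H : LineLD μ) : SiteConv μ 0 := by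
  obtain ⟨C, hC, H⟩ := H
  by_contra hS
  simp only [SiteConv, not_forall, not_exists, not_le] at hS
  obtain ⟨ε, hε, hS⟩ := hS
  have hq : ∀ n₀ : ℕ, ∃ n ≥ n₀, ∃ m, Pm μ {0} + ε ≤ cE μ (minusInd (slit n m)) (minusInd {0}) :=
    fun n₀ => by
      obtain ⟨n, hn, m, hm⟩ := hS n₀
      exact ⟨n, hn, m, hm.le⟩
  have p0 := Pm_pos hμ hβ {0}
  have p1 := Pm_le_one hμ {0}
  set p := Pm μ {0}
  set t := min 1 (ε / (4 * C + 4)) with ht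
  have t0 : 0 < t := lt_min one_pos (by positivity)
  have t1 : t ≤ 1 := min_le_left _ _
  have t2 : t * (4 * C + 4) ≤ ε := by
    rw [← le_div_iff₀ (by positivity)]; exact min_le_right _ _
  have s0 : t < Real.sinh t := Real.self_lt_sinh_iff.2 t0
  have b1 : Real.exp t ≤ 1 + t + t ^ 2 := by
    have := Real.abs_exp_sub_one_sub_id_le (x := t) (by rw [abs_of_pos t0]; exact t1)
    linarith [abs_le.1 this]
  have b2 : Real.exp (-t) ≤ 1 - t + t ^ 2 := by
    have := Real.abs_exp_sub_one_sub_id_le (x := -t) (by rw [abs_neg, abs_of_pos t0]; exact t1)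
    have := (abs_le.1 this).2
    nlinarith
  have b3 : 1 - t ≤ Real.exp (-t) := by linarith [Real.add_one_le_exp (-t)]
  have c1 : Real.cosh t ≤ 1 + t ^ 2 := by rw [Real.cosh_eq]; linarith
  have s1 : Real.sinh t ≤ t + t ^ 2 / 2 := by rw [Real.sinh_eq]; linarith
  have hT : 0 < Real.cosh t - (1 - 2 * p) * Real.sinh t + C * Real.sinh t ^ 2 := by
    have h1 : Real.cosh t - Real.sinh t = Real.exp (-t) := by rw [Real.cosh_sub_sinh]
    have := Real.exp_pos (-t)
    have : 0 ≤ C * Real.sinh t ^ 2 := by positivity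
    nlinarith
  have key := exp_le_of_lineLD hμ hβ t0 hT (H t t0) hq
  have h1 := Real.add_one_le_exp (-t * (1 - 2 * (p + ε)))
  have s2 : Real.sinh t ^ 2 ≤ 4 * t ^ 2 := by
    have : Real.sinh t ≤ 2 * t := by nlinarith
    calc _ ≤ (2 * t) ^ 2 := pow_le_pow_left₀ (t0.le.trans s0.le) this 2
      _ = _ := by ring
  have s3 : C * Real.sinh t ^ 2 ≤ C * (4 * t ^ 2) := mul_le_mul_of_nonneg_left s2 hC
  have h2 : -(1 - 2 * p) * (Real.sinh t - t) ≤ t ^ 2 / 2 := by nlinarith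
  nlinarith

end

section
variable {ι X K : Type*} [Fintype ι] [DecidableEq ι] [Fintype X] [Fintype K]

/-- Monomials in single-site functions. -/
def mono (φ : K → X → ℝ) (a : ι → K → ℕ) (x : ι → X) : ℝ := ∏ i, ∏ k, φ k (x i) ^ a i k

lemma mono_add (φ : K → X → ℝ) (a b : ι → K → ℕ) (x : ι → X) :
    mono φ (a + b) x = mono φ a x * mono φ b x := by
  simp only [mono, Pi.add_apply, pow_add, Finset.prod_mul_distrib]

/-- `g` preserves the cone of functions having nonnegative integrals against all monomials. -/
def Pres (φ : K → X → ℝ) (g : (ι → X) → ℝ) : Prop :=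
  ∀ Φ : (ι → X) → ℝ, (∀ a : ι → K → ℕ, 0 ≤ ∑ x, mono φ a x * Φ x) →
    ∀ a : ι → K → ℕ, 0 ≤ ∑ x, mono φ a x * (g x * Φ x)

variable {φ : K → X → ℝ} {g g' : (ι → X) → ℝ}

lemma Pres.mul (h : Pres φ g) (h' : Pres φ g') : Pres φ (fun x => g x * g' x) := by
  intro Φ hΦ a
  simp only [mul_assoc]
  exact h _ (h' Φ hΦ) a

lemma Pres.add (h : Pres φ g) (h' : Pres φ g') : Pres φ (fun x => g x + g' x) := by
  intro Φ hΦ a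
  simp only [add_mul, mul_add, Finset.sum_add_distrib]
  exact add_nonneg (h Φ hΦ a) (h' Φ hΦ a)

lemma pres_const {c : ℝ} (hc : 0 ≤ c) : Pres (ι := ι) φ (fun _ => c) := by
  intro Φ hΦ a
  simp only [mul_left_comm _ c, ← Finset.mul_sum]
  exact mul_nonneg hc (hΦ a)

lemma pres_mono (b : ι → K → ℕ) : Pres φ (mono φ b) := by
  intro Φ hΦ a
  simp only [← mul_assoc, ← mono_add]
  exact hΦ _

lemma pres_sum {J : Type*} (s : Finset J) {g : J → (ι → X) → ℝ} (h : ∀ j ∈ s, Pres φ (g j)) :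
    Pres φ (fun x => ∑ j ∈ s, g j x) := by
  intro Φ hΦ a
  simp only [Finset.sum_mul, Finset.mul_sum]
  rw [Finset.sum_comm]
  exact Finset.sum_nonneg fun j hj => h j hj Φ hΦ a

lemma Pres.pow (h : Pres φ g) (n : ℕ) : Pres φ (fun x => g x ^ n) := by
  induction n with
  | zero => simpa using pres_const (ι := ι) (φ := φ) zero_le_one
  | succ n ih => simpa only [pow_succ] using ih.mul h

lemma Pres.exp (h : Pres φ g) : Pres φ (fun x => Real.exp (g x)) := by
  intro Φ hΦ a
  have h1 : ∀ x, HasSum (fun n : ℕ => mono φ a x * (g x ^ n / n.factorial * Φ x))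
      (mono φ a x * (Real.exp (g x) * Φ x)) := fun x => by
    have := NormedSpace.expSeries_div_hasSum_exp (g x)
    rw [← Real.exp_eq_exp_ℝ] at this
    exact (this.mul_right _).mul_left _
  have h2 := hasSum_sum (s := Finset.univ) fun x _ => h1 x
  refine h2.nonneg fun n => ?_
  have := ((h.pow n).mul (pres_const (c := 1 / (n.factorial : ℝ)) (by positivity))) Φ hΦ a
  refine this.trans_eq (Finset.sum_congr rfl fun x _ => ?_)
  ring

lemma Pres.sum_nonneg (h : Pres φ g) (hφ : ∀ a : K → ℕ, 0 ≤ ∑ x, ∏ k, φ k x ^ a k) :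
    0 ≤ ∑ x, g x := by
  have := h (fun _ => 1) (fun a => ?_) 0
  · simpa [mono] using this
  · simp only [mul_one, mono]
    rw [← Fintype.piFinset_univ, ← Finset.prod_univ_sum (fun _ => Finset.univ) fun i y => ∏ k, φ k y ^ a i k]
    exact Finset.prod_nonneg fun i _ => hφ _

lemma pres_single [DecidableEq K] (k : K) (i : ι) : Pres φ (fun x => φ k (x i)) := by
  have := pres_mono (φ := φ) (Pi.single i (Pi.single k 1))
  refine cast (congrArg (Pres φ) ?_) this
  ext x
  rw [mono, Finset.prod_eq_single i, Finset.prod_eq_single k]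
  · simp
  · intro j _ hj; simp [hj]
  · simp
  · intro j _ hj; simp [hj]
  · simp

end

section
variable {ι : Type*} [Fintype ι] [DecidableEq ι]

/-- Gibbs weight with pair couplings `J` and fields `b`. -/
def gw (J : ι → ι → ℝ) (b : ι → ℝ) (s : ι → Bool) : ℝ :=
  Real.exp (∑ i, ∑ j, J i j * (sval (s i) * sval (s j)) + ∑ i, b i * sval (s i))

/-- Gibbs expectation. -/
def gE (J : ι → ι → ℝ) (b : ι → ℝ) (f : (ι → Bool) → ℝ) : ℝ :=
  (∑ s, gw J b s * f s) / ∑ s, gw J b s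

lemma gw_pos (J : ι → ι → ℝ) (b : ι → ℝ) (s : ι → Bool) : 0 < gw J b s := Real.exp_pos _

lemma gZ_pos (J : ι → ι → ℝ) (b : ι → ℝ) : 0 < ∑ s, gw J b s :=
  Finset.sum_pos (fun _ _ => gw_pos _ _ _) Finset.univ_nonempty

/-- Rotated pair of spins. -/
def rot2 (k : Bool) (x : Bool × Bool) : ℝ := if k then sval x.2 + sval x.1 else sval x.2 - sval x.1

lemma rot2_moment (a : Bool → ℕ) : 0 ≤ ∑ x, ∏ k, rot2 k x ^ a k := by
  simp only [Fintype.sum_prod_type, Fintype.sum_bool, Fintype.prod_bool, rot2, sval]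
  norm_num
  have h1 : ∀ n : ℕ, 0 ≤ (2:ℝ) ^ n + (-2) ^ n := fun n => by
    rw [neg_pow]; rcases neg_one_pow_eq_or ℝ n with h | h <;> rw [h]
    · positivity
    · simp
  have z : ∀ n : ℕ, 0 ≤ (0:ℝ) ^ n := fun n => by positivity
  have := mul_nonneg (h1 (a true)) (z (a false))
  have := mul_nonneg (z (a true)) (h1 (a false))
  linarith

/-- Second Griffiths inequality in the form of monotonicity of the magnetization. -/
lemma gks_mono {J J' : ι → ι → ℝ} {b b' : ι → ℝ} (hJ : ∀ i j, 0 ≤ J i j) (hJJ : ∀ i j, J i j ≤ J' i j)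
    (hb : ∀ i, 0 ≤ b i) (hbb : ∀ i, b i ≤ b' i) (o : ι) :
    gE J b (fun s => sval (s o)) ≤ gE J' b' (fun s => sval (s o)) := by
  rw [gE, gE, div_le_div_iff₀ (gZ_pos _ _) (gZ_pos _ _),
    mul_comm (∑ s, gw J b s * sval (s o)), Finset.sum_mul_sum, Finset.sum_mul_sum, ← sub_nonneg]
  have t : ∀ i, Pres (φ := rot2) (fun x : ι → Bool × Bool => rot2 true (x i)) := pres_single true
  have q : ∀ i, Pres (φ := rot2) (fun x : ι → Bool × Bool => rot2 false (x i)) := pres_single false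
  have c : ∀ {c : ℝ}, 0 ≤ c → Pres (ι := ι) rot2 (fun _ => c) := fun h => pres_const h
  have key := ((q o).mul (((pres_sum Finset.univ fun i _ => pres_sum Finset.univ fun j _ =>
    (((c (by linarith [hJ i j, hJJ i j] : 0 ≤ (J i j + J' i j) / 4)).mul
      (((t i).mul (t j)).add ((q i).mul (q j)))).add
    ((c (by linarith [hJJ i j] : 0 ≤ (J' i j - J i j) / 4)).mul
      (((t i).mul (q j)).add ((q i).mul (t j)))))).add
    (pres_sum Finset.univ fun i _ =>
      ((c (by linarith [hb i, hbb i] : 0 ≤ (b i + b' i) / 2)).mul (t i)).add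
      ((c (by linarith [hbb i] : 0 ≤ (b' i - b i) / 2)).mul (q i)))).exp)).sum_nonneg rot2_moment
  rw [← (Equiv.arrowProdEquivProdArrow ι (fun _ => Bool) (fun _ => Bool)).symm.sum_comp, Fintype.sum_prod_type] at key
  refine key.trans_eq ?_
  rw [Finset.sum_comm, ← Finset.sum_sub_distrib]
  refine Finset.sum_congr rfl fun s' _ => ?_
  rw [← Finset.sum_sub_distrib]
  refine Finset.sum_congr rfl fun s _ => ?_
  have e : gw J' b' s' * gw J b s = Real.exp (∑ i, ∑ j, ((J i j + J' i j) / 4 *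
      (rot2 true (s i, s' i) * rot2 true (s j, s' j) + rot2 false (s i, s' i) * rot2 false (s j, s' j))
      + (J' i j - J i j) / 4 * (rot2 true (s i, s' i) * rot2 false (s j, s' j) +
        rot2 false (s i, s' i) * rot2 true (s j, s' j))) +
      ∑ i, ((b i + b' i) / 2 * rot2 true (s i, s' i) + (b' i - b i) / 2 * rot2 false (s i, s' i))) := by
    rw [gw, gw, ← Real.exp_add]
    congr 1
    rw [add_add_add_comm, ← Finset.sum_add_distrib, ← Finset.sum_add_distrib]
    congr 1
    · refine Finset.sum_congr rfl fun i _ => ?_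
      rw [← Finset.sum_add_distrib]
      refine Finset.sum_congr rfl fun j _ => ?_
      simp only [rot2, if_true, Bool.false_eq_true, if_false]; ring
    · refine Finset.sum_congr rfl fun i _ => ?_
      simp only [rot2, if_true, Bool.false_eq_true, if_false]; ring
  simp only [Equiv.arrowProdEquivProdArrow, Equiv.coe_fn_symm_mk]
  rw [← e]
  simp only [rot2, Bool.false_eq_true, if_false]; ring

/-- Orthogonally rotated quadruple of spins. -/
def rot4 : Fin 4 → Bool × Bool × Bool × Bool → ℝ
  | 0, x => (sval x.1 + sval x.2.1 + sval x.2.2.1 + sval x.2.2.2) / 2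
  | 1, x => (sval x.2.2.1 + sval x.2.2.2 - sval x.1 - sval x.2.1) / 2
  | 2, x => (sval x.1 - sval x.2.1 + sval x.2.2.1 - sval x.2.2.2) / 2
  | 3, x => (sval x.1 - sval x.2.1 - sval x.2.2.1 + sval x.2.2.2) / 2

lemma rot4_moment (a : Fin 4 → ℕ) : 0 ≤ ∑ x, ∏ k, rot4 k x ^ a k := by
  simp only [Fintype.sum_prod_type, Fintype.sum_bool, Fin.prod_univ_four, rot4, sval]
  norm_num
  have z : ∀ n : ℕ, 0 ≤ (0:ℝ) ^ n := fun n => by positivity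
  have h1 : ∀ n : ℕ, 0 ≤ (2:ℝ) ^ n + (-2) ^ n := fun n => by
    rw [neg_pow]; rcases neg_one_pow_eq_or ℝ n with h | h <;> rw [h]
    · positivity
    · simp
  have h2 : ∀ n : ℕ, 0 ≤ 1 + (-1 : ℝ) ^ n ∧ 0 ≤ 1 - (-1 : ℝ) ^ n := fun n => by
    rcases neg_one_pow_eq_or ℝ n with h | h <;> rw [h] <;> norm_num
  have m : ∀ {u v w x : ℝ}, 0 ≤ u → 0 ≤ v → 0 ≤ w → 0 ≤ x → 0 ≤ u * v * w * x :=
    fun a b c d => mul_nonneg (mul_nonneg (mul_nonneg a b) c) d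
  have k0 := m (h1 (a 0)) (z (a 1)) (z (a 2)) (z (a 3))
  have k1 := m (z (a 0)) (h1 (a 1)) (z (a 2)) (z (a 3))
  have k2 := m (z (a 0)) (z (a 1)) (h1 (a 2)) (z (a 3))
  have k3 := m (z (a 0)) (z (a 1)) (z (a 2)) (h1 (a 3))
  have k4 := m (h2 (a 0)).1 (h2 (a 1)).1 (h2 (a 2)).1 (h2 (a 3)).1
  have k5 := m (h2 (a 0)).2 (h2 (a 1)).2 (h2 (a 2)).2 (h2 (a 3)).2
  linarith

/-- The Griffiths-Hurst-Sherman inequality in the form of midpoint concavity. -/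
lemma ghs_midpoint {J : ι → ι → ℝ} {b k : ι → ℝ} (hJ : ∀ i j, 0 ≤ J i j)
    (hb : ∀ i, 0 ≤ b i) (hk : ∀ i, 0 ≤ k i) (o : ι) :
    gE J (fun i => b i + k i) (fun s => sval (s o)) + gE J (fun i => b i - k i) (fun s => sval (s o)) ≤
      2 * gE J b (fun s => sval (s o)) := by
  have r : ∀ k i, Pres (φ := rot4) (fun x : ι → Bool × Bool × Bool × Bool => rot4 k (x i)) := pres_single
  have c : ∀ {c : ℝ}, 0 ≤ c → Pres (ι := ι) rot4 (fun _ => c) := fun h => pres_const h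
  have key := ((r 1 o).mul (((pres_sum Finset.univ fun i _ => pres_sum Finset.univ fun j _ =>
    ((c (hJ i j)).mul (pres_sum Finset.univ fun (k : Fin 4) _ => (r k i).mul (r k j)))).add
    (pres_sum Finset.univ fun i _ => ((c (by linarith [hb i] : 0 ≤ 2 * b i)).mul (r 0 i)).add
      ((c (hk i)).mul ((r 2 i).add (r 3 i))))).exp)).sum_nonneg rot4_moment
  rw [← (Equiv.arrowProdEquivProdArrow ι (fun _ => Bool) (fun _ => Bool × Bool × Bool)).symm.sum_comp,
    Fintype.sum_prod_type] at key
  simp_rw [← (Equiv.arrowProdEquivProdArrow ι (fun _ => Bool) (fun _ => Bool × Bool)).symm.sum_comp,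
    Fintype.sum_prod_type,
    ← (Equiv.arrowProdEquivProdArrow ι (fun _ => Bool) (fun _ => Bool)).symm.sum_comp,
    Fintype.sum_prod_type] at key
  have e : ∀ s₁ s₂ s₃ s₄ : ι → Bool, gw J (fun i => b i + k i) s₁ * gw J (fun i => b i - k i) s₂ *
      gw J b s₃ * gw J b s₄ = Real.exp (∑ i, ∑ j, J i j * (∑ k, rot4 k (s₁ i, s₂ i, s₃ i, s₄ i) *
        rot4 k (s₁ j, s₂ j, s₃ j, s₄ j)) + ∑ i, (2 * b i * rot4 0 (s₁ i, s₂ i, s₃ i, s₄ i) +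
        k i * (rot4 2 (s₁ i, s₂ i, s₃ i, s₄ i) + rot4 3 (s₁ i, s₂ i, s₃ i, s₄ i)))) := by
    intro s₁ s₂ s₃ s₄
    simp only [gw, ← Real.exp_add]
    congr 1
    have r4 : ∀ A₁ B₁ A₂ B₂ A₃ B₃ A₄ B₄ : ℝ, A₁ + B₁ + (A₂ + B₂) + (A₃ + B₃) + (A₄ + B₄) =
      (A₁ + A₂ + A₃ + A₄) + (B₁ + B₂ + B₃ + B₄) := fun _ _ _ _ _ _ _ _ => by ring
    rw [r4]
    refine congrArg₂ (· + ·) ?_ ?_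
    · rw [← Finset.sum_add_distrib, ← Finset.sum_add_distrib, ← Finset.sum_add_distrib]
      refine Finset.sum_congr rfl fun i _ => ?_
      rw [← Finset.sum_add_distrib, ← Finset.sum_add_distrib, ← Finset.sum_add_distrib]
      refine Finset.sum_congr rfl fun j _ => ?_
      simp only [Fin.sum_univ_four, rot4]; ring
    · rw [← Finset.sum_add_distrib, ← Finset.sum_add_distrib, ← Finset.sum_add_distrib]
      refine Finset.sum_congr rfl fun i _ => ?_
      simp only [rot4]; ring
  simp only [Equiv.arrowProdEquivProdArrow, Equiv.coe_fn_symm_mk, ← e] at key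
  simp only [rot4] at key
  have z1 := gZ_pos J (fun i => b i + k i)
  have z2 := gZ_pos J (fun i => b i - k i)
  have z3 := gZ_pos J b
  rw [gE, gE, gE, ← sub_nonneg]
  set Z1 := ∑ s, gw J (fun i => b i + k i) s
  set Z2 := ∑ s, gw J (fun i => b i - k i) s
  set Z3 := ∑ s, gw J b s
  set M1 := ∑ s, gw J (fun i => b i + k i) s * sval (s o)
  set M2 := ∑ s, gw J (fun i => b i - k i) s * sval (s o)
  set M3 := ∑ s, gw J b s * sval (s o)
  have h1 : 0 ≤ Z1 * Z2 * M3 * Z3 - (M1 * Z2 * Z3 * Z3 + Z1 * M2 * Z3 * Z3) / 2 := by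
    have : ∀ f₁ f₂ f₃ f₄ : (ι → Bool) → ℝ, (∑ s, f₁ s) * (∑ s, f₂ s) * (∑ s, f₃ s) * (∑ s, f₄ s) =
        ∑ s₁, ∑ s₂, ∑ s₃, ∑ s₄, f₁ s₁ * f₂ s₂ * f₃ s₃ * f₄ s₄ := by
      intro f₁ f₂ f₃ f₄
      simp only [← Finset.mul_sum, ← Finset.sum_mul]
    have h3 := this (fun s => gw J (fun i => b i + k i) s) (fun s => gw J (fun i => b i - k i) s)
      (fun s => gw J b s * sval (s o)) (gw J b)
    have h4 := this (fun s => gw J (fun i => b i + k i) s) (fun s => gw J (fun i => b i - k i) s)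
      (gw J b) (fun s => gw J b s * sval (s o))
    have h5 := this (fun s => gw J (fun i => b i + k i) s * sval (s o))
      (fun s => gw J (fun i => b i - k i) s) (gw J b) (gw J b)
    have h6 := this (fun s => gw J (fun i => b i + k i) s)
      (fun s => gw J (fun i => b i - k i) s * sval (s o)) (gw J b) (gw J b)
    have h7 : 0 ≤ (Z1 * Z2 * M3 * Z3 + Z1 * Z2 * Z3 * M3 - M1 * Z2 * Z3 * Z3 - Z1 * M2 * Z3 * Z3) / 2 := by
      rw [h3, h4, h5, h6]
      refine key.trans_eq ?_
      simp only [← Finset.sum_add_distrib, ← Finset.sum_sub_distrib, Finset.sum_div]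
      refine Finset.sum_congr rfl fun _ _ => Finset.sum_congr rfl fun _ _ =>
        Finset.sum_congr rfl fun _ _ => Finset.sum_congr rfl fun _ _ => ?_
      ring
    linarith
  have h2 : 2 * (M3 / Z3) - (M1 / Z1 + M2 / Z2) =
    2 * (Z1 * Z2 * M3 * Z3 - (M1 * Z2 * Z3 * Z3 + Z1 * M2 * Z3 * Z3) / 2) / (Z1 * Z2 * Z3 * Z3) := by
    field_simp
  rw [h2]
  positivity

end

section
variable {β h : ℝ} {Λ : Finset (ℤ × ℤ)} {σ : Cfg2} {f : Cfg2 → ℝ}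

/-- Pair couplings of the Ising model in `Λ`. -/
def cpl (β : ℝ) (Λ : Finset (ℤ × ℤ)) (i j : ↥Λ) : ℝ := if (j : ℤ × ℤ) ∈ nbrs i then β / 2 else 0

/-- Fields of the Ising model in `Λ`, boundary condition included. -/
def bfield (β h : ℝ) (Λ : Finset (ℤ × ℤ)) (σ : Cfg2) (i : ↥Λ) : ℝ :=
  β * ∑ y ∈ (nbrs i).filter (fun y => y ∉ Λ), sval (σ y) - h

lemma wt_fill_eq_gw (τ : ↥Λ → Bool) :
    wt β h Λ (fill Λ σ τ) = gw (cpl β Λ) (bfield β h Λ σ) τ := by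
  rw [← isingWeight_fill, isingWeight, gw]
  congr 1
  have e : ∀ i : ↥Λ, fill Λ σ τ i = τ i := fun i => fill_of_mem i.2 σ τ
  rw [← Finset.sum_coe_sort Λ, ← Finset.sum_coe_sort Λ, ← Finset.sum_coe_sort Λ]
  simp only [e]
  have h1 : ∀ i : ↥Λ, ∑ y ∈ Λ.filter (fun y => y ∈ nbrs i), sval (τ i) * sval (fill Λ σ τ y) =
      ∑ j : ↥Λ, if (j : ℤ × ℤ) ∈ nbrs i then sval (τ i) * sval (τ j) else 0 := fun i => by
    rw [Finset.sum_filter, ← Finset.sum_coe_sort Λ]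
    simp only [e]
  simp only [h1, cpl, bfield]
  rw [Finset.sum_div, mul_add, add_sub_assoc, Finset.mul_sum, Finset.mul_sum, Finset.mul_sum,
    ← Finset.sum_sub_distrib]
  congr 1
  · refine Finset.sum_congr rfl fun i _ => ?_
    rw [Finset.sum_div, Finset.mul_sum]
    refine Finset.sum_congr rfl fun j _ => ?_
    split_ifs <;> ring
  · refine Finset.sum_congr rfl fun i _ => ?_
    rw [← Finset.mul_sum]; ring

lemma Ex_sval_eq_gE {o : ℤ × ℤ} (ho : o ∈ Λ) : Ex β h Λ σ (fun η => sval (η o)) =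
    gE (cpl β Λ) (bfield β h Λ σ) (fun s => sval (s ⟨o, ho⟩)) := by
  rw [Ex, Zf, gE]
  simp only [wt_fill_eq_gw, fill_of_mem ho]

lemma cpl_nonneg (hβ : 0 ≤ β) (i j : ↥Λ) : 0 ≤ cpl β Λ i j := by
  unfold cpl; split_ifs <;> linarith

lemma bfield_true (i : ↥Λ) : bfield β h Λ (fun _ => true) i =
    β * ((nbrs i).filter (fun y => y ∉ Λ)).card - h := by
  simp [bfield, sval_true]

/-- Monotonicity of the plus magnetization in the inverse temperature. -/
lemma Ex_sval_mono_beta {β' : ℝ} (hβ : 0 ≤ β) (hββ : β ≤ β') {o : ℤ × ℤ} (ho : o ∈ Λ) :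
    Ex β 0 Λ (fun _ => true) (fun η => sval (η o)) ≤ Ex β' 0 Λ (fun _ => true) (fun η => sval (η o)) := by
  rw [Ex_sval_eq_gE ho, Ex_sval_eq_gE ho]
  refine gks_mono (cpl_nonneg hβ) (fun i j => ?_) (fun i => ?_) (fun i => ?_) _
  · unfold cpl; split_ifs <;> linarith
  · rw [bfield_true, sub_zero]; positivity
  · rw [bfield_true, bfield_true]; gcongr

/-- Midpoint concavity of the plus magnetization in the field. -/
lemma Ex_sval_midpoint {k : ℝ} (hβ : 0 ≤ β) (hh : h ≤ 0) (hk : 0 ≤ k) {o : ℤ × ℤ} (ho : o ∈ Λ) :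
    Ex β (h - k) Λ (fun _ => true) (fun η => sval (η o)) +
      Ex β (h + k) Λ (fun _ => true) (fun η => sval (η o)) ≤
      2 * Ex β h Λ (fun _ => true) (fun η => sval (η o)) := by
  rw [Ex_sval_eq_gE ho, Ex_sval_eq_gE ho, Ex_sval_eq_gE ho]
  have := ghs_midpoint (J := cpl β Λ) (b := bfield β h Λ (fun _ => true)) (k := fun _ => k)
    (cpl_nonneg hβ) (fun i => ?_) (fun _ => hk) ⟨o, ho⟩
  · have e1 : bfield β (h - k) Λ (fun _ => true) = fun i => bfield β h Λ (fun _ => true) i + k := by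
      ext i; simp only [bfield]; ring
    have e2 : bfield β (h + k) Λ (fun _ => true) = fun i => bfield β h Λ (fun _ => true) i - k := by
      ext i; simp only [bfield]; ring
    rw [e1, e2]; exact this
  · rw [bfield_true]
    have : 0 ≤ β * ((nbrs (i : ℤ × ℤ)).filter (fun y => y ∉ Λ)).card := by positivity
    linarith

lemma sval_not (b : Bool) : sval (!b) = - sval b := by cases b <;> simp [sval]

lemma wt_flip (η : Cfg2) : wt β h Λ (fun x => !η x) = wt β (-h) Λ η := by
  rw [wt_eq β h Λ _ subset_rfl, wt_eq β (-h) Λ _ subset_rfl]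
  congr 1
  have e : ∀ x, bondE Λ (fun x => !η x) x = bondE Λ η x := fun x => by
    simp only [bondE, sval_not]; ring
  simp only [e, sval_not, Finset.sum_neg_distrib]; ring

/-- Spin-flip symmetry. -/
lemma Ex_flip : Ex β h Λ (fun x => !σ x) f = Ex β (-h) Λ σ (fun η => f (fun x => !η x)) := by
  have e : ∀ τ : ↥Λ → Bool, fill Λ (fun x => !σ x) (fun i => !τ i) = fun x => !fill Λ σ τ x := fun τ => by
    ext x
    by_cases hx : x ∈ Λ
    · simp [fill_of_mem hx]
    · simp [fill_of_notMem hx]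
  have inv : Function.Involutive (fun (τ : ↥Λ → Bool) i => !τ i) := fun τ => by simp
  have c : ∀ F : (↥Λ → Bool) → ℝ, ∑ τ, F τ = ∑ τ : ↥Λ → Bool, F (fun i => !τ i) := fun F =>
    ((inv.toPerm _ : Equiv.Perm _).sum_comp Finset.univ F (by simp)).symm
  rw [Ex, Ex, Zf, Zf, c, c (fun τ => wt β h Λ (fill Λ (fun x => !σ x) τ))]
  simp only [e, wt_flip]

lemma Ex_false_sval (o : ℤ × ℤ) : Ex β h Λ (fun _ => false) (fun η => sval (η o)) =
    - Ex β (-h) Λ (fun _ => true) (fun η => sval (η o)) := by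
  have := Ex_flip (β := β) (h := h) (Λ := Λ) (σ := fun _ => true) (f := fun η => sval (η o))
  simp only [Bool.not_true, sval_not] at this
  rw [this, Ex_neg]

lemma abs_Ex_sval (o : ℤ × ℤ) : |Ex β h Λ σ (fun η => sval (η o))| ≤ 1 := by
  rw [abs_le]
  constructor
  · rw [← Ex_const (β := β) (h := h) (Λ := Λ) (σ := σ) (-1)]
    exact Ex_mono fun η _ => (abs_le.1 (abs_sval _).le).1
  · rw [← Ex_const (β := β) (h := h) (Λ := Λ) (σ := σ) 1]
    exact Ex_mono fun η _ => (abs_le.1 (abs_sval _).le).2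

lemma sval_at_mono (o : ℤ × ℤ) : Monotone (fun η : Cfg2 => sval (η o)) := fun _ _ h => sval_mono (h o)

/-- The plus magnetization in infinite volume. -/
def mp (β h : ℝ) : ℝ := ⨅ n, Ex β h (box n) (fun _ => true) (fun η => sval (η 0))

lemma mp_bdd : BddBelow (Set.range fun n => Ex β h (box n) (fun _ => true) (fun η => sval (η 0))) :=
  ⟨-1, by rintro _ ⟨n, rfl⟩; exact (abs_le.1 (abs_Ex_sval 0)).1⟩

lemma mp_tendsto (hβ : 0 ≤ β) : Tendsto (fun n => Ex β h (box n) (fun _ => true) (fun η => sval (η 0)))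
    atTop (𝓝 (mp β h)) :=
  tendsto_atTop_ciInf (fun _ _ hmn => Ex_domain_anti hβ (box_mono hmn) (sval_at_mono 0)) mp_bdd

lemma mp_le_Ex (hβ : 0 ≤ β) (o : ℤ × ℤ) (Λ : Finset (ℤ × ℤ)) :
    mp β h ≤ Ex β h Λ (fun _ => true) (fun η => sval (η o)) := by
  obtain ⟨n, hn⟩ := exists_subset_box (Λ.image (· + (-o)))
  refine (ciInf_le mp_bdd n).trans ((Ex_domain_anti hβ hn (sval_at_mono 0)).trans_eq ?_)
  rw [Ex_shift]
  have : shiftC (-o) (fun _ => true) = fun _ => true := rfl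
  rw [this]
  simp only [shiftC, zero_add, neg_neg]

lemma abs_mp (hβ : 0 ≤ β) : |mp β h| ≤ 1 :=
  le_of_tendsto (mp_tendsto hβ).abs (Eventually.of_forall fun _ => abs_Ex_sval 0)

lemma mp_midpoint {k : ℝ} (hβ : 0 ≤ β) (hh : h ≤ 0) (hk : 0 ≤ k) :
    mp β (h - k) + mp β (h + k) ≤ 2 * mp β h :=
  le_of_tendsto_of_tendsto' ((mp_tendsto hβ).add (mp_tendsto hβ)) ((mp_tendsto hβ).const_mul 2)
    fun n => Ex_sval_midpoint hβ hh hk (mem_box.2 (by simp))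

lemma mp_mono_beta {β' : ℝ} (hβ : 0 ≤ β) (hββ : β ≤ β') : mp β 0 ≤ mp β' 0 :=
  le_of_tendsto_of_tendsto' (mp_tendsto hβ) (mp_tendsto (hβ.trans hββ))
    fun n => Ex_sval_mono_beta hβ hββ (mem_box.2 (by simp))

lemma mp_zero_nonneg (hβ : 0 ≤ β) : 0 ≤ mp β 0 := by
  refine ge_of_tendsto' (mp_tendsto hβ) fun n => ?_
  have := Ex_bc_mono (β := β) (h := 0) (Λ := box n) hβ (σ := fun _ => false) (σ' := fun _ => true)
    (fun _ => Bool.false_le _) (sval_at_mono 0)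
  rw [Ex_false_sval, neg_zero] at this
  linarith

lemma Ev_sval_eq_mp {μ : Measure Cfg2} (hμ : IsPlusPhase β h μ) (hβ : 0 ≤ β) :
    Ev μ (fun η => sval (η 0)) = mp β h :=
  tendsto_nhds_unique (Ex_tendsto hμ (loc_sval (Finset.mem_singleton_self 0))) (mp_tendsto hβ)

lemma Pm_zero_eq {μ : Measure Cfg2} (hμ : IsPlusPhase β h μ) (hβ : 0 ≤ β) :
    Pm μ {0} = (1 - mp β h) / 2 := by
  rw [← Ev_sval_eq_mp hμ hβ, Pm]
  have e : minusInd {(0 : ℤ × ℤ)} = fun η => 1 / 2 + (- (1 / 2)) * sval (η 0) := by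
    ext η; rw [minusInd_singleton]; ring
  rw [e, Ev_add hμ (loc_const _) (S := ∅) (T := {0})
    ((loc_sval (Finset.mem_singleton_self 0)).comp fun x => -(1/2) * x), Ev_const hμ, Ev_mul_left]
  ring

lemma siteConv_of_mp {μ : Measure Cfg2} (hμ : IsPlusPhase β h μ) (hβ : 0 ≤ β)
    (H : mp β h + mp β (-h) ≤ 0) : SiteConv μ 0 := by
  refine siteConv_of_unique hμ hβ fun ε hε => ?_
  obtain ⟨n, hn⟩ := ((mp_tendsto (h := -h) hβ).eventually (gt_mem_nhds (show mp β (-h) < mp β (-h) + ε by linarith))).exists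
  refine ⟨box n, ?_⟩
  have e : minusInd {(0 : ℤ × ℤ)} = fun η => 1 / 2 + (- (1 / 2)) * sval (η 0) := by
    ext η; rw [minusInd_singleton]; ring
  rw [Pm_zero_eq hμ hβ, e, Ex_add, Ex_const, Ex_mul_left, Ex_false_sval]
  linarith

lemma exp_Ex_le (f : Cfg2 → ℝ) : Real.exp (Ex β h Λ σ f) ≤ Ex β h Λ σ (fun η => Real.exp (f η)) := by
  set c := Ex β h Λ σ f with hc
  have : Ex β h Λ σ (fun η => Real.exp c * (f η - c + 1)) ≤ Ex β h Λ σ (fun η => Real.exp (f η)) :=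
    Ex_mono fun η _ => by
      have := Real.add_one_le_exp (f η - c)
      calc Real.exp c * (f η - c + 1) ≤ Real.exp c * Real.exp (f η - c) := by gcongr
        _ = _ := by rw [← Real.exp_add]; congr 1; ring
  rwa [Ex_mul_left, Ex_add, Ex_const, Ex_sub, Ex_const, ← hc, sub_self, zero_add, mul_one] at this

lemma wt_field (h h' : ℝ) (η : Cfg2) :
    wt β h' Λ η = wt β h Λ η * Real.exp ((h - h') * ∑ x ∈ Λ, sval (η x)) := by
  rw [wt_eq β h Λ _ subset_rfl, wt_eq β h' Λ _ subset_rfl, ← Real.exp_add]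
  congr 1; ring

lemma Zf_field_ge (h h' : ℝ) : Zf β h Λ σ * Real.exp ((h - h') * ∑ x ∈ Λ, Ex β h Λ σ (fun η => sval (η x))) ≤
    Zf β h' Λ σ := by
  have e : Zf β h' Λ σ = Ex β h Λ σ (fun η => Real.exp ((h - h') * ∑ x ∈ Λ, sval (η x))) * Zf β h Λ σ := by
    rw [Ex_mul_Zf, Zf]; simp only [← wt_field]
  rw [e, mul_comm]
  refine mul_le_mul_of_nonneg_right ?_ Zf_pos.le
  rw [← Ex_sum, ← Ex_mul_left]
  exact exp_Ex_le _

/-- Number of boundary bonds. -/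
def bdry (Λ : Finset (ℤ × ℤ)) : ℝ := ∑ x ∈ Λ, ((nbrs x).filter (fun y => y ∉ Λ)).card

lemma Zf_bc_le (hβ : 0 ≤ β) (σ σ' : Cfg2) : Zf β h Λ σ ≤ Real.exp (2 * β * bdry Λ) * Zf β h Λ σ' := by
  rw [Zf, Zf, Finset.mul_sum]
  refine Finset.sum_le_sum fun τ _ => ?_
  rw [wt_fill_eq_gw, wt_fill_eq_gw, gw, gw, ← Real.exp_add, Real.exp_le_exp]
  have : ∑ i, bfield β h Λ σ i * sval (τ i) ≤ 2 * β * bdry Λ + ∑ i, bfield β h Λ σ' i * sval (τ i) := by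
    rw [bdry, ← Finset.sum_coe_sort Λ, Finset.mul_sum, ← Finset.sum_add_distrib]
    refine Finset.sum_le_sum fun i _ => ?_
    have b : ∀ σ : Cfg2, |β * ∑ y ∈ (nbrs (i : ℤ × ℤ)).filter (fun y => y ∉ Λ), sval (σ y)| ≤
        β * ((nbrs (i : ℤ × ℤ)).filter (fun y => y ∉ Λ)).card := fun σ => by
      rw [abs_mul, abs_of_nonneg hβ]
      refine mul_le_mul_of_nonneg_left ((Finset.abs_sum_le_sum_abs _ _).trans_eq ?_) hβ
      simp [abs_sval]
    have h1 := abs_le.1 (b σ)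
    have h2 := abs_le.1 (b σ')
    simp only [bfield]
    rcases Bool.eq_false_or_eq_true (τ i) with h | h <;> rw [h] <;>
      simp only [sval_true, sval_false] <;> linarith [h1.1, h1.2, h2.1, h2.2]
  linarith

lemma pressure_bound {h' : ℝ} (hβ : 0 ≤ β) (hh : h < h') (Λ : Finset (ℤ × ℤ)) :
    (h' - h) * (Λ.card * (mp β h' + mp β (-h))) ≤ 4 * β * bdry Λ := by
  have a1 := Zf_field_ge (β := β) (Λ := Λ) (σ := fun _ => true) h' h
  have a2 := Zf_field_ge (β := β) (Λ := Λ) (σ := fun _ => false) h h'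
  have a3 := Zf_bc_le (h := h) (Λ := Λ) hβ (fun _ => true) (fun _ => false)
  have a4 := Zf_bc_le (h := h') (Λ := Λ) hβ (fun _ => false) (fun _ => true)
  set Zp := Zf β h Λ (fun _ => true)
  set Zm := Zf β h Λ (fun _ => false)
  set Zp' := Zf β h' Λ (fun _ => true)
  set Zm' := Zf β h' Λ (fun _ => false)
  have p1 : 0 < Zm := Zf_pos
  have p2 : 0 < Zp' := Zf_pos
  set X := ∑ x ∈ Λ, Ex β h' Λ (fun _ => true) (fun η => sval (η x))
  set Y := ∑ x ∈ Λ, Ex β h Λ (fun _ => false) (fun η => sval (η x))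
  set c := 2 * β * bdry Λ
  have hX : Λ.card * mp β h' ≤ X := by
    rw [← nsmul_eq_mul]; exact Finset.card_nsmul_le_sum _ _ _ fun x _ => mp_le_Ex hβ x Λ
  have hY : Λ.card * mp β (-h) ≤ - Y := by
    simp only [Y, Ex_false_sval, Finset.sum_neg_distrib, neg_neg]
    rw [← nsmul_eq_mul]; exact Finset.card_nsmul_le_sum _ _ _ fun x _ => mp_le_Ex hβ x Λ
  have b1 : Zp' * Real.exp ((h' - h) * X) ≤ Real.exp c * Zm := a1.trans a3
  have b2 : Zm * Real.exp ((h - h') * Y) ≤ Real.exp c * Zp' := a2.trans a4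
  have b3 : Real.exp ((h' - h) * X + (h - h') * Y) ≤ Real.exp (c + c) := by
    rw [Real.exp_add, Real.exp_add]
    have := mul_le_mul b1 b2 (by positivity) (by positivity)
    have hp : 0 < Zp' * Zm := by positivity
    nlinarith
  have b4 := Real.exp_le_exp.1 b3
  have : (h' - h) * (Λ.card * mp β h' + Λ.card * mp β (-h)) ≤ (h' - h) * (X + - Y) :=
    mul_le_mul_of_nonneg_left (add_le_add hX hY) (by linarith)
  have hc : c = 2 * β * bdry Λ := rfl
  nlinarith

lemma card_box (n : ℕ) : ((box n).card : ℝ) = (2 * n + 1) ^ 2 := by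
  rw [box, Finset.card_product, Int.card_Icc]
  have : ((n : ℤ) + 1 - -(n : ℤ)).toNat = 2 * n + 1 := by omega
  rw [this]; push_cast; ring

lemma bdry_box (n : ℕ) : bdry (box (n + 1)) ≤ 32 * (n + 1) := by
  have h1 : bdry (box (n + 1)) ≤ ∑ x ∈ box (n + 1) \ box n, (4 : ℝ) := by
    rw [bdry, ← Finset.sum_sdiff (box_mono (Nat.le_succ n))]
    have : ∑ x ∈ box n, (((nbrs x).filter (fun y => y ∉ box (n + 1))).card : ℝ) = 0 := by
      refine Finset.sum_eq_zero fun x hx => ?_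
      rw [Nat.cast_eq_zero, Finset.card_eq_zero, Finset.filter_eq_empty_iff]
      intro y hy
      rw [not_not, mem_box]
      rw [mem_box] at hx
      simp only [nbrs, Finset.mem_insert, Finset.mem_singleton] at hy
      rcases hy with rfl | rfl | rfl | rfl <;> simp only <;> omega
    rw [this, add_zero]
    refine Finset.sum_le_sum fun x _ => ?_
    have : ((nbrs x).filter (fun y => y ∉ box (n + 1))).card ≤ 4 :=
      (Finset.card_filter_le _ _).trans Finset.card_le_four
    exact_mod_cast this
  refine h1.trans ?_
  rw [Finset.sum_const, nsmul_eq_mul, Finset.card_sdiff_of_subset (box_mono (Nat.le_succ n)),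
    Nat.cast_sub (Finset.card_le_card (box_mono (Nat.le_succ n))), card_box, card_box]
  push_cast
  nlinarith

lemma mp_cross {h' : ℝ} (hβ : 0 ≤ β) (hh : h < h') : mp β h' + mp β (-h) ≤ 0 := by
  by_contra! hc
  set a := (h' - h) * (mp β h' + mp β (-h))
  have ha : 0 < a := mul_pos (by linarith) hc
  obtain ⟨n, hn⟩ := exists_nat_gt (128 * β / a)
  rw [div_lt_iff₀ ha] at hn
  have h1 := pressure_bound hβ hh (box (n + 1))
  have h2 := mul_le_mul_of_nonneg_left (bdry_box n) (show 0 ≤ 4 * β by linarith)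
  rw [card_box] at h1
  push_cast at h1
  have h3 : a * (2 * (n + 1) + 1) ^ 2 ≤ 128 * β * (n + 1) := by
    calc a * (2 * (n + 1) + 1) ^ 2 = _ := by simp only [a]; ring
      _ ≤ _ := h1
      _ ≤ _ := h2
      _ = _ := by ring
  have : (0 : ℝ) ≤ n := n.cast_nonneg
  have h4 := mul_lt_mul_of_pos_right hn (show (0:ℝ) < n + 1 by positivity)
  nlinarith [mul_nonneg ha.le this, mul_nonneg (mul_nonneg ha.le this) this]

lemma mp_neg_field (hβ : 0 ≤ β) (hh : h < 0) : mp β h + mp β (-h) ≤ 0 := by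
  refine le_of_forall_pos_le_add fun ε hε => ?_
  obtain ⟨J, hJ⟩ := exists_nat_gt (2 / ε)
  have hJ0 : (0 : ℝ) < J := lt_trans (by positivity) hJ
  rw [div_lt_iff₀ hε] at hJ
  set k := -h / J with hk
  have hk0 : 0 < k := div_pos (by linarith) hJ0
  have hkJ : J * k = -h := by rw [hk]; field_simp
  have h1 : mp β (h + k) + mp β (-h) ≤ 0 := mp_cross hβ (by linarith)
  have inc : ∀ j : ℕ, j < J → mp β h - mp β (h + k) ≤ mp β (h + j * k) - mp β (h + (j + 1) * k) := by
    intro j hj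
    induction j with
    | zero => simp
    | succ j ih =>
      refine (ih (by omega)).trans ?_
      have hj' : ((j + 1 : ℕ) : ℝ) * k ≤ J * k := by gcongr
      have := mp_midpoint (β := β) (h := h + (j + 1 : ℕ) * k) (k := k) hβ (by linarith) hk0.le
      have e1 : h + (j + 1 : ℕ) * k - k = h + j * k := by push_cast; ring
      have e2 : h + (j + 1 : ℕ) * k + k = h + ((j + 1 : ℕ) + 1) * k := by push_cast; ring
      have e3 : h + (j + 1 : ℕ) * k = h + (j + 1) * k := by push_cast; ring
      rw [e1, e2, e3] at this
      push_cast at this ⊢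
      linarith
  have h2 : J * (mp β h - mp β (h + k)) ≤ mp β h - mp β (h + J * k) := by
    have := Finset.sum_range_sub' (fun j : ℕ => mp β (h + j * k)) J
    simp only [Nat.cast_zero, zero_mul, add_zero] at this
    rw [← this, ← nsmul_eq_mul]
    have := Finset.card_nsmul_le_sum (Finset.range J)
      (fun j : ℕ => mp β (h + j * k) - mp β (h + (j + 1 : ℕ) * k)) (mp β h - mp β (h + k))
      (fun j hj => by have := inc j (Finset.mem_range.1 hj); push_cast; exact this)
    rwa [Finset.card_range] at this
  have h3 := abs_le.1 (abs_mp (β := β) (h := h) hβ)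
  have h4 := abs_le.1 (abs_mp (β := β) (h := h + J * k) hβ)
  have : mp β h - mp β (h + k) ≤ ε := by
    by_contra! hc
    have := mul_lt_mul_of_pos_left hc hJ0
    linarith [h3.1, h3.2, h4.1, h4.2]
  linarith

lemma mp_field_ne_zero (hβ : 0 ≤ β) (hh : h ≠ 0) : mp β h + mp β (-h) ≤ 0 := by
  rcases lt_or_gt_of_ne hh with h0 | h0
  · exact mp_neg_field hβ h0
  · have := mp_neg_field (h := -h) hβ (by linarith)
    rw [neg_neg] at this; linarith

end

section
open Matrix
variable {X : Type*} [Fintype X]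

/-- `e` is an orthonormal basis (in coordinates) made of eigenvectors of `M`. -/
structure IsEigenbasis (M : Matrix X X ℝ) (e : X → X → ℝ) (μ : X → ℝ) : Prop where
  eig : ∀ i, M *ᵥ e i = μ i • e i
  norm : ∀ i, e i ⬝ᵥ e i = 1
  expand : ∀ x, x = ∑ i, (e i ⬝ᵥ x) • e i

lemma exists_eigenbasis [DecidableEq X] {M : Matrix X X ℝ} (hM : M.IsSymm) :
    ∃ e μ, IsEigenbasis M e μ := by
  have hH : M.IsHermitian := by
    rw [Matrix.IsHermitian, Matrix.conjTranspose_eq_transpose_of_trivial]; exact hM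
  have ip : ∀ i (x : EuclideanSpace ℝ X), (hH.eigenvectorBasis i).ofLp ⬝ᵥ x.ofLp =
      inner ℝ (hH.eigenvectorBasis i) x := fun i x => by
    rw [EuclideanSpace.inner_eq_star_dotProduct, dotProduct_comm]; simp
  refine ⟨fun i => (hH.eigenvectorBasis i).ofLp, hH.eigenvalues, ⟨fun i => ?_, fun i => ?_, fun x => ?_⟩⟩
  · exact hH.mulVec_eigenvectorBasis i
  · rw [ip, real_inner_self_eq_norm_sq, hH.eigenvectorBasis.norm_eq_one, one_pow]
  · have := congrArg WithLp.ofLp (hH.eigenvectorBasis.sum_repr' (WithLp.toLp 2 x))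
    simp only [WithLp.ofLp_sum, WithLp.ofLp_smul, ← ip] at this
    exact this.symm

namespace IsEigenbasis
variable {M : Matrix X X ℝ} {e : X → X → ℝ} {μ : X → ℝ}

lemma dot (h : IsEigenbasis M e μ) (x y : X → ℝ) : x ⬝ᵥ y = ∑ i, (e i ⬝ᵥ x) * (e i ⬝ᵥ y) := by
  conv_lhs => rw [h.expand y]
  rw [dotProduct_sum]
  refine Finset.sum_congr rfl fun i _ => ?_
  rw [dotProduct_smul, dotProduct_comm x, smul_eq_mul, mul_comm]

lemma dot_mulVec (h : IsEigenbasis M e μ) (hM : M.IsSymm) (i : X) (y : X → ℝ) :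
    e i ⬝ᵥ (M *ᵥ y) = μ i * (e i ⬝ᵥ y) := by
  rw [dotProduct_mulVec, ← mulVec_transpose, hM.eq, h.eig, smul_dotProduct, smul_eq_mul]

lemma form (h : IsEigenbasis M e μ) (hM : M.IsSymm) (x y : X → ℝ) :
    x ⬝ᵥ (M *ᵥ y) = ∑ i, μ i * ((e i ⬝ᵥ x) * (e i ⬝ᵥ y)) := by
  rw [h.dot]
  refine Finset.sum_congr rfl fun i _ => ?_
  rw [h.dot_mulVec hM]; ring

lemma dot_pow [DecidableEq X] (h : IsEigenbasis M e μ) (hM : M.IsSymm) (N : ℕ) (i : X) (y : X → ℝ) :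
    e i ⬝ᵥ ((M ^ N) *ᵥ y) = μ i ^ N * (e i ⬝ᵥ y) := by
  induction N generalizing y with
  | zero => simp
  | succ N ih => rw [pow_succ, ← mulVec_mulVec, ih, h.dot_mulVec hM, pow_succ, mul_assoc]

lemma form_pow [DecidableEq X] (h : IsEigenbasis M e μ) (hM : M.IsSymm) (N : ℕ) (x y : X → ℝ) :
    x ⬝ᵥ ((M ^ N) *ᵥ y) = ∑ i, μ i ^ N * ((e i ⬝ᵥ x) * (e i ⬝ᵥ y)) := by
  rw [h.dot]
  refine Finset.sum_congr rfl fun i _ => ?_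
  rw [h.dot_pow hM]; ring

end IsEigenbasis

lemma dot_mulVec_symm {M : Matrix X X ℝ} (hM : M.IsSymm) (x y : X → ℝ) :
    x ⬝ᵥ (M *ᵥ y) = (M *ᵥ x) ⬝ᵥ y := by
  rw [dotProduct_mulVec, ← mulVec_transpose, hM.eq]

lemma dot_self_nonneg (x : X → ℝ) : 0 ≤ x ⬝ᵥ x := Finset.sum_nonneg fun _ _ => mul_self_nonneg _

lemma dot_self_pos {x : X → ℝ} (hx : x ≠ 0) : 0 < x ⬝ᵥ x :=
  lt_of_le_of_ne (dot_self_nonneg x) fun h => hx (dotProduct_self_eq_zero.1 h.symm)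

lemma dot_sq_le (x y : X → ℝ) : (x ⬝ᵥ y) ^ 2 ≤ (x ⬝ᵥ x) * (y ⬝ᵥ y) := by
  have := Finset.sum_mul_sq_le_sq_mul_sq Finset.univ x y
  simpa only [dotProduct, sq] using this

/-- A symmetric matrix with nonnegative entries whose form is bounded by `T` has powers bounded
by powers of `T`. -/
lemma form_pow_le [DecidableEq X] {B : Matrix X X ℝ} (hB : B.IsSymm) (h0 : ∀ i j, 0 ≤ B i j) {T : ℝ}
    (hT : ∀ x, x ⬝ᵥ (B *ᵥ x) ≤ T * (x ⬝ᵥ x)) (k : ℕ) (x : X → ℝ) :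
    x ⬝ᵥ ((B ^ k) *ᵥ x) ≤ T ^ k * (x ⬝ᵥ x) := by
  obtain ⟨e, μ, h⟩ := exists_eigenbasis hB
  have hμ : ∀ i, |μ i| ≤ T := fun i => by
    have h1 : |e i ⬝ᵥ (B *ᵥ e i)| ≤ (fun j => |e i j|) ⬝ᵥ (B *ᵥ fun j => |e i j|) := by
      simp only [dotProduct, mulVec]
      refine (Finset.abs_sum_le_sum_abs _ _).trans (Finset.sum_le_sum fun j _ => ?_)
      rw [abs_mul]
      refine mul_le_mul_of_nonneg_left ((Finset.abs_sum_le_sum_abs _ _).trans_eq ?_) (abs_nonneg _)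
      refine Finset.sum_congr rfl fun l _ => ?_
      rw [abs_mul, abs_of_nonneg (h0 _ _)]
    have h2 : (fun j => |e i j|) ⬝ᵥ (fun j => |e i j|) = 1 := by
      rw [← h.norm i]; simp only [dotProduct, abs_mul_abs_self]
    rw [h.eig, dotProduct_smul, h.norm, smul_eq_mul, mul_one] at h1
    have h3 := hT fun j => |e i j|
    rw [h2] at h3
    linarith
  rw [h.form_pow hB, h.dot, Finset.mul_sum]
  refine Finset.sum_le_sum fun i _ => mul_le_mul_of_nonneg_right ?_ (mul_self_nonneg _)
  exact (le_abs_self _).trans (by rw [abs_pow]; exact pow_le_pow_left₀ (abs_nonneg _) (hμ i) k)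

/-- Perron-Frobenius data of a symmetric matrix. -/
structure IsPerron [DecidableEq X] (V : Matrix X X ℝ) (r : ℝ) (Ω : X → ℝ) : Prop where
  pos : 0 < r
  vec_pos : ∀ i, 0 < Ω i
  norm : Ω ⬝ᵥ Ω = 1
  eig : V *ᵥ Ω = r • Ω
  form_le : ∀ x, x ⬝ᵥ (V *ᵥ x) ≤ r * (x ⬝ᵥ x)
  lim : ∀ x y, Tendsto (fun N : ℕ => (x ⬝ᵥ ((V ^ N) *ᵥ y)) / r ^ N) atTop (𝓝 ((Ω ⬝ᵥ x) * (Ω ⬝ᵥ y)))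

lemma exists_perron [DecidableEq X] [Nonempty X] {V : Matrix X X ℝ} (hV : V.IsSymm)
    (h0 : ∀ i j, 0 < V i j) : ∃ r Ω, IsPerron V r Ω := by
  obtain ⟨e, μ, h⟩ := exists_eigenbasis hV
  obtain ⟨i₀, -, hi₀⟩ := Finset.exists_max_image Finset.univ (fun i => |μ i|) Finset.univ_nonempty
  set r := |μ i₀| with hr
  have hle : ∀ x, x ⬝ᵥ (V *ᵥ x) ≤ r * (x ⬝ᵥ x) := fun x => by
    rw [h.form hV, h.dot, Finset.mul_sum]
    exact Finset.sum_le_sum fun i _ => mul_le_mul_of_nonneg_right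
      ((le_abs_self _).trans (hi₀ i (Finset.mem_univ _))) (mul_self_nonneg _)
  have hmax : ∀ x, x ⬝ᵥ (V *ᵥ x) = r * (x ⬝ᵥ x) → V *ᵥ x = r • x := fun x hx => by
    have h1 : ∑ i, (r - μ i) * ((e i ⬝ᵥ x) * (e i ⬝ᵥ x)) = 0 := by
      simp only [sub_mul, Finset.sum_sub_distrib]
      rw [← h.form hV, hx, h.dot, Finset.mul_sum, sub_self]
    have h2 : ∀ i, (r - μ i) * ((e i ⬝ᵥ x) * (e i ⬝ᵥ x)) = 0 := fun i =>
      (Finset.sum_eq_zero_iff_of_nonneg fun i _ => mul_nonneg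
        (sub_nonneg.2 ((le_abs_self _).trans (hi₀ i (Finset.mem_univ _)))) (mul_self_nonneg _)).1 h1 i (Finset.mem_univ _)
    rw [h.expand (V *ᵥ x), h.expand (r • x)]
    refine Finset.sum_congr rfl fun i _ => ?_
    rw [h.dot_mulVec hV, dotProduct_smul, smul_eq_mul]
    rcases mul_eq_zero.1 (h2 i) with h3 | h3
    · rw [show μ i = r by linarith]
    · rw [mul_self_eq_zero.1 h3, mul_zero, mul_zero]
  have habs : ∀ x, |x ⬝ᵥ (V *ᵥ x)| = ∑ i, ∑ j, |x i| * (V i j * |x j|) →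
      ∀ i j, x i * x j = |x i| * |x j| ∨ ∀ i j, x i * x j = - (|x i| * |x j|) := by
    intro x hx i j
    have e1 : x ⬝ᵥ (V *ᵥ x) = ∑ i, ∑ j, x i * (V i j * x j) := by
      simp only [dotProduct, mulVec, Finset.mul_sum]
    rw [e1] at hx
    have key : ∀ s : ℝ, (s = 1 ∨ s = -1) → s * ∑ i, ∑ j, x i * (V i j * x j) = ∑ i, ∑ j, |x i| * (V i j * |x j|) →
        ∀ i j, s * (x i * x j) = |x i| * |x j| := by
      intro s hs hsum
      have nn : ∀ i j, 0 ≤ V i j * (|x i| * |x j| - s * (x i * x j)) := fun i j => by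
        refine mul_nonneg (h0 i j).le (sub_nonneg.2 ?_)
        rw [← abs_mul]
        rcases hs with rfl | rfl
        · rw [one_mul]; exact le_abs_self _
        · rw [neg_one_mul]; exact neg_le_abs _
      have z : ∑ i, ∑ j, V i j * (|x i| * |x j| - s * (x i * x j)) = 0 := by
        rw [← sub_eq_zero.2 hsum.symm, Finset.mul_sum, ← Finset.sum_sub_distrib]
        refine Finset.sum_congr rfl fun i _ => ?_
        rw [Finset.mul_sum, ← Finset.sum_sub_distrib]
        exact Finset.sum_congr rfl fun j _ => by ring
      intro i j
      have z1 := (Finset.sum_eq_zero_iff_of_nonneg fun i _ => Finset.sum_nonneg fun j _ => nn i j).1 z i (Finset.mem_univ _)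
      have z2 := (Finset.sum_eq_zero_iff_of_nonneg fun j _ => nn i j).1 z1 j (Finset.mem_univ _)
      rcases mul_eq_zero.1 z2 with z3 | z3
      · exact absurd z3 (h0 i j).ne'
      · linarith
    rcases abs_choice (∑ i, ∑ j, x i * (V i j * x j)) with h1 | h1 <;> rw [h1] at hx
    · left
      have := key 1 (Or.inl rfl) (by rw [one_mul]; exact hx) i j
      rwa [one_mul] at this
    · right
      intro i j
      have := key (-1) (Or.inr rfl) (by rw [neg_one_mul]; exact hx) i j
      linarith
  have hform : ∀ x : X → ℝ, (fun j => |x j|) ⬝ᵥ (V *ᵥ fun j => |x j|) = ∑ i, ∑ j, |x i| * (V i j * |x j|) :=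
    fun x => by simp only [dotProduct, mulVec, Finset.mul_sum]
  have hnorm : ∀ x : X → ℝ, (fun j => |x j|) ⬝ᵥ (fun j => |x j|) = x ⬝ᵥ x := fun x => by
    simp only [dotProduct, abs_mul_abs_self]
  have hge : ∀ x : X → ℝ, |x ⬝ᵥ (V *ᵥ x)| ≤ ∑ i, ∑ j, |x i| * (V i j * |x j|) := fun x => by
    simp only [dotProduct, mulVec, Finset.mul_sum]
    refine (Finset.abs_sum_le_sum_abs _ _).trans (Finset.sum_le_sum fun i _ => ?_)
    refine (Finset.abs_sum_le_sum_abs _ _).trans_eq (Finset.sum_congr rfl fun j _ => ?_)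
    rw [abs_mul, abs_mul, abs_of_pos (h0 _ _)]
  -- an extremal eigenvector has strictly positive modulus
  have ext : ∀ (x : X → ℝ) (c : ℝ), x ≠ 0 → V *ᵥ x = c • x → |c| = r →
      V *ᵥ (fun j => |x j|) = r • (fun j => |x j|) ∧
      |x ⬝ᵥ (V *ᵥ x)| = ∑ i, ∑ j, |x i| * (V i j * |x j|) := by
    intro x c hx hc hcr
    have h1 : |x ⬝ᵥ (V *ᵥ x)| = r * (x ⬝ᵥ x) := by
      rw [hc, dotProduct_smul, smul_eq_mul, abs_mul, hcr, abs_of_nonneg (dot_self_nonneg x)]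
    have h2 := hge x
    have h3 := hle fun j => |x j|
    rw [hform, hnorm] at h3
    have h4 : ∑ i, ∑ j, |x i| * (V i j * |x j|) = r * (x ⬝ᵥ x) := le_antisymm h3 (h1 ▸ h2)
    refine ⟨hmax _ ?_, by rw [h1, h4]⟩
    rw [hform, hnorm, h4]
  have e0 : e i₀ ≠ 0 := fun hh => by have := h.norm i₀; rw [hh] at this; simp at this
  obtain ⟨hΩ, -⟩ := ext (e i₀) (μ i₀) e0 (h.eig i₀) rfl
  have hpos : ∀ x : X → ℝ, x ≠ 0 → V *ᵥ (fun j => |x j|) = r • (fun j => |x j|) → 0 < r ∧ ∀ i, 0 < |x i| := by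
    intro x hx hh
    have h1 : ∀ i, 0 < r * |x i| := fun i => by
      have := congrFun hh i
      simp only [Pi.smul_apply, smul_eq_mul] at this
      rw [← this, mulVec, dotProduct]
      obtain ⟨j, hj⟩ := Function.ne_iff.1 hx
      exact Finset.sum_pos' (fun j _ => mul_nonneg (h0 i j).le (abs_nonneg _))
        ⟨j, Finset.mem_univ _, mul_pos (h0 i j) (abs_pos.2 hj)⟩
    have hr0 : 0 < r := by
      have i := Classical.arbitrary X
      rcases (abs_nonneg (μ i₀)).lt_or_eq with h2 | h2
      · exact h2
      · have := h1 i; rw [hr, ← h2] at this; simp at this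
    exact ⟨hr0, fun i => pos_of_mul_pos_right (h1 i) hr0.le⟩
  obtain ⟨hr0, hΩ0⟩ := hpos _ e0 hΩ
  set Ω : X → ℝ := fun j => |e i₀ j| with hΩdef
  have hΩ1 : Ω ⬝ᵥ Ω = 1 := by rw [hΩdef, hnorm, h.norm]
  refine ⟨r, Ω, hr0, hΩ0, hΩ1, hΩ, hle, ?_⟩
  -- deflation
  set V' : Matrix X X ℝ := V - r • vecMulVec Ω Ω with hV'
  have hV's : V'.IsSymm := by
    ext i j
    simp only [hV', transpose_apply, Matrix.sub_apply, Matrix.smul_apply, vecMulVec_apply, smul_eq_mul]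
    rw [hV.apply, mul_comm (Ω j)]
  have hV'x : ∀ x, V' *ᵥ x = V *ᵥ x - (r * (Ω ⬝ᵥ x)) • Ω := fun x => by
    rw [hV', sub_mulVec, smul_mulVec, vecMulVec_mulVec, mul_smul]; simp
  have hV'Ω : V' *ᵥ Ω = 0 := by rw [hV'x, hΩ, hΩ1, mul_one, sub_self]
  obtain ⟨f, ν, hf⟩ := exists_eigenbasis hV's
  have hν : ∀ i, |ν i| < r := by
    intro i
    by_cases hz : ν i = 0
    · rw [hz, abs_zero]; exact hr0
    have orth : Ω ⬝ᵥ f i = 0 := by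
      have := dot_mulVec_symm hV's Ω (f i)
      rw [hV'Ω, zero_dotProduct, hf.eig, dotProduct_smul, smul_eq_mul] at this
      exact (mul_eq_zero.1 this).resolve_left hz
    have eigV : V *ᵥ f i = ν i • f i := by
      have := hV'x (f i)
      rw [orth, mul_zero, zero_smul, sub_zero, hf.eig] at this
      exact this.symm
    have f0 : f i ≠ 0 := fun hh => by have := hf.norm i; rw [hh] at this; simp at this
    have nle : |ν i| ≤ r := by
      have h1 := hge (f i)
      have h2 := hle fun j => |f i j|
      rw [hform, hnorm, hf.norm, mul_one] at h2
      rw [eigV, dotProduct_smul, hf.norm, smul_eq_mul, mul_one] at h1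
      exact h1.trans h2
    refine lt_of_le_of_ne nle fun heq => ?_
    obtain ⟨h1, h2⟩ := ext (f i) (ν i) f0 eigV heq
    obtain ⟨-, h3⟩ := hpos _ f0 h1
    have h4 := habs _ h2
    have i1 := Classical.arbitrary X
    have h5 : ∀ j, f i i1 * f i j = |f i i1| * |f i j| := by
      intro j
      rcases h4 i1 j with h6 | h6
      · exact h6
      · have := h6 i1 i1
        have a := h3 i1
        nlinarith [mul_self_nonneg (f i i1)]
    have h6 : 0 < f i i1 * (Ω ⬝ᵥ f i) := by
      rw [dotProduct, Finset.mul_sum]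
      refine Finset.sum_pos (fun j _ => ?_) Finset.univ_nonempty
      rw [mul_left_comm, h5]
      exact mul_pos (hΩ0 j) (mul_pos (h3 _) (h3 _))
    rw [orth, mul_zero] at h6
    exact lt_irrefl _ h6
  intro x y
  have hpow : ∀ N : ℕ, 0 < N → ∀ y, (V ^ N) *ᵥ y = (r ^ N * (Ω ⬝ᵥ y)) • Ω + (V' ^ N) *ᵥ y := by
    intro N hN
    induction N, hN using Nat.le_induction with
    | base => intro y; rw [pow_one, pow_one, pow_one, hV'x]; simp
    | succ N hN ih =>
      intro y
      have a1 : Ω ⬝ᵥ (V *ᵥ y) = r * (Ω ⬝ᵥ y) := by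
        rw [dot_mulVec_symm hV, hΩ, smul_dotProduct, smul_eq_mul]
      have a2 : (V' ^ N) *ᵥ Ω = 0 := by
        obtain ⟨k, rfl⟩ : ∃ k, N = k + 1 := ⟨N - 1, by omega⟩
        rw [pow_succ, ← mulVec_mulVec, hV'Ω, mulVec_zero]
      rw [pow_succ, pow_succ, pow_succ, ← mulVec_mulVec, ih, a1, ← mulVec_mulVec _ (V' ^ N) V', hV'x, mulVec_sub,
        mulVec_smul, a2, smul_zero, sub_zero, mul_assoc]
  have key : Tendsto (fun N : ℕ => (Ω ⬝ᵥ x) * (Ω ⬝ᵥ y) + ∑ i, (ν i / r) ^ N * ((f i ⬝ᵥ x) * (f i ⬝ᵥ y)))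
      atTop (𝓝 ((Ω ⬝ᵥ x) * (Ω ⬝ᵥ y) + ∑ i, 0 * ((f i ⬝ᵥ x) * (f i ⬝ᵥ y)))) := by
    refine tendsto_const_nhds.add (tendsto_finsetSum _ fun i _ => Tendsto.mul_const _ ?_)
    refine tendsto_pow_atTop_nhds_zero_of_abs_lt_one ?_
    rw [abs_div, abs_of_pos hr0, div_lt_one hr0]
    exact hν i
  simp only [zero_mul, Finset.sum_const_zero, add_zero] at key
  refine key.congr' ?_
  filter_upwards [eventually_gt_atTop 0] with N hN
  rw [hpow N hN, dotProduct_add, dotProduct_smul, smul_eq_mul, hf.form_pow hV's, add_div,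
    dotProduct_comm x Ω, Finset.sum_div]
  have : r ^ N ≠ 0 := by positivity
  congr 1
  · field_simp
  · exact Finset.sum_congr rfl fun i _ => by rw [div_pow]; ring

end

/-- The rectangle with columns `0,…,M` and rows `0,…,L-1`. -/
def rect (M L : ℕ) : Finset (ℤ × ℤ) := Finset.Ico (0 : ℤ) (M + 1) ×ˢ Finset.Ico (0 : ℤ) L

lemma mem_rect {M L : ℕ} {x : ℤ × ℤ} :
    x ∈ rect M L ↔ (0 ≤ x.1 ∧ x.1 < M + 1) ∧ 0 ≤ x.2 ∧ x.2 < L := by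
  simp only [rect, Finset.mem_product, Finset.mem_Ico]

lemma sum_Ico_int (a : ℤ) (n : ℕ) (f : ℤ → ℝ) :
    ∑ i ∈ Finset.Ico a (a + n), f i = ∑ k ∈ Finset.range n, f (a + k) := by
  rw [← Finset.sum_image (s := Finset.range n) (g := fun k : ℕ => a + (k : ℤ)) fun i _ j _ hij => by simpa using hij]
  refine Finset.sum_congr ?_ fun _ _ => rfl
  ext x
  simp only [Finset.mem_Ico, Finset.mem_image, Finset.mem_range]
  constructor
  · intro h; exact ⟨(x - a).toNat, by omega, by omega⟩
  · rintro ⟨k, hk, rfl⟩; omega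

lemma wt_rect (β : ℝ) (M : ℕ) {L : ℕ} (hL : 0 < L) (η : Cfg2) : wt β 0 (rect M L) η =
    Real.exp (β * ((∑ i ∈ Finset.range (M + 2), ∑ j ∈ Finset.range L,
        sval (η ((i : ℤ) - 1, (j : ℤ))) * sval (η ((i : ℤ), (j : ℤ)))) +
      ∑ i ∈ Finset.range (M + 1), ∑ j ∈ Finset.range (L + 1),
        sval (η ((i : ℤ), (j : ℤ) - 1)) * sval (η ((i : ℤ), (j : ℤ))))) := by
  rw [wt_eq β 0 (rect M L) (Finset.Ico (-1 : ℤ) (M + 1) ×ˢ Finset.Ico (-1 : ℤ) L), zero_mul, sub_zero]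
  · congr 2
    simp only [bondE, Finset.sum_add_distrib]
    congr 1
    · rw [← Finset.sum_subset (s₁ := Finset.Ico (-1 : ℤ) (-1 + (M + 2 : ℕ)) ×ˢ Finset.Ico (0 : ℤ) (0 + L))]
      · rw [Finset.sum_product, sum_Ico_int]
        refine Finset.sum_congr rfl fun i hi => ?_
        rw [sum_Ico_int]
        refine Finset.sum_congr rfl fun j hj => ?_
        rw [Finset.mem_range] at hi hj
        rw [touch, if_pos, one_mul]
        · simp only [Prod.mk_add_mk]
          ring_nf
        · simp only [mem_rect, Prod.mk_add_mk]
          rcases Nat.eq_zero_or_pos i with h0 | h0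
          · right; omega
          · left; omega
      · intro x; simp only [Finset.mem_product, Finset.mem_Ico]; push_cast; omega
      · intro x h1 h2
        rw [touch, if_neg, zero_mul]
        simp only [Finset.mem_product, Finset.mem_Ico, mem_rect, Prod.fst_add, Prod.snd_add] at h1 h2 ⊢
        push_cast at h2; omega
    · rw [← Finset.sum_subset (s₁ := Finset.Ico (0 : ℤ) (0 + (M + 1 : ℕ)) ×ˢ Finset.Ico (-1 : ℤ) (-1 + (L + 1 : ℕ)))]
      · rw [Finset.sum_product, sum_Ico_int]
        refine Finset.sum_congr rfl fun i hi => ?_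
        rw [sum_Ico_int]
        refine Finset.sum_congr rfl fun j hj => ?_
        rw [Finset.mem_range] at hi hj
        rw [touch, if_pos, one_mul]
        · simp only [Prod.mk_add_mk]
          ring_nf
        · simp only [mem_rect, Prod.mk_add_mk]
          rcases Nat.eq_zero_or_pos j with h0 | h0
          · right; omega
          · left; omega
      · intro x; simp only [Finset.mem_product, Finset.mem_Ico]; push_cast; omega
      · intro x h1 h2
        rw [touch, if_neg, zero_mul]
        simp only [Finset.mem_product, Finset.mem_Ico, mem_rect, Prod.fst_add, Prod.snd_add] at h1 h2 ⊢
        push_cast at h2; omega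
  · intro x
    simp only [bondSites, Finset.mem_union, Finset.mem_image, mem_rect, Finset.mem_product, Finset.mem_Ico]
    rintro ((h | ⟨y, hy, rfl⟩) | ⟨y, hy, rfl⟩)
    · omega
    · simp only [Prod.fst_sub, Prod.snd_sub]; omega
    · simp only [Prod.fst_sub, Prod.snd_sub]; omega

/-- Boundary condition with value `g` on row `-1`, plus elsewhere. -/
def bcRow (g : Bool) : Cfg2 := fun x => if x.2 = -1 then g else true

/-- Spins of a column, indexed by naturals, with a plus spin above the column. -/
def sx {n : ℕ} (x : Fin n → Bool) (j : ℕ) : ℝ := if h : j < n then sval (x ⟨j, h⟩) else 1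

/-- Energy inside a column. -/
def colE {L : ℕ} (x : Fin (L + 1) → Bool) : ℝ := ∑ j ∈ Finset.range (L + 1), sx x j * sx x (j + 1)

/-- Energy between neighbouring columns. -/
def hE {L : ℕ} (y y' : Fin L → Bool) : ℝ := ∑ j ∈ Finset.range L, sx y j * sx y' j

/-- Energy between a column and a plus column. -/
def bE {L : ℕ} (y : Fin L → Bool) : ℝ := ∑ j ∈ Finset.range L, sx y j

/-- The configuration with given columns. -/
def colCfg {M L : ℕ} (g : Bool) (ξ : Fin (M + 1) → Fin L → Bool) : Cfg2 := fun x =>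
  if h : x ∈ rect M L then
    ξ ⟨x.1.toNat, by have := mem_rect.1 h; omega⟩ ⟨x.2.toNat, by have := mem_rect.1 h; omega⟩
  else bcRow g x

lemma colCfg_sx {M L : ℕ} (g : Bool) (ξ : Fin (M + 1) → Fin L → Bool) (i : Fin (M + 1)) {j : ℕ} (hj : j < L) :
    sval (colCfg g ξ (i, (j : ℤ))) = sx (ξ i) j := by
  have := i.2
  rw [colCfg, dif_pos (by rw [mem_rect]; simp; omega), sx, dif_pos hj]
  simp

lemma colCfg_cons {M L : ℕ} (g : Bool) (ξ : Fin (M + 1) → Fin L → Bool) (i : Fin (M + 1)) {j : ℕ} (hj : j ≤ L + 1) :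
    sval (colCfg g ξ (i, (j : ℤ) - 1)) = sx (Fin.cons g (ξ i) : Fin (L + 1) → Bool) j := by
  have hi := i.2
  rcases j with _ | j
  · rw [colCfg, dif_neg (by rw [mem_rect]; simp), sx, dif_pos (Nat.succ_pos _)]
    simp [bcRow]
  · have e : ((j + 1 : ℕ) : ℤ) - 1 = j := by push_cast; ring
    rw [e]
    rcases (Nat.le_of_succ_le_succ hj).lt_or_eq with h | h
    · rw [colCfg_sx _ _ _ h, sx, dif_pos h, sx, dif_pos (by omega)]
      rfl
    · rw [colCfg, dif_neg (by rw [mem_rect]; simp; omega), sx, dif_neg (by omega), bcRow, if_neg (by simp only; omega),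
        sval_true]

lemma colCfg_out {M L : ℕ} (g : Bool) (ξ : Fin (M + 1) → Fin L → Bool) {i : ℤ} (hi : i < 0 ∨ (M : ℤ) < i) (j : ℕ) :
    sval (colCfg g ξ (i, (j : ℤ))) = 1 := by
  rw [colCfg, dif_neg (by rw [mem_rect]; simp only; omega), bcRow, if_neg (by simp only; omega), sval_true]

lemma wt_colCfg (β : ℝ) {M L : ℕ} (hL : 0 < L) (g : Bool) (ξ : Fin (M + 1) → Fin L → Bool) :
    wt β 0 (rect M L) (colCfg g ξ) = Real.exp (β * (bE (ξ 0) + (∑ i : Fin M, hE (ξ i.castSucc) (ξ i.succ)) +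
      bE (ξ (Fin.last M)) + ∑ i, colE (Fin.cons g (ξ i)))) := by
  rw [wt_rect β M hL]
  congr 2
  congr 1
  · rw [Finset.sum_range_succ', Finset.sum_range_succ, ← Fin.sum_univ_eq_sum_range (fun i => ∑ j ∈ Finset.range L,
      sval (colCfg g ξ (((i + 1 : ℕ) : ℤ) - 1, (j : ℤ))) * sval (colCfg g ξ (((i + 1 : ℕ) : ℤ), (j : ℤ)))), add_comm,
      add_assoc]
    congr 1
    · refine Finset.sum_congr rfl fun j hj => ?_
      rw [colCfg_out _ _ (by simp), one_mul]
      exact colCfg_sx g ξ 0 (Finset.mem_range.1 hj)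
    congr 1
    · refine Finset.sum_congr rfl fun i _ => Finset.sum_congr rfl fun j hj => ?_
      rw [← colCfg_sx g ξ _ (Finset.mem_range.1 hj), ← colCfg_sx g ξ _ (Finset.mem_range.1 hj)]
      congr 4
      · simp
    · refine Finset.sum_congr rfl fun j hj => ?_
      rw [colCfg_out g ξ (i := ((M + 1 : ℕ) : ℤ)) (by right; push_cast; omega), mul_one,
        ← colCfg_sx g ξ _ (Finset.mem_range.1 hj)]
      congr 3
      simp
  · rw [← Fin.sum_univ_eq_sum_range (fun i => ∑ j ∈ Finset.range (L + 1),
      sval (colCfg g ξ ((i : ℤ), (j : ℤ) - 1)) * sval (colCfg g ξ ((i : ℤ), (j : ℤ))))]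
    refine Finset.sum_congr rfl fun i _ => Finset.sum_congr rfl fun j hj => ?_
    rw [Finset.mem_range] at hj
    rw [colCfg_cons g ξ i (by omega)]
    have := colCfg_cons g ξ i (j := j + 1) (by omega)
    push_cast at this
    rw [add_sub_cancel_right] at this
    rw [this]

/-- Configurations in a rectangle are described by their columns. -/
def colEquiv (M L : ℕ) : (Fin (M + 1) → Fin L → Bool) ≃ (↥(rect M L) → Bool) where
  toFun ξ x := ξ ⟨x.1.1.toNat, by have := mem_rect.1 x.2; omega⟩ ⟨x.1.2.toNat, by have := mem_rect.1 x.2; omega⟩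
  invFun τ i j := τ ⟨(i, j), by rw [mem_rect]; have := i.2; have := j.2; simp; omega⟩
  left_inv ξ := by ext i j; simp
  right_inv τ := by
    ext ⟨⟨a, b⟩, hx⟩
    have := mem_rect.1 hx
    dsimp only at this ⊢
    congr 2
    ext <;> simp <;> omega

lemma fill_colEquiv {M L : ℕ} (g : Bool) (ξ : Fin (M + 1) → Fin L → Bool) :
    fill (rect M L) (bcRow g) (colEquiv M L ξ) = colCfg g ξ := by
  ext x
  by_cases hx : x ∈ rect M L
  · rw [fill_of_mem hx, colCfg, dif_pos hx]; rfl
  · rw [fill_of_notMem hx, colCfg, dif_neg hx]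

lemma sum_fill_rect {M L : ℕ} (g : Bool) (F : Cfg2 → ℝ) :
    ∑ τ, F (fill (rect M L) (bcRow g) τ) = ∑ ξ : Fin (M + 1) → Fin L → Bool, F (colCfg g ξ) := by
  rw [← (colEquiv M L).sum_comp]
  simp only [fill_colEquiv]

open Matrix in
section
variable {Y : Type*} [Fintype Y] [DecidableEq Y]

/-- Products of a transfer matrix with insertions. -/
def pathM (a : ℕ → Y → ℝ) (V : Matrix Y Y ℝ) : ℕ → Matrix Y Y ℝ
  | 0 => diagonal (a 0)
  | M + 1 => pathM a V M * V * diagonal (a (M + 1))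

lemma sum_path (a : ℕ → Y → ℝ) (V : Matrix Y Y ℝ) (M : ℕ) (x u : Y → ℝ) :
    ∑ ξ : Fin (M + 1) → Y, x (ξ 0) * (∏ i : Fin M, V (ξ i.castSucc) (ξ i.succ)) *
      (∏ i : Fin (M + 1), a i (ξ i)) * u (ξ (Fin.last M)) = x ⬝ᵥ (pathM a V M *ᵥ u) := by
  induction M generalizing u with
  | zero =>
    rw [← (Equiv.funUnique (Fin 1) Y).symm.sum_comp]
    simp only [dotProduct, pathM, mulVec_diagonal]
    refine Finset.sum_congr rfl fun y _ => ?_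
    simp [mul_assoc]
  | succ M ih =>
    rw [← (Fin.snocEquiv fun _ : Fin (M + 2) => Y).sum_comp, Fintype.sum_prod_type, Finset.sum_comm]
    have := ih (V *ᵥ (diagonal (a (M + 1)) *ᵥ u))
    rw [mulVec_mulVec, mulVec_mulVec, ← Matrix.mul_assoc] at this
    rw [pathM, ← this]
    refine Finset.sum_congr rfl fun ξ _ => ?_
    rw [← mulVec_mulVec, mulVec, dotProduct, Finset.mul_sum]
    refine Finset.sum_congr rfl fun y _ => ?_
    rw [Fin.prod_univ_castSucc, Fin.prod_univ_castSucc (fun i : Fin (M + 1 + 1) => a i _), mulVec_diagonal]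
    simp only [Fin.snocEquiv, Equiv.coe_fn_mk, Fin.snoc_castSucc, Fin.snoc_last, Fin.succ_last, Fin.succ_castSucc,
      Fin.val_castSucc, Fin.val_last]
    rw [show (0 : Fin (M + 2)) = Fin.castSucc 0 from rfl, Fin.snoc_castSucc]
    ring

lemma pathM_window (b : Y → ℝ) (V : Matrix Y Y ℝ) (N k j : ℕ) :
    pathM (fun i => if N ≤ i ∧ i ≤ N + k then b else 1) V (N + k + j) =
      V ^ N * (diagonal b * (V * diagonal b) ^ k) * V ^ j := by
  set a : ℕ → Y → ℝ := fun i => if N ≤ i ∧ i ≤ N + k then b else 1 with ha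
  have h1 : ∀ i < N, pathM a V i = V ^ i := by
    intro i hi
    induction i with
    | zero => rw [pathM, ha]; simp only; rw [if_neg (by omega), pow_zero]; exact diagonal_one
    | succ i ih =>
      rw [pathM, ih (by omega), ha]; simp only; rw [if_neg (by omega), pow_succ]
      exact (congrArg _ diagonal_one).trans (mul_one _)
  have h2 : pathM a V N = V ^ N * diagonal b := by
    have haN : a N = b := by rw [ha]; simp only; rw [if_pos (by omega)]
    rcases N with _ | N
    · rw [pathM, haN, pow_zero, one_mul]
    · rw [pathM, h1 N (by omega), haN, pow_succ]
  have h3 : ∀ i ≤ k, pathM a V (N + i) = V ^ N * (diagonal b * (V * diagonal b) ^ i) := by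
    intro i hi
    induction i with
    | zero => rw [add_zero, h2, pow_zero, mul_one]
    | succ i ih =>
      rw [← add_assoc, pathM, ih (by omega), ha]; simp only; rw [if_pos (by omega), pow_succ]
      simp only [Matrix.mul_assoc]
  induction j with
  | zero => rw [add_zero, h3 k le_rfl, pow_zero, mul_one]
  | succ j ih =>
    rw [← add_assoc, pathM, ih, ha]; simp only; rw [if_neg (by omega), pow_succ]
    refine ((congrArg _ diagonal_one).trans (mul_one _)).trans ?_
    simp only [Matrix.mul_assoc]

lemma IsPerron.lim_vec {V : Matrix Y Y ℝ} {r : ℝ} {Ω : Y → ℝ} (h : IsPerron V r Ω) (y : Y → ℝ) (i : Y) :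
    Tendsto (fun N : ℕ => ((V ^ N) *ᵥ y) i / r ^ N) atTop (𝓝 ((Ω ⬝ᵥ y) * Ω i)) := by
  have := h.lim (Pi.single i 1) y
  simp only [single_dotProduct, one_mul, dotProduct_single, mul_one] at this
  rwa [mul_comm]

lemma IsPerron.lim_mid {V : Matrix Y Y ℝ} (hV : V.IsSymm) {r : ℝ} {Ω : Y → ℝ} (h : IsPerron V r Ω)
    (B : Matrix Y Y ℝ) (x y : Y → ℝ) :
    Tendsto (fun N : ℕ => x ⬝ᵥ ((V ^ N * B * V ^ N) *ᵥ y) / (r ^ N * r ^ N)) atTop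
      (𝓝 ((Ω ⬝ᵥ x) * (Ω ⬝ᵥ y) * (Ω ⬝ᵥ (B *ᵥ Ω)))) := by
  have e : ∀ N : ℕ, x ⬝ᵥ ((V ^ N * B * V ^ N) *ᵥ y) / (r ^ N * r ^ N) =
      ∑ i, ∑ j, B i j * (((V ^ N) *ᵥ x) i / r ^ N * (((V ^ N) *ᵥ y) j / r ^ N)) := by
    intro N
    rw [← mulVec_mulVec, ← mulVec_mulVec, dot_mulVec_symm (hV.pow N), dotProduct, Finset.sum_div]
    refine Finset.sum_congr rfl fun i _ => ?_
    rw [show (B *ᵥ ((V ^ N) *ᵥ y)) i = ∑ j, B i j * ((V ^ N) *ᵥ y) j from rfl, Finset.mul_sum, Finset.sum_div]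
    refine Finset.sum_congr rfl fun j _ => ?_
    rw [div_mul_div_comm]; ring
  simp only [e]
  have e2 : (Ω ⬝ᵥ x) * (Ω ⬝ᵥ y) * (Ω ⬝ᵥ (B *ᵥ Ω)) =
      ∑ i, ∑ j, B i j * ((Ω ⬝ᵥ x) * Ω i * ((Ω ⬝ᵥ y) * Ω j)) := by
    rw [show Ω ⬝ᵥ (B *ᵥ Ω) = ∑ i, Ω i * ∑ j, B i j * Ω j from rfl, Finset.mul_sum]
    refine Finset.sum_congr rfl fun i _ => ?_
    rw [Finset.mul_sum, Finset.mul_sum]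
    refine Finset.sum_congr rfl fun j _ => ?_
    ring
  rw [e2]
  exact tendsto_finsetSum _ fun i _ => tendsto_finsetSum _ fun j _ =>
    ((h.lim_vec x i).mul (h.lim_vec y j)).const_mul _

lemma IsPerron.rate_le {V V' : Matrix Y Y ℝ} {r r' : ℝ} {Ω Ω' : Y → ℝ} (h : IsPerron V r Ω) (h' : IsPerron V' r' Ω')
    {y y' : Y → ℝ} (hy : ∀ i, 0 < y i) [Nonempty Y]
    (hle : ∀ M : ℕ, y ⬝ᵥ ((V ^ M) *ᵥ y) ≤ y' ⬝ᵥ ((V' ^ M) *ᵥ y')) : r ≤ r' := by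
  by_contra! hr
  have h1 := h.lim y y
  have h2 := (h'.lim y' y').mul (tendsto_pow_atTop_nhds_zero_of_lt_one (r := r' / r)
    (div_nonneg h'.pos.le h.pos.le) ((div_lt_one h.pos).2 hr))
  have h3 := le_of_tendsto_of_tendsto' h1 h2 fun M => by
    have a := pow_pos h.pos M
    have b := pow_pos h'.pos M
    rw [div_pow, div_mul_div_comm, mul_comm (r' ^ M), mul_div_mul_right _ _ b.ne']
    gcongr
    exact hle M
  have h4 : 0 < Ω ⬝ᵥ y := Finset.sum_pos (fun i _ => mul_pos (h.vec_pos i) (hy i)) Finset.univ_nonempty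
  rw [mul_zero] at h3
  nlinarith
end

section
open Matrix
variable (β : ℝ) (L : ℕ)

/-- Symmetric column transfer matrix, with boundary spin `g` below and a plus spin above. -/
def tm (g : Bool) : Matrix (Fin L → Bool) (Fin L → Bool) ℝ := fun y y' =>
  Real.exp (β / 2 * colE (Fin.cons g y) + β * hE y y' + β / 2 * colE (Fin.cons g y'))

/-- Boundary vector of the transfer matrix. -/
def tv (g : Bool) (y : Fin L → Bool) : ℝ := Real.exp (β / 2 * colE (Fin.cons g y) + β * bE y)

lemma tm_symm (g : Bool) : (tm β L g : Matrix (Fin L → Bool) (Fin L → Bool) ℝ).IsSymm := by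
  ext y y'
  rw [transpose_apply, tm, tm]
  congr 1
  have : hE y' y = hE y y' := Finset.sum_congr rfl fun _ _ => mul_comm _ _
  rw [this]; ring

lemma tm_pos (g : Bool) (y y' : Fin L → Bool) : 0 < tm β L g y y' := Real.exp_pos _

variable {L}

lemma wt_colCfg_eq (hL : 0 < L) {M : ℕ} (g : Bool) (ξ : Fin (M + 1) → Fin L → Bool) :
    wt β 0 (rect M L) (colCfg g ξ) =
      tv β L g (ξ 0) * (∏ i : Fin M, tm β L g (ξ i.castSucc) (ξ i.succ)) * tv β L g (ξ (Fin.last M)) := by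
  simp only [wt_colCfg β hL, tv, tm, ← Real.exp_sum, ← Real.exp_add]
  congr 1
  simp only [Finset.sum_add_distrib, ← Finset.mul_sum]
  have h1 := Fin.sum_univ_castSucc fun i => colE (Fin.cons g (ξ i) : Fin (L + 1) → Bool)
  have h2 := Fin.sum_univ_succ fun i => colE (Fin.cons g (ξ i) : Fin (L + 1) → Bool)
  linear_combination β / 2 * h1 + β / 2 * h2

lemma Zf_rect (hL : 0 < L) (M : ℕ) (g : Bool) :
    Zf β 0 (rect M L) (bcRow g) = tv β L g ⬝ᵥ ((tm β L g ^ M) *ᵥ tv β L g) := by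
  have h := pathM_window (fun _ => 1) (tm β L g) 0 0 M
  have h1 : (diagonal fun _ => 1 : Matrix (Fin L → Bool) (Fin L → Bool) ℝ) = 1 := diagonal_one
  rw [pow_zero, pow_zero, h1, mul_one, mul_one, one_mul, add_zero, zero_add] at h
  rw [← h, ← sum_path, Zf, sum_fill_rect g (fun η => wt β 0 (rect M L) η)]
  refine Finset.sum_congr rfl fun ξ _ => ?_
  rw [wt_colCfg_eq β hL, Finset.prod_eq_one (s := Finset.univ) (f := fun i : Fin (M + 1) => _) fun i _ => ?_, mul_one]
  split_ifs <;> rfl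

/-- A column of a configuration. -/
def colOf (L : ℕ) (η : Cfg2) (i : ℕ) : Fin L → Bool := fun j => η ((i : ℤ), (j : ℤ))

lemma colOf_colCfg {M : ℕ} (g : Bool) (ξ : Fin (M + 1) → Fin L → Bool) (i : Fin (M + 1)) :
    colOf L (colCfg g ξ) i = ξ i := by
  ext j
  have := i.2
  have := j.2
  rw [colOf, colCfg, dif_pos (by rw [mem_rect]; simp; omega)]
  simp

lemma Ex_rect_limit (hL : 0 < L) {r : ℝ} {Ω : (Fin L → Bool) → ℝ} (h : IsPerron (tm β L true) r Ω)
    (b : (Fin L → Bool) → ℝ) (k : ℕ) :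
    Tendsto (fun N : ℕ => Ex β 0 (rect (N + k + N) L) (fun _ => true)
      (fun η => ∏ i ∈ Finset.range (k + 1), b (colOf L η (N + i)))) atTop
      (𝓝 (Ω ⬝ᵥ ((diagonal b * (tm β L true * diagonal b) ^ k) *ᵥ Ω) / r ^ k)) := by
  have hs := tm_symm β L true
  have hbc : bcRow true = fun _ => true := by ext x; simp [bcRow]
  have e : ∀ N : ℕ, Ex β 0 (rect (N + k + N) L) (fun _ => true)
      (fun η => ∏ i ∈ Finset.range (k + 1), b (colOf L η (N + i))) =
      (tv β L true ⬝ᵥ ((tm β L true ^ N * (diagonal b * (tm β L true * diagonal b) ^ k) * tm β L true ^ N) *ᵥ tv β L true)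
        / (r ^ N * r ^ N)) / (tv β L true ⬝ᵥ ((tm β L true ^ N * tm β L true ^ k * tm β L true ^ N) *ᵥ tv β L true)
        / (r ^ N * r ^ N)) := by
    intro N
    have hr := pow_pos h.pos N
    rw [div_div_div_cancel_right₀ (mul_pos hr hr).ne', ← hbc, Ex, Zf_rect β hL, pow_add, pow_add]
    congr 1
    rw [← pathM_window, ← sum_path, sum_fill_rect true (fun η => wt β 0 (rect (N + k + N) L) η *
      ∏ i ∈ Finset.range (k + 1), b (colOf L η (N + i)))]
    refine Finset.sum_congr rfl fun ξ _ => ?_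
    rw [wt_colCfg_eq β hL]
    have : ∏ i ∈ Finset.range (k + 1), b (colOf L (colCfg true ξ) (N + i)) =
        ∏ i : Fin (N + k + N + 1), (if N ≤ (i : ℕ) ∧ (i : ℕ) ≤ N + k then b else 1) (ξ i) := by
      have e1 : ∀ i : Fin (N + k + N + 1), (if N ≤ (i : ℕ) ∧ (i : ℕ) ≤ N + k then b else 1) (ξ i) =
          (fun i : ℕ => if N ≤ i ∧ i ≤ N + k then b (colOf L (colCfg true ξ) i) else 1) i := by
        intro i
        simp only [colOf_colCfg]
        split_ifs <;> rfl
      rw [Finset.prod_congr rfl fun i _ => e1 i, Fin.prod_univ_eq_prod_range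
        (fun i : ℕ => if N ≤ i ∧ i ≤ N + k then b (colOf L (colCfg true ξ) i) else 1), ← Finset.prod_filter]
      have : (Finset.range (N + k + N + 1)).filter (fun i => N ≤ i ∧ i ≤ N + k) =
          (Finset.range (k + 1)).image (N + ·) := by
        ext i
        simp only [Finset.mem_filter, Finset.mem_range, Finset.mem_image]
        constructor
        · intro hi; exact ⟨i - N, by omega, by omega⟩
        · rintro ⟨j, hj, rfl⟩; omega
      rw [this, Finset.prod_image fun i _ j _ hij => by simpa using hij]
    rw [this]; ring
  simp only [e]
  have hc : 0 < Ω ⬝ᵥ tv β L true :=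
    Finset.sum_pos (fun i _ => mul_pos (h.vec_pos i) (Real.exp_pos _)) Finset.univ_nonempty
  have hk : Ω ⬝ᵥ ((tm β L true ^ k) *ᵥ Ω) = r ^ k := by
    have : ∀ k : ℕ, (tm β L true ^ k) *ᵥ Ω = r ^ k • Ω := by
      intro k
      induction k with
      | zero => simp
      | succ k ih => rw [pow_succ, ← mulVec_mulVec, h.eig, mulVec_smul, ih, smul_smul, pow_succ, mul_comm]
    rw [this, dotProduct_smul, h.norm, smul_eq_mul, mul_one]
  have l1 := h.lim_mid hs (diagonal b * (tm β L true * diagonal b) ^ k) (tv β L true) (tv β L true)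
  have l2 := h.lim_mid hs (tm β L true ^ k) (tv β L true) (tv β L true)
  rw [hk] at l2
  have := l1.div l2 (mul_pos (mul_pos hc hc) (pow_pos h.pos k)).ne'
  rwa [mul_div_mul_left _ _ (mul_pos hc hc).ne'] at this
end

section
open Matrix
variable {β : ℝ} {L : ℕ}

lemma sval_moment (a : Unit → ℕ) : 0 ≤ ∑ x : Bool, ∏ k, (fun _ : Unit => sval) k x ^ a k := by
  simp only [Finset.univ_unique, Finset.prod_singleton, Fintype.sum_bool, sval_true, sval_false, one_pow]
  rcases neg_one_pow_eq_or ℝ (a default) with h | h <;> rw [h] <;> norm_num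

lemma Pres.two_sinh {ι X K : Type*} [Fintype ι] [DecidableEq ι] [Fintype X] [Fintype K] {φ : K → X → ℝ}
    {g : (ι → X) → ℝ} (h : Pres φ g) : Pres φ (fun x => Real.sinh (g x)) := by
  intro Φ hΦ a
  have h1 : ∀ x, HasSum (fun n : ℕ => mono φ a x * (g x ^ (2 * n + 1) / (2 * n + 1).factorial * Φ x))
      (mono φ a x * (Real.sinh (g x) * Φ x)) := fun x =>
    ((Real.hasSum_sinh (g x)).mul_right _).mul_left _
  have h2 := hasSum_sum (s := Finset.univ) fun x _ => h1 x
  refine h2.nonneg fun n => ?_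
  have := ((h.pow (2 * n + 1)).mul (pres_const (c := 1 / ((2 * n + 1).factorial : ℝ)) (by positivity))) Φ hΦ a
  refine this.trans_eq (Finset.sum_congr rfl fun x _ => ?_)
  ring

lemma gZ_mono {ι : Type*} [Fintype ι] [DecidableEq ι] {J : ι → ι → ℝ} {b b' : ι → ℝ} (hJ : ∀ i j, 0 ≤ J i j)
    (hb : ∀ i, |b i| ≤ b' i) : ∑ s, gw J b s ≤ ∑ s, gw J b' s := by
  have t : ∀ i, Pres (φ := fun _ : Unit => sval) (fun x : ι → Bool => sval (x i)) := pres_single ()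
  have c : ∀ {c : ℝ}, 0 ≤ c → Pres (ι := ι) (fun _ : Unit => sval) (fun _ => c) := fun h => pres_const h
  have key := ((((pres_sum Finset.univ fun i _ => pres_sum Finset.univ fun j _ =>
    (c (hJ i j)).mul ((t i).mul (t j))).add (pres_sum Finset.univ fun i _ =>
      (c (by linarith [neg_abs_le (b i), hb i] : 0 ≤ (b i + b' i) / 2)).mul (t i))).exp.mul
    (pres_sum Finset.univ fun i _ =>
      (c (by linarith [le_abs_self (b i), hb i] : 0 ≤ (b' i - b i) / 2)).mul (t i)).two_sinh).mul
    (c zero_le_two)).sum_nonneg sval_moment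
  rw [← sub_nonneg, ← Finset.sum_sub_distrib]
  refine key.trans_eq (Finset.sum_congr rfl fun s _ => ?_)
  have e1 : ∑ i, (b i + b' i) / 2 * sval (s i) + ∑ i, (b' i - b i) / 2 * sval (s i) = ∑ i, b' i * sval (s i) := by
    rw [← Finset.sum_add_distrib]; exact Finset.sum_congr rfl fun i _ => by ring
  have e2 : ∑ i, (b i + b' i) / 2 * sval (s i) - ∑ i, (b' i - b i) / 2 * sval (s i) = ∑ i, b i * sval (s i) := by
    rw [← Finset.sum_sub_distrib]; exact Finset.sum_congr rfl fun i _ => by ring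
  rw [Real.sinh_eq, mul_assoc, div_mul_cancel₀ _ two_ne_zero, mul_sub, ← Real.exp_add, ← Real.exp_add, gw, gw,
    add_assoc, add_assoc, e1, ← sub_eq_add_neg, e2]

lemma Zf_le_true (hβ : 0 ≤ β) (Λ : Finset (ℤ × ℤ)) (σ : Cfg2) : Zf β 0 Λ σ ≤ Zf β 0 Λ (fun _ => true) := by
  simp only [Zf, wt_fill_eq_gw]
  refine gZ_mono (cpl_nonneg hβ) fun i => ?_
  simp only [bfield, sub_zero]
  rw [abs_mul, abs_of_nonneg hβ]
  gcongr
  refine (Finset.abs_sum_le_sum_abs _ _).trans_eq (Finset.sum_congr rfl fun y _ => ?_)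
  rw [abs_sval, sval_true]

lemma bcRow_true : bcRow true = fun _ => true := by ext x; simp [bcRow]

lemma perron_rate_le (hβ : 0 ≤ β) (hL : 0 < L) {g : Bool} {r r' : ℝ} {Ω Ω' : (Fin L → Bool) → ℝ}
    (h : IsPerron (tm β L g) r Ω) (h' : IsPerron (tm β L true) r' Ω') : r ≤ r' :=
  h.rate_le h' (y := tv β L g) (y' := tv β L true) (fun _ => Real.exp_pos _) fun M => by
    rw [← Zf_rect β hL, ← Zf_rect β hL, bcRow_true]
    exact Zf_le_true hβ _ _

lemma perron_mag_ge (hβ : 0 ≤ β) {r : ℝ} {Ω : (Fin L → Bool) → ℝ} (h : IsPerron (tm β L true) r Ω) {j : ℕ}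
    (hj : j < L) : mp β 0 ≤ ∑ y, Ω y ^ 2 * sx y j := by
  have h1 := Ex_rect_limit β (by omega) h (fun y => sx y j) 0
  refine (ge_of_tendsto' h1 fun N => ?_).trans_eq ?_
  · refine (mp_le_Ex hβ (N, j) (rect (N + 0 + N) L)).trans_eq ?_
    congr 1
    ext η
    simp [sx, hj, colOf]
  · rw [pow_zero, pow_zero, div_one, mul_one]
    simp only [dotProduct, mulVec_diagonal]
    exact Finset.sum_congr rfl fun y _ => by ring

lemma antitone_tilt {t : ℝ} (ht : 0 ≤ t) (S : Finset (ℤ × ℤ)) : Antitone (tilt t S) := fun η η' h => by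
  refine Real.exp_le_exp.2 (mul_le_mul_of_nonpos_left (Finset.sum_le_sum fun x _ => sval_mono (h x)) (by linarith))

lemma Ev_tilt_le {μ : Measure Cfg2} (hμ : IsPlusPhase β 0 μ) (hβ : 0 ≤ β) {t : ℝ} (ht : 0 ≤ t) (k : ℕ) {c : ℝ}
    (H : ∀ (l : ℕ) (r : ℝ) (Ω : (Fin (2 * l + 1) → Bool) → ℝ), IsPerron (tm β (2 * l + 1) true) r Ω →
      Ω ⬝ᵥ ((diagonal (fun y => Real.exp (-t * sx y l)) *
        (tm β (2 * l + 1) true * diagonal (fun y => Real.exp (-t * sx y l))) ^ k) *ᵥ Ω) / r ^ k ≤ c) :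
    Ev μ (tilt t (seg 0 (k + 1))) ≤ c := by
  refine le_of_tendsto' (Ex_tendsto hμ (loc_tilt t _)) fun l => ?_
  obtain ⟨r, Ω, h⟩ := exists_perron (tm_symm β (2 * l + 1) true) (tm_pos β _ true)
  refine le_trans ?_ (H l r Ω h)
  refine ge_of_tendsto (Ex_rect_limit β (by omega) h (fun y => Real.exp (-t * sx y l)) k) ?_
  filter_upwards [eventually_ge_atTop l] with N hN
  have h1 : box l ⊆ (rect (N + k + N) (2 * l + 1)).image (· + (-(N : ℤ), -(l : ℤ))) := by
    rintro ⟨a, b⟩ hx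
    rw [box, Finset.mem_product, Finset.mem_Icc, Finset.mem_Icc] at hx
    rw [Finset.mem_image]
    refine ⟨(a + N, b + l), ?_, by simp⟩
    rw [mem_rect]; push_cast; dsimp only at hx ⊢; omega
  have h2 := Ex_domain_anti (h := 0) hβ h1 (antitone_tilt ht (seg 0 (k + 1))).neg
  have e : ∀ Λ, Ex β 0 Λ (fun _ => true) (fun η => - tilt t (seg 0 (k + 1)) η) =
      - Ex β 0 Λ (fun _ => true) (tilt t (seg 0 (k + 1))) := fun Λ => Ex_neg
  have h3 : Ex β 0 (box l) (fun _ => true) (tilt t (seg 0 (k + 1))) ≤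
      Ex β 0 ((rect (N + k + N) (2 * l + 1)).image (· + (-(N : ℤ), -(l : ℤ)))) (fun _ => true)
        (tilt t (seg 0 (k + 1))) := by
    rw [← neg_le_neg_iff, ← e, ← e]; exact h2
  refine h3.trans_eq ?_
  rw [Ex_shift]
  congr 1
  ext η
  rw [tilt, sum_seg, Finset.mul_sum, Real.exp_sum]
  refine Finset.prod_congr rfl fun i _ => ?_
  rw [sx, dif_pos (by omega)]
  simp [colOf, shiftC, add_comm]
end

section
open Matrix
variable {L : ℕ}

/-- Flip the spins with index at most `k`. -/
def fl (k : Fin (L + 1)) (x : Fin (L + 1) → Bool) : Fin (L + 1) → Bool := fun j => if j ≤ k then !(x j) else x j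

lemma fl_fl (k : Fin (L + 1)) (x : Fin (L + 1) → Bool) : fl k (fl k x) = x := by
  ext j; simp only [fl]; split_ifs <;> simp

lemma fl_comm (k l : Fin (L + 1)) (x : Fin (L + 1) → Bool) : fl k (fl l x) = fl l (fl k x) := by
  ext j; simp only [fl]; split_ifs <;> rfl

lemma fl_zero (k : Fin (L + 1)) (x : Fin (L + 1) → Bool) : fl k x 0 = !(x 0) := by simp [fl]

lemma sx_fl (k : Fin (L + 1)) (x : Fin (L + 1) → Bool) (j : ℕ) :
    sx (fl k x) j = (if j ≤ k then -1 else 1) * sx x j := by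
  have := k.2
  unfold sx
  by_cases hj : j < L + 1
  · rw [dif_pos hj, dif_pos hj, fl]
    by_cases h : j ≤ k
    · rw [if_pos (Fin.le_def.2 h), if_pos h, sval_not]; ring
    · rw [if_neg (fun h' => h (Fin.le_def.1 h')), if_neg h, one_mul]
  · rw [dif_neg hj, dif_neg hj, if_neg (by omega), one_mul]

lemma sx_fl_le {k : Fin (L + 1)} {j : ℕ} (h : j ≤ k) (x : Fin (L + 1) → Bool) : sx (fl k x) j = - sx x j := by
  rw [sx_fl, if_pos h]; ring

lemma sx_fl_gt {k : Fin (L + 1)} {j : ℕ} (h : k < j) (x : Fin (L + 1) → Bool) : sx (fl k x) j = sx x j := by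
  rw [sx_fl, if_neg (by omega)]; ring

lemma sx_sq {n : ℕ} (x : Fin n → Bool) (j : ℕ) : sx x j * sx x j = 1 := by
  unfold sx; split_ifs
  · cases x _ <;> simp [sval]
  · simp

lemma sx_cases {n : ℕ} (x : Fin n → Bool) (j : ℕ) : sx x j = 1 ∨ sx x j = -1 := by
  unfold sx; split_ifs
  · cases x _ <;> simp [sval]
  · simp

/-- The involution `fl k` as an equivalence. -/
def flEquiv (k : Fin (L + 1)) : Equiv.Perm (Fin (L + 1) → Bool) := ⟨fl k, fl k, fl_fl k, fl_fl k⟩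

lemma sum_fl (k : Fin (L + 1)) (f : (Fin (L + 1) → Bool) → ℝ) : ∑ x, f (fl k x) = ∑ x, f x :=
  Equiv.sum_comp (flEquiv k) f

/-- Coefficients of Majorana operators. -/
def acf (w : Bool × Fin (L + 1) → ℝ) (k : Fin (L + 1)) (x : Fin (L + 1) → Bool) : ℝ :=
  w (true, k) * sx x (k + 1) - w (false, k) * sx x k

/-- The Majorana operator with coefficients `w`. -/
def psi (w : Bool × Fin (L + 1) → ℝ) (f : (Fin (L + 1) → Bool) → ℝ) (x : Fin (L + 1) → Bool) : ℝ :=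
  ∑ k, acf w k x * f (fl k x)

/-- The adjoint mode. -/
def tau (w : Bool × Fin (L + 1) → ℝ) : Bool × Fin (L + 1) → ℝ := fun i => if i.1 then w i else - w i

variable (u v w : Bool × Fin (L + 1) → ℝ) (f g : (Fin (L + 1) → Bool) → ℝ) (x : Fin (L + 1) → Bool) (c : ℝ)

lemma tau_tau : tau (tau w) = w := by ext ⟨b, k⟩; cases b <;> simp [tau]

lemma dot_modes : v ⬝ᵥ w = ∑ k, (v (true, k) * w (true, k) + v (false, k) * w (false, k)) := by
  rw [dotProduct, Fintype.sum_prod_type, Fintype.sum_bool, ← Finset.sum_add_distrib]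

lemma tau_dot : tau v ⬝ᵥ w = v ⬝ᵥ tau w := by
  rw [dot_modes, dot_modes]; exact Finset.sum_congr rfl fun k _ => by simp [tau]

lemma tau_dot_tau : tau v ⬝ᵥ tau w = v ⬝ᵥ w := by rw [tau_dot, tau_tau]

lemma tau_add : tau (v + w) = tau v + tau w := by ext ⟨b, k⟩; cases b <;> simp [tau]; ring
lemma tau_smul : tau (c • w) = c • tau w := by ext ⟨b, k⟩; cases b <;> simp [tau]

lemma psi_add : psi (v + w) f = psi v f + psi w f := by
  ext x; simp only [psi, Pi.add_apply, ← Finset.sum_add_distrib, acf]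
  exact Finset.sum_congr rfl fun k _ => by ring
lemma psi_smul : psi (c • w) f = c • psi w f := by
  ext x; simp only [psi, Pi.smul_apply, Finset.mul_sum, acf, smul_eq_mul]
  exact Finset.sum_congr rfl fun k _ => by ring
lemma psi_add' : psi w (f + g) = psi w f + psi w g := by
  ext x; simp only [psi, Pi.add_apply, mul_add, Finset.sum_add_distrib]
lemma psi_smul' : psi w (c • f) = c • psi w f := by
  ext x; simp only [psi, Pi.smul_apply, Finset.mul_sum, smul_eq_mul]
  exact Finset.sum_congr rfl fun k _ => by ring
lemma psi_zero : psi w 0 = 0 := by ext x; simp [psi]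
lemma psi_sum {ι : Type*} (s : Finset ι) (w : ι → Bool × Fin (L + 1) → ℝ) :
    psi (∑ i ∈ s, w i) f = ∑ i ∈ s, psi (w i) f := by
  classical
  induction s using Finset.induction_on with
  | empty => ext x; simp [psi, acf]
  | insert i s hi ih => rw [Finset.sum_insert hi, Finset.sum_insert hi, psi_add, ih]

lemma acf_fl (k : Fin (L + 1)) : acf w k (fl k x) = acf (tau w) k x := by
  rw [acf, acf, sx_fl_gt (by omega), sx_fl_le le_rfl]; simp [tau]

lemma acf_fl_lt {k l : Fin (L + 1)} (h : l < k) : acf w k (fl l x) = acf w k x := by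
  rw [Fin.lt_def] at h
  rw [acf, acf, sx_fl_gt (by omega), sx_fl_gt (by omega)]

lemma acf_fl_gt {k l : Fin (L + 1)} (h : k < l) : acf w k (fl l x) = - acf w k x := by
  rw [Fin.lt_def] at h
  rw [acf, acf, sx_fl_le (by omega), sx_fl_le (by omega)]; ring

lemma dot_psi : f ⬝ᵥ psi w g = psi (tau w) f ⬝ᵥ g := by
  simp only [dotProduct, psi, Finset.mul_sum, Finset.sum_mul]
  rw [Finset.sum_comm, Finset.sum_comm (s := Finset.univ (α := Fin (L + 1) → Bool))]
  refine Finset.sum_congr rfl fun k _ => ?_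
  rw [← sum_fl k]
  refine Finset.sum_congr rfl fun x _ => ?_
  rw [acf_fl, fl_fl]; ring

lemma psi_anticomm : psi v (psi w f) + psi w (psi v f) = (2 * (v ⬝ᵥ tau w)) • f := by
  ext x
  simp only [Pi.add_apply, Pi.smul_apply, psi, Finset.mul_sum, smul_eq_mul]
  rw [Finset.sum_comm (f := fun k l => acf w k x * _), ← Finset.sum_add_distrib, dot_modes, Finset.mul_sum,
    Finset.sum_mul]
  refine Finset.sum_congr rfl fun k _ => ?_
  rw [← Finset.sum_add_distrib, Finset.sum_eq_single k]
  · rw [fl_fl, acf_fl, acf_fl]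
    simp only [acf, tau]
    have h1 := sx_sq x k
    have h2 := sx_sq x (k + 1)
    simp only [if_true, Bool.false_eq_true, if_false]
    linear_combination (2 * v (true, k) * w (true, k) * f x) * h2 - (2 * v (false, k) * w (false, k) * f x) * h1
  · intro l _ hl
    rw [fl_comm]
    rcases lt_or_gt_of_ne hl with h | h
    · rw [acf_fl_gt w x h, acf_fl_lt v x h]; ring
    · rw [acf_fl_lt w x h, acf_fl_gt v x h]; ring
  · intro h; exact absurd (Finset.mem_univ _) h

lemma psi_norm_add : psi w f ⬝ᵥ psi w f + psi (tau w) f ⬝ᵥ psi (tau w) f = 2 * (w ⬝ᵥ w) * (f ⬝ᵥ f) := by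
  have h3 := congrArg (f ⬝ᵥ ·) (psi_anticomm (tau w) w f)
  simp only [dotProduct_add, dotProduct_smul, smul_eq_mul, tau_dot_tau] at h3
  have h4 := dot_psi (tau w) f (psi w f)
  have h5 := dot_psi w f (psi (tau w) f)
  rw [tau_tau] at h4
  linarith

/-- Boundary to bulk part of the evolution of modes. -/
def R1 (K : ℝ) (w : Bool × Fin (L + 1) → ℝ) : Bool × Fin (L + 1) → ℝ := fun i =>
  Real.cosh K * w i - Real.sinh K * w (!i.1, i.2)

/-- Hopping part of the evolution of modes. -/
def R2 (K : ℝ) (w : Bool × Fin (L + 1) → ℝ) : Bool × Fin (L + 1) → ℝ := fun i =>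
  if i.1 then Fin.lastCases (motive := fun _ => ℝ) (w (true, Fin.last L))
    (fun k => (Real.cosh (2 * K) * w (true, k.castSucc) + w (false, k.succ)) / Real.sinh (2 * K)) i.2
  else Fin.cases (motive := fun _ => ℝ) (w (false, 0))
    (fun k => (Real.cosh (2 * K) * w (false, k.succ) + w (true, k.castSucc)) / Real.sinh (2 * K)) i.2

/-- Energy between two columns. -/
def tE (x x' : Fin (L + 1) → Bool) : ℝ := ∑ j ∈ Finset.range L, sx x (j + 1) * sx x' (j + 1)

/-- Horizontal transfer matrix, preserving the bottom spin. -/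
def tT (K : ℝ) (x x' : Fin (L + 1) → Bool) : ℝ := if x 0 = x' 0 then Real.exp (K * tE x x') else 0

/-- Full transfer matrix on columns together with the bottom spin. -/
def tV (K : ℝ) : Matrix (Fin (L + 1) → Bool) (Fin (L + 1) → Bool) ℝ := fun x x' =>
  Real.exp (K / 2 * colE x) * tT K x x' * Real.exp (K / 2 * colE x')

lemma colE_fl (k : Fin (L + 1)) : colE (fl k x) = colE x - 2 * (sx x k * sx x (k + 1)) := by
  rw [eq_sub_iff_add_eq', ← sub_eq_zero, add_sub_assoc, colE, colE, ← Finset.sum_sub_distrib,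
    Finset.sum_eq_single (k : ℕ)]
  · rw [sx_fl_le le_rfl, sx_fl_gt (by omega)]; ring
  · intro j _ hj
    rw [sx_fl, sx_fl]
    rcases lt_or_gt_of_ne hj with h | h
    · rw [if_pos (by omega), if_pos (by omega)]; ring
    · rw [if_neg (by omega), if_neg (by omega)]; ring
  · intro h; exact absurd (Finset.mem_range.2 k.2) h

lemma acf_R1 (K : ℝ) (k : Fin (L + 1)) :
    acf (R1 K w) k x * Real.exp (-K * (sx x k * sx x (k + 1))) = acf w k x := by
  simp only [acf, R1, Bool.not_true, Bool.not_false]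
  rw [Real.cosh_eq, Real.sinh_eq]
  have h : Real.exp K * Real.exp (-K) = 1 := by rw [← Real.exp_add]; simp
  rcases sx_cases x k with h1 | h1 <;> rcases sx_cases x (k + 1) with h2 | h2 <;> rw [h1, h2] <;>
    simp only [mul_one, mul_neg, neg_neg]
  · linear_combination (w (true, k) - w (false, k)) * h
  · linear_combination (-(w (true, k) + w (false, k))) * h
  · linear_combination (w (true, k) + w (false, k)) * h
  · linear_combination (-(w (true, k) - w (false, k))) * h

lemma psi_D (K : ℝ) : psi (R1 K w) (fun x => Real.exp (K / 2 * colE x) * f x) =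
    fun x => Real.exp (K / 2 * colE x) * psi w f x := by
  ext x
  rw [psi, psi, Finset.mul_sum]
  refine Finset.sum_congr rfl fun k _ => ?_
  rw [colE_fl, ← acf_R1 w x K k, mul_sub, sub_eq_add_neg, Real.exp_add]
  ring_nf

lemma tT_fl (K : ℝ) (k : Fin (L + 1)) (x x' : Fin (L + 1) → Bool) : tT K x (fl k x') = tT K (fl k x) x' := by
  unfold tT
  have e : tE x (fl k x') = tE (fl k x) x' := Finset.sum_congr rfl fun j _ => by rw [sx_fl, sx_fl]; ring
  rw [e, fl_zero, fl_zero]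
  cases x 0 <;> cases x' 0 <;> simp

lemma tT_succ (K : ℝ) (k : Fin L) (x x' : Fin (L + 1) → Bool) :
    tT K (fl k.succ x) x' = Real.exp (-2 * K * (sx x (k + 1) * sx x' (k + 1))) * tT K (fl k.castSucc x) x' := by
  unfold tT
  rw [fl_zero, fl_zero]
  split_ifs
  · rw [← Real.exp_add]
    congr 1
    have : tE (fl k.succ x) x' = tE (fl k.castSucc x) x' - 2 * (sx x (k + 1) * sx x' (k + 1)) := by
      rw [eq_sub_iff_add_eq', ← sub_eq_zero, add_sub_assoc, tE, tE, ← Finset.sum_sub_distrib,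
        Finset.sum_eq_single (k : ℕ)]
      · rw [sx_fl_le (by simp), sx_fl_gt (by simp)]; ring
      · intro j _ hj
        rw [sx_fl, sx_fl]
        simp only [Fin.val_succ, Fin.val_castSucc]
        rcases lt_or_gt_of_ne hj with h | h
        · rw [if_pos (by omega), if_pos (by omega)]; ring
        · rw [if_neg (by omega), if_neg (by omega)]; ring
      · intro h; exact absurd (Finset.mem_range.2 k.2) h
    rw [this]; ring
  · simp

lemma sum_tT_acf {K : ℝ} (hK : K ≠ 0) (x x' : Fin (L + 1) → Bool) :
    ∑ k, tT K (fl k x) x' * acf (tau w) k x' = ∑ k, acf (R2 K w) k x * tT K (fl k x) x' := by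
  have hs : Real.sinh (2 * K) ≠ 0 := by rw [Ne, Real.sinh_eq_zero]; simpa using hK
  have hl : ∀ x : Fin (L + 1) → Bool, sx x (L + 1) = 1 := fun x => by simp [sx]
  simp only [acf, mul_sub, sub_mul, Finset.sum_sub_distrib, tau, if_true, Bool.false_eq_true, if_false]
  rw [Fin.sum_univ_castSucc, Fin.sum_univ_succ (fun k => tT K (fl k x) x' * (-w (false, k) * sx x' k)),
    Fin.sum_univ_castSucc, Fin.sum_univ_succ (fun k => R2 K w (false, k) * sx x k * tT K (fl k x) x')]
  have e0 : tT K (fl 0 x) x' * (-w (false, 0) * sx x' (0 : Fin (L + 1))) =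
      R2 K w (false, 0) * sx x (0 : Fin (L + 1)) * tT K (fl 0 x) x' := by
    simp only [R2, Bool.false_eq_true, if_false, Fin.cases_zero]
    unfold tT
    split_ifs with h
    · rw [fl_zero] at h
      have h0 : ∀ x : Fin (L + 1) → Bool, sx x (0 : Fin (L + 1)) = sval (x 0) := fun x => by simp [sx]
      rw [h0, h0, ← h, sval_not]; ring
    · simp
  have e1 : tT K (fl (Fin.last L) x) x' * (w (true, Fin.last L) * sx x' (Fin.last L + 1)) =
      R2 K w (true, Fin.last L) * sx x (Fin.last L + 1) * tT K (fl (Fin.last L) x) x' := by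
    simp only [R2, if_true, Fin.lastCases_last, Fin.val_last, hl]; ring
  have e2 : ∑ k : Fin L, tT K (fl k.castSucc x) x' * (w (true, k.castSucc) * sx x' (k.castSucc + 1)) -
      ∑ k : Fin L, tT K (fl k.succ x) x' * (-w (false, k.succ) * sx x' k.succ) =
      ∑ k : Fin L, R2 K w (true, k.castSucc) * sx x (k.castSucc + 1) * tT K (fl k.castSucc x) x' -
      ∑ k : Fin L, R2 K w (false, k.succ) * sx x k.succ * tT K (fl k.succ x) x' := by
    rw [← Finset.sum_sub_distrib, ← Finset.sum_sub_distrib]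
    refine Finset.sum_congr rfl fun k _ => ?_
    simp only [R2, if_true, Bool.false_eq_true, if_false, Fin.lastCases_castSucc, Fin.cases_succ, tT_succ,
      Fin.val_succ, Fin.val_castSucc]
    generalize tT K (fl k.castSucc x) x' = p
    have hc : Real.cosh (2 * K) = (Real.exp (2 * K) + Real.exp (-(2 * K))) / 2 := Real.cosh_eq _
    have hsi : Real.sinh (2 * K) = (Real.exp (2 * K) - Real.exp (-(2 * K))) / 2 := Real.sinh_eq _
    have h : Real.exp (2 * K) * Real.exp (-2 * K) = 1 := by rw [← Real.exp_add]; simp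
    have ha := div_mul_cancel₀ (Real.cosh (2 * K) * w (true, k.castSucc) + w (false, k.succ)) hs
    have hb := div_mul_cancel₀ (Real.cosh (2 * K) * w (false, k.succ) + w (true, k.castSucc)) hs
    refine mul_right_cancel₀ hs ?_
    generalize (Real.cosh (2 * K) * w (true, k.castSucc) + w (false, k.succ)) / Real.sinh (2 * K) = A at ha ⊢
    generalize (Real.cosh (2 * K) * w (false, k.succ) + w (true, k.castSucc)) / Real.sinh (2 * K) = B at hb ⊢
    rw [hc, hsi] at ha hb
    rw [hsi]
    rcases sx_cases x (k + 1) with h1 | h1 <;> rcases sx_cases x' (k + 1) with h2 | h2 <;> rw [h1, h2] <;>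
      simp only [mul_one, mul_neg, neg_mul, neg_neg] at h ⊢
    · linear_combination (-p) * ha + (Real.exp (-(2 * K)) * p) * hb + (p * w (false, k.succ)) * h
    · linear_combination (-p) * ha + (Real.exp (2 * K) * p) * hb + (p * w (false, k.succ)) * h
    · linear_combination p * ha - (Real.exp (2 * K) * p) * hb - (p * w (false, k.succ)) * h
    · linear_combination p * ha - (Real.exp (-(2 * K)) * p) * hb - (p * w (false, k.succ)) * h
  linear_combination e1 - e0 + e2

lemma psi_T {K : ℝ} (hK : K ≠ 0) :
    psi (R2 K w) (fun x => ∑ x', tT K x x' * f x') = fun x => ∑ x', tT K x x' * psi w f x' := by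
  ext x
  simp only [psi, Finset.mul_sum]
  rw [Finset.sum_comm, Finset.sum_comm (s := Finset.univ (α := Fin (L + 1) → Bool)) (t := Finset.univ (α := Fin (L + 1)))
    (f := fun x' k => tT K x x' * (acf w k x' * f (fl k x')))]
  simp only [← mul_assoc]
  rw [Finset.sum_congr rfl fun k _ => (sum_fl k (fun x' => tT K x x' * acf w k x' * f (fl k x'))).symm,
    Finset.sum_comm (s := Finset.univ (α := Fin (L + 1)))]
  refine Finset.sum_congr rfl fun x' _ => ?_
  simp only [fl_fl, tT_fl, acf_fl]
  rw [← Finset.sum_mul, ← Finset.sum_mul, sum_tT_acf w hK]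

lemma tV_mulVec (K : ℝ) : tV K *ᵥ f = fun x => Real.exp (K / 2 * colE x) *
    ∑ x', tT K x x' * (Real.exp (K / 2 * colE x') * f x') := by
  ext x
  rw [mulVec, dotProduct, Finset.mul_sum]
  exact Finset.sum_congr rfl fun x' _ => by rw [tV]; ring

lemma tV_psi {K : ℝ} (hK : K ≠ 0) : tV K *ᵥ psi w f = psi (R1 K (R2 K (R1 K w))) (tV K *ᵥ f) := by
  rw [tV_mulVec, tV_mulVec, psi_D, psi_T _ _ hK, psi_D]
end

section
open Matrix
variable {L : ℕ} (K : ℝ) (v w : Bool × Fin (L + 1) → ℝ)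

lemma R1_add : R1 K (v + w) = R1 K v + R1 K w := by ext i; simp only [R1, Pi.add_apply]; ring
lemma R1_smul (c : ℝ) : R1 K (c • w) = c • R1 K w := by
  ext i; simp only [R1, Pi.smul_apply, smul_eq_mul]; ring

lemma R2_false_zero : R2 K w (false, 0) = w (false, 0) := by simp [R2]
lemma R2_true_last : R2 K w (true, Fin.last L) = w (true, Fin.last L) := by simp [R2]
lemma R2_true_castSucc (k : Fin L) : R2 K w (true, k.castSucc) =
    (Real.cosh (2 * K) * w (true, k.castSucc) + w (false, k.succ)) / Real.sinh (2 * K) := by simp [R2]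
lemma R2_false_succ (k : Fin L) : R2 K w (false, k.succ) =
    (Real.cosh (2 * K) * w (false, k.succ) + w (true, k.castSucc)) / Real.sinh (2 * K) := by simp [R2]

lemma modes_ext {v w : Bool × Fin (L + 1) → ℝ} (h0 : v (false, 0) = w (false, 0))
    (h1 : v (true, Fin.last L) = w (true, Fin.last L))
    (h2 : ∀ k : Fin L, v (true, k.castSucc) = w (true, k.castSucc) ∧ v (false, k.succ) = w (false, k.succ)) :
    v = w := by
  ext ⟨b, k⟩
  cases b
  · cases k using Fin.cases with
    | zero => exact h0
    | succ k => exact (h2 k).2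
  · cases k using Fin.lastCases with
    | last => exact h1
    | cast k => exact (h2 k).1

lemma R2_add : R2 K (v + w) = R2 K v + R2 K w := by
  refine modes_ext ?_ ?_ fun k => ⟨?_, ?_⟩ <;>
    simp only [R2_false_zero, R2_true_last, R2_true_castSucc, R2_false_succ, Pi.add_apply]
  · ring
  · ring

lemma R2_smul (c : ℝ) : R2 K (c • w) = c • R2 K w := by
  refine modes_ext ?_ ?_ fun k => ⟨?_, ?_⟩ <;>
    simp only [R2_false_zero, R2_true_last, R2_true_castSucc, R2_false_succ, Pi.smul_apply, smul_eq_mul]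
  · ring
  · ring

/-- The evolution of modes under the transfer matrix. -/
def sM : Matrix (Bool × Fin (L + 1)) (Bool × Fin (L + 1)) ℝ := LinearMap.toMatrix'
  { toFun := fun w => R1 K (R2 K (R1 K w))
    map_add' := fun v w => by rw [R1_add, R2_add, R1_add]
    map_smul' := fun c w => by rw [R1_smul, R2_smul, R1_smul]; rfl }

lemma sM_mulVec : sM K *ᵥ w = R1 K (R2 K (R1 K w)) := by
  rw [sM, LinearMap.toMatrix'_mulVec]; rfl

lemma tV_psi' {K : ℝ} (hK : K ≠ 0) (f : (Fin (L + 1) → Bool) → ℝ) :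
    tV K *ᵥ psi w f = psi (sM K *ᵥ w) (tV K *ᵥ f) := by rw [sM_mulVec, tV_psi w f hK]

lemma R1_tau_R1 : R1 K (tau (R1 K w)) = tau w := by
  ext ⟨b, k⟩
  have := Real.cosh_sq K
  cases b <;> simp only [R1, tau, Bool.not_true, Bool.not_false, if_true, Bool.false_eq_true, if_false] <;>
    [linear_combination (-w (false, k)) * this; linear_combination w (true, k) * this]

lemma R2_tau_R2 {K : ℝ} (hK : K ≠ 0) : R2 K (tau (R2 K w)) = tau w := by
  have hs : Real.sinh (2 * K) ≠ 0 := by rw [Ne, Real.sinh_eq_zero]; simpa using hK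
  have := Real.cosh_sq (2 * K)
  refine modes_ext ?_ ?_ fun k => ⟨?_, ?_⟩ <;>
    simp only [R2_false_zero, R2_true_last, R2_true_castSucc, R2_false_succ, tau, if_true, Bool.false_eq_true,
      if_false]
  · field_simp
    linear_combination w (true, k.castSucc) * this
  · field_simp
    linear_combination (-w (false, k.succ)) * this

lemma sM_tau_sM {K : ℝ} (hK : K ≠ 0) : sM K *ᵥ tau (sM K *ᵥ w) = tau w := by
  rw [sM_mulVec, sM_mulVec, R1_tau_R1, R2_tau_R2 _ hK, R1_tau_R1]

lemma dot_R1 : v ⬝ᵥ R1 K w = R1 K v ⬝ᵥ w := by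
  rw [dot_modes, dot_modes]
  refine Finset.sum_congr rfl fun k _ => ?_
  simp only [R1, Bool.not_true, Bool.not_false]; ring

lemma dot_modes' : v ⬝ᵥ w = v (true, Fin.last L) * w (true, Fin.last L) + v (false, 0) * w (false, 0) +
    ∑ k : Fin L, (v (true, k.castSucc) * w (true, k.castSucc) + v (false, k.succ) * w (false, k.succ)) := by
  rw [dot_modes, Finset.sum_add_distrib, Fin.sum_univ_castSucc, Fin.sum_univ_succ (fun k => v (false, k) * w (false, k)),
    Finset.sum_add_distrib]
  ring

lemma dot_R2 : v ⬝ᵥ R2 K w = v (true, Fin.last L) * w (true, Fin.last L) + v (false, 0) * w (false, 0) +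
    ∑ k : Fin L, (Real.cosh (2 * K) * (v (true, k.castSucc) * w (true, k.castSucc) + v (false, k.succ) * w (false, k.succ))
      + (v (true, k.castSucc) * w (false, k.succ) + v (false, k.succ) * w (true, k.castSucc))) / Real.sinh (2 * K) := by
  rw [dot_modes', R2_false_zero, R2_true_last]
  congr 1
  refine Finset.sum_congr rfl fun k _ => ?_
  rw [R2_true_castSucc, R2_false_succ]; ring

lemma dot_R2_comm : v ⬝ᵥ R2 K w = R2 K v ⬝ᵥ w := by
  rw [dotProduct_comm (R2 K v), dot_R2, dot_R2]
  congr 1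
  · ring
  · exact Finset.sum_congr rfl fun k _ => by ring

lemma sM_symm : (sM K : Matrix (Bool × Fin (L + 1)) (Bool × Fin (L + 1)) ℝ).IsSymm := by
  ext i j
  have h : ∀ i j : Bool × Fin (L + 1), sM K i j = Pi.single i 1 ⬝ᵥ (sM K *ᵥ Pi.single j (1 : ℝ)) := fun i j => by simp
  rw [transpose_apply, h, h, sM_mulVec, sM_mulVec, dot_R1, dot_R2_comm, dot_R1, dotProduct_comm]

lemma dot_sM_self_nonneg {K : ℝ} (hK : 0 < K) : 0 ≤ w ⬝ᵥ (sM K *ᵥ w) := by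
  rw [sM_mulVec, dot_R1, dot_R2]
  have hs : 0 < Real.sinh (2 * K) := Real.sinh_pos_iff.2 (by linarith)
  have hc : 1 ≤ Real.cosh (2 * K) := Real.one_le_cosh _
  refine add_nonneg (add_nonneg (mul_self_nonneg _) (mul_self_nonneg _)) (Finset.sum_nonneg fun k _ => ?_)
  refine div_nonneg ?_ hs.le
  nlinarith [mul_self_nonneg (R1 K w (true, k.castSucc) + R1 K w (false, k.succ)),
    mul_self_nonneg (R1 K w (true, k.castSucc)), mul_self_nonneg (R1 K w (false, k.succ)),
    mul_nonneg (sub_nonneg.2 hc) (add_nonneg (mul_self_nonneg (R1 K w (true, k.castSucc)))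
      (mul_self_nonneg (R1 K w (false, k.succ))))]

/-- Eigenvalues of the evolution of modes are positive, and come in inverse pairs. -/
lemma sM_eig_tau {K : ℝ} (hK : 0 < K) {z : ℝ} {e : Bool × Fin (L + 1) → ℝ} (he : e ≠ 0) (h : sM K *ᵥ e = z • e) :
    0 < z ∧ sM K *ᵥ tau e = z⁻¹ • tau e := by
  have h1 := sM_tau_sM e hK.ne'
  rw [h, tau_smul, mulVec_smul] at h1
  have hz : z ≠ 0 := by
    rintro rfl
    rw [zero_smul] at h1
    apply he
    rw [← tau_tau e, ← h1]
    ext ⟨b, k⟩; cases b <;> simp [tau]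
  have h2 := dot_sM_self_nonneg e hK
  rw [h, dotProduct_smul, smul_eq_mul] at h2
  have h3 := dot_self_pos he
  refine ⟨lt_of_le_of_ne (nonneg_of_mul_nonneg_left h2 h3) hz.symm, ?_⟩
  rw [← h1, smul_smul, inv_mul_cancel₀ hz, one_smul, h1]

lemma sum_fin_shift (a : Fin (L + 1) → ℝ) (A B : ℝ) : ∑ k : Fin L, (A * a k.castSucc + B * a k.succ) =
    (A + B) * ∑ k, a k - A * a (Fin.last L) - B * a 0 := by
  rw [Finset.sum_add_distrib, ← Finset.mul_sum, ← Finset.mul_sum]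
  have h1 := Fin.sum_univ_castSucc a
  have h2 := Fin.sum_univ_succ a
  have e1 : ∑ k : Fin L, a k.castSucc = ∑ k, a k - a (Fin.last L) := by linarith
  have e2 : ∑ k : Fin L, a k.succ = ∑ k, a k - a 0 := by linarith
  rw [e1, e2]; ring

lemma sM_form_ge {K : ℝ} (hs : 1 ≤ Real.sinh (2 * K)) :
    2 * (Real.sinh (2 * K) + (Real.sinh (2 * K))⁻¹ - 1) * (w ⬝ᵥ w) ≤
      w ⬝ᵥ (sM K *ᵥ w) + tau w ⬝ᵥ (sM K *ᵥ tau w) := by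
  set s := Real.sinh (2 * K) with hsd
  set c := Real.cosh (2 * K) with hcd
  set a := Real.cosh K ^ 2 with ha
  set b := Real.sinh K ^ 2 with hb
  have hs0 : 0 < s := by linarith
  have hcs : c ^ 2 = s ^ 2 + 1 := Real.cosh_sq _
  have hab : a = b + 1 := Real.cosh_sq K
  have hcab : c = a + b := Real.cosh_two_mul K
  have hsab : s = 2 * Real.sinh K * Real.cosh K := Real.sinh_two_mul K
  have hcs' : s < c := by nlinarith
  have hb0 : 0 ≤ b := sq_nonneg _
  have hA : 2 * a * (c / s - 1) ≤ 1 := by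
    rw [div_sub_one hs0.ne', mul_div_assoc', div_le_one hs0]
    nlinarith
  have hcs1 : 0 ≤ c / s - 1 := by rw [sub_nonneg, one_le_div hs0]; exact hcs'.le
  have hB : 2 * b * (c / s - 1) ≤ 1 := by nlinarith
  have key : w ⬝ᵥ (sM K *ᵥ w) + tau w ⬝ᵥ (sM K *ᵥ tau w) =
      2 * (a * w (true, Fin.last L) ^ 2 + b * w (false, Fin.last L) ^ 2) +
      2 * (a * w (false, 0) ^ 2 + b * w (true, 0) ^ 2) +
      ∑ k : Fin L, (2 * (c / s) * (a * w (true, k.castSucc) ^ 2 + b * w (false, k.castSucc) ^ 2 +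
        a * w (false, k.succ) ^ 2 + b * w (true, k.succ) ^ 2) - 2 * w (true, k.castSucc) * w (true, k.succ) -
        2 * w (false, k.castSucc) * w (false, k.succ)) := by
    rw [sM_mulVec, sM_mulVec, dot_R1, dot_R1, dot_R2, dot_R2, add_add_add_comm, ← Finset.sum_add_distrib, ← hcd,
      ← hsd]
    congr 1
    · simp only [R1, tau, Bool.not_true, Bool.not_false, if_true, Bool.false_eq_true, if_false]
      rw [ha, hb]; ring
    · refine Finset.sum_congr rfl fun k _ => ?_
      simp only [R1, tau, Bool.not_true, Bool.not_false, if_true, Bool.false_eq_true, if_false]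
      rw [ha, hb, ← add_div, div_eq_iff hs0.ne']
      field_simp
      rw [hsab]; ring
  rw [key]
  have hle : ∀ k : Fin L, ((2 * (c / s) * a - 1) * w (true, k.castSucc) ^ 2 + (2 * (c / s) * b - 1) * w (true, k.succ) ^ 2)
      + ((2 * (c / s) * b - 1) * w (false, k.castSucc) ^ 2 + (2 * (c / s) * a - 1) * w (false, k.succ) ^ 2) ≤
      2 * (c / s) * (a * w (true, k.castSucc) ^ 2 + b * w (false, k.castSucc) ^ 2 +
        a * w (false, k.succ) ^ 2 + b * w (true, k.succ) ^ 2) - 2 * w (true, k.castSucc) * w (true, k.succ) -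
        2 * w (false, k.castSucc) * w (false, k.succ) := fun k => by
    nlinarith [sq_nonneg (w (true, k.castSucc) - w (true, k.succ)), sq_nonneg (w (false, k.castSucc) - w (false, k.succ))]
  have h1 := Finset.sum_le_sum fun k (_ : k ∈ Finset.univ) => hle k
  rw [Finset.sum_add_distrib, sum_fin_shift (fun k => w (true, k) ^ 2), sum_fin_shift (fun k => w (false, k) ^ 2)] at h1
  have hk : 2 * (s + s⁻¹ - 1) = 2 * (c / s) * (a + b) - 2 := by
    rw [← hcab]; field_simp; linear_combination (-1) * hcs
  have hd : w ⬝ᵥ w = ∑ k, w (true, k) ^ 2 + ∑ k, w (false, k) ^ 2 := by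
    rw [dot_modes, ← Finset.sum_add_distrib]; exact Finset.sum_congr rfl fun k _ => by ring
  rw [hk, hd]
  nlinarith [mul_nonneg (sub_nonneg.2 hA) (sq_nonneg (w (true, Fin.last L))),
    mul_nonneg (sub_nonneg.2 hB) (sq_nonneg (w (false, Fin.last L))),
    mul_nonneg (sub_nonneg.2 hA) (sq_nonneg (w (false, 0))),
    mul_nonneg (sub_nonneg.2 hB) (sq_nonneg (w (true, 0)))]

lemma sM_eig_ge {K : ℝ} (hK : 0 < K) (hs : 1 ≤ Real.sinh (2 * K)) {z : ℝ} {e : Bool × Fin (L + 1) → ℝ} (he : e ≠ 0)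
    (h : sM K *ᵥ e = z • e) : 2 * (Real.sinh (2 * K) + (Real.sinh (2 * K))⁻¹ - 1) ≤ z + z⁻¹ := by
  have h1 := sM_form_ge e hs
  rw [(sM_eig_tau hK he h).2, h, dotProduct_smul, dotProduct_smul, tau_dot_tau, smul_eq_mul, smul_eq_mul, ← add_mul] at h1
  exact le_of_mul_le_mul_right h1 (dot_self_pos he)
end

section
open Matrix
variable {L : ℕ}

lemma sum_cons (F : (Fin (L + 1) → Bool) → ℝ) : ∑ x, F x = ∑ y, F (Fin.cons true y) + ∑ y, F (Fin.cons false y) := by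
  rw [← (Fin.consEquiv fun _ : Fin (L + 1) => Bool).sum_comp, Fintype.sum_prod_type, Fintype.sum_bool]
  rfl

/-- Extend a vector on columns to columns with a plus bottom spin. -/
def exv (v : (Fin L → Bool) → ℝ) (x : Fin (L + 1) → Bool) : ℝ := if x 0 then v (Fin.tail x) else 0

lemma exv_cons (v : (Fin L → Bool) → ℝ) (g : Bool) (y : Fin L → Bool) :
    exv v (Fin.cons g y) = if g then v y else 0 := by rw [exv, Fin.cons_zero, Fin.tail_cons]

lemma sx_cons_succ (g : Bool) (y : Fin L → Bool) {j : ℕ} (hj : j < L) :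
    sx (Fin.cons g y : Fin (L + 1) → Bool) (j + 1) = sx y j := by
  rw [sx, sx, dif_pos (by omega : j + 1 < L + 1), dif_pos hj]; rfl

lemma tV_cons (K : ℝ) (g g' : Bool) (y y' : Fin L → Bool) :
    tV K (Fin.cons g y) (Fin.cons g' y') = if g = g' then tm K L g y y' else 0 := by
  rw [tV, tT, Fin.cons_zero, Fin.cons_zero]
  split_ifs with h
  · subst h
    have : tE (Fin.cons g y : Fin (L + 1) → Bool) (Fin.cons g y') = hE y y' :=
      Finset.sum_congr rfl fun j hj => by
        rw [sx_cons_succ _ _ (Finset.mem_range.1 hj), sx_cons_succ _ _ (Finset.mem_range.1 hj)]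
    rw [this, tm, Real.exp_add, Real.exp_add]
  · simp

lemma dot_exv (v : (Fin L → Bool) → ℝ) (f : (Fin (L + 1) → Bool) → ℝ) :
    exv v ⬝ᵥ f = v ⬝ᵥ fun y => f (Fin.cons true y) := by
  rw [dotProduct, sum_cons]; simp [exv_cons, dotProduct]

lemma dot_exv_exv (v w : (Fin L → Bool) → ℝ) : exv v ⬝ᵥ exv w = v ⬝ᵥ w := by
  rw [dot_exv]; simp [exv_cons]

lemma tV_mulVec_cons (K : ℝ) (f : (Fin (L + 1) → Bool) → ℝ) (g : Bool) (y : Fin L → Bool) :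
    (tV K *ᵥ f) (Fin.cons g y) = (tm K L g *ᵥ fun y => f (Fin.cons g y)) y := by
  rw [mulVec, dotProduct, sum_cons]
  cases g <;> simp [tV_cons, mulVec, dotProduct]

lemma tV_exv (K : ℝ) (v : (Fin L → Bool) → ℝ) : tV K *ᵥ exv v = exv (tm K L true *ᵥ v) := by
  ext x
  obtain ⟨g, y, rfl⟩ : ∃ g y, x = Fin.cons g y := ⟨x 0, Fin.tail x, (Fin.cons_self_tail x).symm⟩
  rw [tV_mulVec_cons, exv_cons]
  cases g
  · have : (fun y => exv v (Fin.cons false y)) = 0 := by ext y; simp [exv_cons]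
    rw [this, mulVec_zero]; simp
  · simp [exv_cons]

lemma tV_form_le {K : ℝ} (hK : 0 ≤ K) (hL : 0 < L) {r : ℝ} {Ω : (Fin L → Bool) → ℝ} (h : IsPerron (tm K L true) r Ω)
    (f : (Fin (L + 1) → Bool) → ℝ) : f ⬝ᵥ (tV K *ᵥ f) ≤ r * (f ⬝ᵥ f) := by
  obtain ⟨r', Ω', h'⟩ := exists_perron (tm_symm K L false) (fun y y' => tm_pos K L false y y')
  have hr := perron_rate_le hK hL h' h
  rw [dotProduct, sum_cons, dotProduct, sum_cons, mul_add]
  refine add_le_add ?_ ?_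
  · refine le_trans (le_of_eq ?_) (h.form_le fun y => f (Fin.cons true y))
    exact Finset.sum_congr rfl fun y _ => by rw [tV_mulVec_cons]
  · refine le_trans (le_of_eq ?_) ((h'.form_le fun y => f (Fin.cons false y)).trans
      (mul_le_mul_of_nonneg_right hr (dot_self_nonneg _)))
    exact Finset.sum_congr rfl fun y _ => by rw [tV_mulVec_cons]

lemma psi_kill {K : ℝ} (hK : 0 < K) (hL : 0 < L) {r : ℝ} {Ω : (Fin L → Bool) → ℝ} (h : IsPerron (tm K L true) r Ω)
    {u : Bool × Fin (L + 1) → ℝ} {z l : ℝ} (hu : sM K *ᵥ u = z • u) {f : (Fin (L + 1) → Bool) → ℝ}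
    (hf : tV K *ᵥ f = l • f) (hz : r < z * l) : psi u f = 0 := by
  have h1 : tV K *ᵥ psi u f = (z * l) • psi u f := by
    rw [tV_psi' _ hK.ne', hu, hf, psi_smul, psi_smul', smul_smul]
  have h2 := tV_form_le hK.le hL h (psi u f)
  rw [h1, dotProduct_smul, smul_eq_mul] at h2
  by_contra h3
  exact absurd (le_of_mul_le_mul_right h2 (dot_self_pos h3)) (not_le.2 hz)

/-- Apply a word of Majorana operators. -/
def words (l : List (Bool × Fin (L + 1) → ℝ)) (f : (Fin (L + 1) → Bool) → ℝ) : (Fin (L + 1) → Bool) → ℝ :=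
  l.foldr psi f

section words
variable (f g : (Fin (L + 1) → Bool) → ℝ) (l l₁ l₂ : List (Bool × Fin (L + 1) → ℝ)) (u v w : Bool × Fin (L + 1) → ℝ)

lemma words_cons : words (w :: l) f = psi w (words l f) := rfl
lemma words_append : words (l₁ ++ l₂) f = words l₁ (words l₂ f) := List.foldr_append
lemma words_add : words l (f + g) = words l f + words l g := by
  induction l with
  | nil => rfl
  | cons w l ih => rw [words_cons, words_cons, words_cons, ih, psi_add']
lemma words_smul (c : ℝ) : words l (c • f) = c • words l f := by
  induction l with
  | nil => rfl
  | cons w l ih => rw [words_cons, words_cons, ih, psi_smul']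
lemma words_zero : words l 0 = 0 := by have := words_smul (0 : (Fin (L + 1) → Bool) → ℝ) l 0; simpa using this

lemma dot_words_killed {Ω φ : (Fin (L + 1) → Bool) → ℝ} (hu : psi u Ω = 0)
    (H : ∀ l' : List (Bool × Fin (L + 1) → ℝ), l'.length < l.length → φ ⬝ᵥ words l' Ω = 0)
    (hl : l = l₁ ++ u :: l₂) : φ ⬝ᵥ words l Ω = 0 := by
  induction l₂ generalizing l l₁ with
  | nil => 
    have : words [] Ω = Ω := rfl
    rw [hl, words_append, words_cons, this, hu, words_zero, dotProduct_zero]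
  | cons w l₂ ih =>
    have e : words l Ω = (2 * (u ⬝ᵥ tau w)) • words (l₁ ++ l₂) Ω - words ((l₁ ++ [w]) ++ u :: l₂) Ω := by
      rw [eq_sub_iff_add_eq, hl, words_append, words_append _ l₁ l₂, words_append, words_append _ l₁ [w], ← words_add,
        ← words_smul]
      congr 1
      exact psi_anticomm u w (words l₂ Ω)
    rw [e, dotProduct_sub, dotProduct_smul, H _ (by rw [hl]; simp), smul_zero, zero_sub, neg_eq_zero]
    refine ih ((l₁ ++ [w]) ++ u :: l₂) (l₁ ++ [w]) (fun l' hl' => H l' ?_) rfl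
    rw [hl]; simpa using hl'

lemma dot_words_eq_zero {Ω φ : (Fin (L + 1) → Bool) → ℝ}
    (H : ∀ w, ∃ u u', w = u + tau u' ∧ psi u Ω = 0 ∧ psi u' φ = 0) (h0 : φ ⬝ᵥ Ω = 0) :
    φ ⬝ᵥ words l Ω = 0 := by
  induction hn : l.length using Nat.strong_induction_on generalizing l with
  | _ n ih =>
    cases l with
    | nil => exact h0
    | cons w l =>
      obtain ⟨u, u', rfl, h1, h2⟩ := H w
      rw [words_cons, psi_add, dotProduct_add]
      have e2 : φ ⬝ᵥ psi (tau u') (words l Ω) = 0 := by rw [dot_psi, tau_tau, h2, zero_dotProduct]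
      rw [e2, add_zero, ← words_cons]
      exact dot_words_killed (u :: l) [] l u h1 (fun l' hl' => ih _ (by rw [← hn]; simpa using hl') l' rfl) rfl

/-- The `γ` and `β` generators. -/
def mode (b : Bool) (k : Fin (L + 1)) : Bool × Fin (L + 1) → ℝ := Pi.single (b, k) 1

lemma psi_mode_true (k : Fin (L + 1)) (x : Fin (L + 1) → Bool) : psi (mode true k) f x = sx x (k + 1) * f (fl k x) := by
  rw [psi, Finset.sum_eq_single k]
  · simp [acf, mode]
  · intro j _ hj; simp [acf, mode, hj]
  · simp

lemma psi_mode_false (k : Fin (L + 1)) (x : Fin (L + 1) → Bool) : psi (mode false k) f x = - sx x k * f (fl k x) := by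
  rw [psi, Finset.sum_eq_single k]
  · simp [acf, mode]
  · intro j _ hj; simp [acf, mode, hj]
  · simp

lemma words_bond (k : Fin (L + 1)) (x : Fin (L + 1) → Bool) :
    words (mode false k :: mode true k :: l) f x = -(sx x k * sx x (k + 1)) * words l f x := by
  rw [words_cons, words_cons, psi_mode_false, psi_mode_true, fl_fl, sx_fl_gt (by omega)]; ring

lemma eq_zero_of_dot_words {Ω φ : (Fin (L + 1) → Bool) → ℝ} (H : ∀ l, φ ⬝ᵥ words l Ω = 0) (y : Fin (L + 1) → Bool)
    (hy : Ω y ≠ 0) : φ y = 0 := by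
  have key : ∀ s : Finset (Fin (L + 1)), ∀ l, φ ⬝ᵥ (fun x => (∏ k ∈ s, (1 + sx y k * sx y (k + 1) * (sx x k * sx x (k + 1)))) *
      words l Ω x) = 0 := by
    intro s
    induction s using Finset.induction_on with
    | empty => intro l; simpa using H l
    | insert k s hk ih =>
      intro l
      have e : (fun x => (∏ k ∈ insert k s, (1 + sx y k * sx y (k + 1) * (sx x k * sx x (k + 1)))) * words l Ω x) =
          (fun x => (∏ k ∈ s, (1 + sx y k * sx y (k + 1) * (sx x k * sx x (k + 1)))) * words l Ω x) -
          (sx y k * sx y (k + 1)) • (fun x => (∏ k ∈ s, (1 + sx y k * sx y (k + 1) * (sx x k * sx x (k + 1)))) *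
            words (mode false k :: mode true k :: l) Ω x) := by
        ext x
        rw [Pi.sub_apply, Pi.smul_apply, smul_eq_mul, Finset.prod_insert hk, words_bond]; ring
      rw [e, dotProduct_sub, dotProduct_smul, ih, ih]; simp
  have h1 := key Finset.univ []
  rw [dotProduct, Finset.sum_eq_single y] at h1
  · have h2 : (∏ k : Fin (L + 1), (1 + sx y k * sx y (k + 1) * (sx y k * sx y (k + 1)))) ≠ 0 := by
      refine Finset.prod_ne_zero_iff.2 fun k _ => ?_
      nlinarith [mul_self_nonneg (sx y k * sx y (k + 1))]
    have h3 : words [] Ω y ≠ 0 := hy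
    simpa [h2, h3] using h1
  · intro x _ hx
    have : ∃ k : Fin (L + 1), sx x k * sx x (k + 1) ≠ sx y k * sx y (k + 1) := by
      by_contra! hc
      apply hx
      have hd : ∀ d j : ℕ, j + d = L + 1 → sx x j = sx y j := by
        intro d
        induction d with
        | zero => intro j hj; simp [sx, show ¬ j < L + 1 by omega]
        | succ d ih =>
          intro j hj
          have h4 := hc ⟨j, by omega⟩
          simp only at h4
          rw [ih (j + 1) (by omega)] at h4
          refine mul_right_cancel₀ ?_ h4
          rcases sx_cases y (j + 1) with h | h <;> rw [h] <;> norm_num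
      ext j
      have h5 := hd (L + 1 - j) j (by omega)
      simp only [sx, j.2, dif_pos, Fin.eta] at h5
      revert h5
      cases x j <;> cases y j <;> simp [sval]; all_goals norm_num
    obtain ⟨k, hk⟩ := this
    have h6 : 1 + sx y k * sx y (k + 1) * (sx x k * sx x (k + 1)) = 0 := by
      rcases sx_cases x k with h1 | h1 <;> rcases sx_cases x (k + 1) with h2 | h2 <;>
      rcases sx_cases y k with h3 | h3 <;> rcases sx_cases y (k + 1) with h4 | h4 <;>
      rw [h1, h2, h3, h4] at hk ⊢ <;> first | (norm_num; done) | exact absurd (by norm_num) hk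
    rw [Finset.prod_eq_zero (Finset.mem_univ k) h6]; simp
  · simp
end words
end

section
open Matrix
variable {L : ℕ}

lemma tau_sum {ι : Type*} (s : Finset ι) (w : ι → Bool × Fin (L + 1) → ℝ) :
    tau (∑ i ∈ s, w i) = ∑ i ∈ s, tau (w i) := by
  classical
  induction s using Finset.induction_on with
  | empty => ext ⟨b, k⟩; cases b <;> simp [tau]
  | insert i s hi ih => rw [Finset.sum_insert hi, Finset.sum_insert hi, tau_add, ih]

lemma IsEigenbasis.ne_zero {X : Type*} [Fintype X] {M : Matrix X X ℝ} {e : X → X → ℝ} {μ : X → ℝ}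
    (h : IsEigenbasis M e μ) (i : X) : e i ≠ 0 := by
  intro h0
  have := h.norm i
  rw [h0] at this
  simp at this

lemma le_of_add_inv {z k : ℝ} (hz : 1 < z) (h : 2 * k ≤ z + z⁻¹) : 2 * k - 1 ≤ z := by
  have := inv_lt_one_of_one_lt₀ hz
  linarith

lemma modes_split {K : ℝ} (hK : 0 < K) (hs : 1 < Real.sinh (2 * K)) {f g : (Fin (L + 1) → Bool) → ℝ}
    (Hf : ∀ u z, sM K *ᵥ u = z • u → 2 * (Real.sinh (2 * K) + (Real.sinh (2 * K))⁻¹ - 1) - 1 ≤ z → psi u f = 0)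
    (Hg : ∀ u z, sM K *ᵥ u = z • u → 2 * (Real.sinh (2 * K) + (Real.sinh (2 * K))⁻¹ - 1) - 1 ≤ z → psi u g = 0)
    (w : Bool × Fin (L + 1) → ℝ) : ∃ u u', w = u + tau u' ∧ psi u f = 0 ∧ psi u' g = 0 := by
  obtain ⟨e, z, h⟩ := exists_eigenbasis (sM_symm (L := L) K)
  have hk : 1 < Real.sinh (2 * K) + (Real.sinh (2 * K))⁻¹ - 1 := by
    have h0 : 0 < Real.sinh (2 * K) := by linarith
    have : Real.sinh (2 * K) + (Real.sinh (2 * K))⁻¹ - 1 - 1 = (Real.sinh (2 * K) - 1) ^ 2 / Real.sinh (2 * K) := by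
      field_simp; ring
    have : 0 < (Real.sinh (2 * K) - 1) ^ 2 / Real.sinh (2 * K) := div_pos (by nlinarith) h0
    linarith
  refine ⟨∑ i, (if 1 < z i then e i ⬝ᵥ w else 0) • e i, ∑ i, (if 1 < z i then 0 else e i ⬝ᵥ w) • tau (e i), ?_, ?_, ?_⟩
  · rw [tau_sum, ← Finset.sum_add_distrib]
    conv_lhs => rw [h.expand w]
    refine Finset.sum_congr rfl fun i _ => ?_
    rw [tau_smul, tau_tau, ← add_smul]
    split_ifs <;> simp
  · rw [psi_sum]
    refine Finset.sum_eq_zero fun i _ => ?_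
    rw [psi_smul]
    split_ifs with hz
    · rw [Hf _ _ (h.eig i) (le_of_add_inv hz (sM_eig_ge hK hs.le (h.ne_zero i) (h.eig i))), smul_zero]
    · rw [zero_smul]
  · rw [psi_sum]
    refine Finset.sum_eq_zero fun i _ => ?_
    rw [psi_smul]
    split_ifs with hz
    · rw [zero_smul]
    · obtain ⟨h1, h2⟩ := sM_eig_tau hK (h.ne_zero i) (h.eig i)
      have h3 := sM_eig_ge hK hs.le (h.ne_zero i) (h.eig i)
      have h4 : z i ≠ 1 := fun h4 => by rw [h4] at h3; linarith
      have h5 : 1 < (z i)⁻¹ := (one_lt_inv₀ h1).2 (lt_of_le_of_ne (not_lt.1 hz) h4)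
      rw [Hg _ _ h2 (le_of_add_inv h5 (by rw [inv_inv]; linarith)), smul_zero]

/-- Spectral gap ratio of the transfer matrices. -/
def gapq (K : ℝ) : ℝ := (2 * (Real.sinh (2 * K) + (Real.sinh (2 * K))⁻¹ - 1) - 1)⁻¹

lemma gapq_mem {K : ℝ} (hs : 1 < Real.sinh (2 * K)) :
    1 < 2 * (Real.sinh (2 * K) + (Real.sinh (2 * K))⁻¹ - 1) - 1 ∧ 0 < gapq K ∧ gapq K < 1 := by
  have h0 : 0 < Real.sinh (2 * K) := by linarith
  have h1 : Real.sinh (2 * K) + (Real.sinh (2 * K))⁻¹ - 1 - 1 = (Real.sinh (2 * K) - 1) ^ 2 / Real.sinh (2 * K) := by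
    field_simp; ring
  have h2 : 0 < (Real.sinh (2 * K) - 1) ^ 2 / Real.sinh (2 * K) := div_pos (by nlinarith) h0
  have h3 : 1 < 2 * (Real.sinh (2 * K) + (Real.sinh (2 * K))⁻¹ - 1) - 1 := by linarith
  exact ⟨h3, inv_pos.2 (by linarith), inv_lt_one_of_one_lt₀ h3⟩

lemma gap_vec {K : ℝ} (hK : 0 < K) (hs : 1 < Real.sinh (2 * K)) (hL : 0 < L) {r : ℝ} {Ω : (Fin L → Bool) → ℝ}
    (h : IsPerron (tm K L true) r Ω) {v : (Fin L → Bool) → ℝ} {l : ℝ} (hv : tm K L true *ᵥ v = l • v)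
    (hl : gapq K * r < l) (hvo : v ⬝ᵥ Ω = 0) : v = 0 := by
  obtain ⟨h1, h2, h3⟩ := gapq_mem hs
  have hsm : ∀ (c : ℝ) (v : (Fin L → Bool) → ℝ), exv (c • v) = c • exv v := fun c v => by
    ext x; simp [exv]
  have kill : ∀ {v : (Fin L → Bool) → ℝ} {l : ℝ}, tm K L true *ᵥ v = l • v → gapq K * r < l →
      ∀ u z, sM K *ᵥ u = z • u → 2 * (Real.sinh (2 * K) + (Real.sinh (2 * K))⁻¹ - 1) - 1 ≤ z → psi u (exv v) = 0 := by
    intro v l hv hl u z hu hz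
    refine psi_kill hK hL h hu (l := l) (by rw [tV_exv, hv, hsm]) ?_
    have h4 : 0 < l := (mul_pos h2 h.pos).trans hl
    have h5 := mul_lt_mul_of_pos_left hl (by linarith : 0 < 2 * (Real.sinh (2 * K) + (Real.sinh (2 * K))⁻¹ - 1) - 1)
    rw [← mul_assoc, gapq, mul_inv_cancel₀ (by linarith), one_mul] at h5
    exact h5.trans_le (mul_le_mul_of_nonneg_right hz h4.le)
  have hr : gapq K * r < r := by nlinarith [h.pos]
  have h6 := eq_zero_of_dot_words (Ω := exv Ω) (φ := exv v) fun l => dot_words_eq_zero l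
    (modes_split hK hs (kill h.eig hr) (kill hv hl)) (by rw [dot_exv_exv, hvo])
  ext y
  have h7 := h6 (Fin.cons true y) (by rw [exv_cons]; exact (h.vec_pos y).ne')
  rwa [exv_cons] at h7

lemma gap_form {K : ℝ} (hK : 0 < K) (hs : 1 < Real.sinh (2 * K)) (hL : 0 < L) {r : ℝ} {Ω : (Fin L → Bool) → ℝ}
    (h : IsPerron (tm K L true) r Ω) {x : (Fin L → Bool) → ℝ} (hx : Ω ⬝ᵥ x = 0) :
    x ⬝ᵥ (tm K L true *ᵥ x) ≤ gapq K * r * (x ⬝ᵥ x) := by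
  obtain ⟨e, μ, he⟩ := exists_eigenbasis (tm_symm K L true)
  rw [he.form (tm_symm K L true), he.dot, Finset.mul_sum]
  refine Finset.sum_le_sum fun i _ => ?_
  rcases le_or_gt (μ i) (gapq K * r) with h1 | h1
  · exact mul_le_mul_of_nonneg_right h1 (mul_self_nonneg _)
  · suffices e i ⬝ᵥ x = 0 by rw [this]; simp
    have h2 := dot_mulVec_symm (tm_symm K L true) Ω (e i)
    rw [he.eig, h.eig, dotProduct_smul, smul_dotProduct, smul_eq_mul, smul_eq_mul] at h2
    have h3 : tm K L true *ᵥ (e i - (Ω ⬝ᵥ e i) • Ω) = μ i • (e i - (Ω ⬝ᵥ e i) • Ω) := by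
      rw [mulVec_sub, mulVec_smul, he.eig, h.eig, smul_sub, smul_smul, smul_smul, h2, mul_comm r]
    have h4 := gap_vec hK hs hL h h3 h1 (by
      rw [sub_dotProduct, smul_dotProduct, h.norm, dotProduct_comm]; simp)
    rw [sub_eq_zero.1 h4, smul_dotProduct, hx, smul_zero]

lemma diag_pow {X : Type*} [Fintype X] [DecidableEq X] (V D : Matrix X X ℝ) (k : ℕ) :
    (D * D) * (V * (D * D)) ^ k = D * (D * V * D) ^ k * D := by
  induction k with
  | zero => simp
  | succ k ih => rw [pow_succ, pow_succ, ← mul_assoc, ih]; simp only [mul_assoc]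

lemma tilt_scalar {q sh ch m m' N P Q R e S ρ b2 : ℝ} (hq0 : 0 < q) (hq1 : q < 1) (hsh : 0 ≤ sh) (hch : ch ^ 2 = sh ^ 2 + 1)
    (hch1 : 1 ≤ ch) (hm : m ≤ m') (hm1 : m ≤ 1) (hN : N = P ^ 2 + ρ) (hR : R = P ^ 2 * m' + 2 * (P * e) + S) (hQ : Q = P * m' + e)
    (hS : -ρ ≤ S) (he : e ^ 2 ≤ ρ) (hQN : Q ^ 2 ≤ N)
    (hb : b2 = (1 + ch) / 2 * P ^ 2 - sh * (P * Q) + (ch - 1) / 2 * Q ^ 2) :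
    q * (ch * N - sh * R) + (1 - q) * b2 ≤ (ch - m * sh + (1 + 2 / (1 - q)) * sh ^ 2) * N := by
  have hd : 0 < 1 - q := by linarith
  have hρ : 0 ≤ ρ := (sq_nonneg _).trans he
  have hN0 : 0 ≤ N := by rw [hN]; positivity
  have hc : ch - 1 ≤ sh ^ 2 := by nlinarith
  have a1 : 2 * sh * ρ ≤ ((1 - q) / 2 + 2 / (1 - q) * sh ^ 2) * ρ := by
    refine mul_le_mul_of_nonneg_right ?_ hρ
    have : (1 - q) / 2 + 2 / (1 - q) * sh ^ 2 - 2 * sh = ((1 - q) - 2 * sh) ^ 2 / (2 * (1 - q)) := by field_simp; ring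
    have : 0 ≤ ((1 - q) - 2 * sh) ^ 2 / (2 * (1 - q)) := by positivity
    linarith
  have a2 : -(sh * (P * e) * (1 + q)) ≤ (1 - q) / 2 * ρ + 2 / (1 - q) * sh ^ 2 * P ^ 2 := by
    have h1 : 0 ≤ ((1 - q) * e + (1 + q) * sh * P) ^ 2 / (2 * (1 - q)) := by positivity
    have h2 : ((1 - q) * e + (1 + q) * sh * P) ^ 2 / (2 * (1 - q)) =
        (1 - q) / 2 * e ^ 2 + sh * (P * e) * (1 + q) + (1 + q) ^ 2 / (2 * (1 - q)) * sh ^ 2 * P ^ 2 := by field_simp; ring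
    have h3 : (1 + q) ^ 2 / (2 * (1 - q)) * sh ^ 2 * P ^ 2 ≤ 2 / (1 - q) * sh ^ 2 * P ^ 2 := by
      refine mul_le_mul_of_nonneg_right (mul_le_mul_of_nonneg_right ?_ (sq_nonneg _)) (sq_nonneg _)
      rw [div_le_div_iff₀ (by linarith) hd]
      have : 0 ≤ 4 - (1 + q) ^ 2 := by nlinarith
      nlinarith [mul_nonneg hd.le this]
    have h4 := mul_le_mul_of_nonneg_left he (by linarith : 0 ≤ (1 - q) / 2)
    linarith
  have a3 : (1 - q) * ((ch - 1) / 2 * Q ^ 2) ≤ (1 - q) * ((ch - 1) / 2 * N) :=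
    mul_le_mul_of_nonneg_left (mul_le_mul_of_nonneg_left hQN (by linarith)) hd.le
  have a4 : sh * P ^ 2 * m ≤ sh * P ^ 2 * m' := mul_le_mul_of_nonneg_left hm (by positivity)
  have a5 : sh * ρ * m ≤ sh * ρ * 1 := mul_le_mul_of_nonneg_left hm1 (by positivity)
  have a6 : -(q * sh * S) ≤ sh * ρ := by
    linarith [mul_le_mul_of_nonneg_left hS (mul_nonneg hq0.le hsh), mul_nonneg (mul_nonneg hsh hρ) hd.le]
  have a7 : (ch - 1) * N ≤ sh ^ 2 * N := mul_le_mul_of_nonneg_right hc hN0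
  have a8 : (1 - q) * ρ ≤ (1 - q) * ch * ρ := by
    linarith [mul_nonneg (mul_nonneg hd.le hρ) (sub_nonneg.2 hch1)]
  have a9 : (1 - q) * ((ch - 1) / 2 * N) ≤ (ch - 1) * N := by
    nlinarith [mul_nonneg (sub_nonneg.2 hch1) hN0, mul_nonneg (mul_nonneg (sub_nonneg.2 hch1) hN0) hq0.le]
  have a10 : (1 - q) * ((1 + ch) / 2 * P ^ 2) ≤ (1 - q) * ch * P ^ 2 := by
    linarith [mul_nonneg (mul_nonneg hd.le (sub_nonneg.2 hch1)) (sq_nonneg P)]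
  have b1 : P * Q = P ^ 2 * m' + P * e := by rw [hQ]; ring
  rw [hb, b1, hR]
  generalize 2 / (1 - q) = G at *
  generalize Q ^ 2 = Q2 at *
  rw [hN] at a7 a9 a3 ⊢
  clear hb b1 hR hN hQ hS hQN he hc hch
  generalize P * e = Pe at *
  generalize P ^ 2 = P2 at *
  linarith only [a1, a2, a3, a4, a5, a6, a7, a8, a9, a10]
end

section
open Matrix
variable {L : ℕ}

lemma tilt_form_le {K : ℝ} (hK : 0 < K) (hs : 1 < Real.sinh (2 * K)) (hL : 0 < L) {r : ℝ} {Ω : (Fin L → Bool) → ℝ}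
    (h : IsPerron (tm K L true) r Ω) {t : ℝ} (ht : 0 ≤ t) {j : ℕ} (hj : j < L) (x : (Fin L → Bool) → ℝ) :
    (fun y => Real.exp (-(t / 2) * sx y j) * x y) ⬝ᵥ (tm K L true *ᵥ fun y => Real.exp (-(t / 2) * sx y j) * x y) ≤
      r * (Real.cosh t - mp K 0 * Real.sinh t + (1 + 2 / (1 - gapq K)) * Real.sinh t ^ 2) * (x ⬝ᵥ x) := by
  set q := gapq K
  obtain ⟨-, hq0, hq1⟩ := gapq_mem hs
  have hsum1 : ∑ y, Ω y ^ 2 = 1 := by rw [← h.norm]; exact Finset.sum_congr rfl fun y _ => sq _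
  have hexp : ∀ u : ℝ, ∀ y : Fin L → Bool, Real.exp (-u * sx y j) = Real.cosh u - Real.sinh u * sx y j := fun u y => by
    rw [Real.cosh_eq, Real.sinh_eq]
    rcases sx_cases y j with h | h <;> rw [h] <;> ring_nf
  set y : (Fin L → Bool) → ℝ := fun y => Real.exp (-(t / 2) * sx y j) * x y with hy
  set c := Ω ⬝ᵥ y with hc
  have hgen : y ⬝ᵥ (tm K L true *ᵥ y) ≤ r * (q * (y ⬝ᵥ y) + (1 - q) * c ^ 2) := by
    have ho : Ω ⬝ᵥ (y - c • Ω) = 0 := by rw [dotProduct_sub, dotProduct_smul, h.norm, ← hc]; simp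
    have h1 := gap_form hK hs hL h ho
    have e1 : (y - c • Ω) ⬝ᵥ (tm K L true *ᵥ (y - c • Ω)) = y ⬝ᵥ (tm K L true *ᵥ y) - r * c ^ 2 := by
      rw [mulVec_sub, mulVec_smul, h.eig, dotProduct_sub, sub_dotProduct, sub_dotProduct, smul_dotProduct,
        dot_mulVec_symm (tm_symm K L true) Ω, h.eig]
      simp only [smul_dotProduct, dotProduct_smul, smul_eq_mul, h.norm, ← hc, dotProduct_comm y Ω]
      ring
    have e2 : (y - c • Ω) ⬝ᵥ (y - c • Ω) = y ⬝ᵥ y - c ^ 2 := by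
      rw [dotProduct_sub, sub_dotProduct, sub_dotProduct]
      simp only [smul_dotProduct, dotProduct_smul, smul_eq_mul, h.norm, ← hc, dotProduct_comm y Ω]
      ring
    rw [e1, e2] at h1
    change _ ≤ q * r * _ at h1
    nlinarith
  refine hgen.trans ?_
  rw [mul_assoc]
  refine mul_le_mul_of_nonneg_left ?_ h.pos.le
  set P := ∑ y, Ω y * x y with hP
  set Q := ∑ y, sx y j * Ω y * x y with hQ
  set R := ∑ y, sx y j * x y ^ 2 with hR
  set m' := ∑ y, Ω y ^ 2 * sx y j with hm'
  set e := ∑ y, sx y j * Ω y * (x y - P * Ω y) with he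
  set S := ∑ y, sx y j * (x y - P * Ω y) ^ 2 with hS
  set ρ := ∑ y, (x y - P * Ω y) ^ 2 with hρ
  have hN : x ⬝ᵥ x = P ^ 2 + ρ := by
    have key : ∀ p : ℝ, ∑ y, (x y - p * Ω y) ^ 2 = x ⬝ᵥ x - 2 * p * ∑ y, Ω y * x y + p ^ 2 * ∑ y, Ω y ^ 2 := fun p => by
      rw [dotProduct, Finset.mul_sum, Finset.mul_sum, ← Finset.sum_sub_distrib, ← Finset.sum_add_distrib]
      exact Finset.sum_congr rfl fun y _ => by ring
    rw [hρ, key, hsum1, ← hP]; ring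
  have hQe : Q = P * m' + e := by
    rw [hm', he, hQ, Finset.mul_sum, ← Finset.sum_add_distrib]
    exact Finset.sum_congr rfl fun y _ => by ring
  have hRe : R = P ^ 2 * m' + 2 * (P * e) + S := by
    rw [hm', he, hR, hS, Finset.mul_sum, Finset.mul_sum, Finset.mul_sum, ← Finset.sum_add_distrib, ← Finset.sum_add_distrib]
    exact Finset.sum_congr rfl fun y _ => by ring
  have hsx1 : ∀ y : Fin L → Bool, -1 ≤ sx y j := fun y => by rcases sx_cases y j with h | h <;> rw [h] <;> norm_num
  have hS' : -ρ ≤ S := by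
    rw [hS, hρ, ← Finset.sum_neg_distrib]
    exact Finset.sum_le_sum fun y _ => by nlinarith [mul_le_mul_of_nonneg_right (hsx1 y) (sq_nonneg (x y - P * Ω y))]
  have cs : ∀ v : (Fin L → Bool) → ℝ, (∑ y, sx y j * Ω y * v y) ^ 2 ≤ ∑ y, v y ^ 2 := fun v => by
    have h1 := Finset.sum_mul_sq_le_sq_mul_sq Finset.univ (fun y => sx y j * Ω y) v
    have h2 : ∑ y, (sx y j * Ω y) ^ 2 = 1 := by
      rw [← hsum1]; exact Finset.sum_congr rfl fun y _ => by rw [mul_pow, sq (sx y j), sx_sq, one_mul]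
    rwa [h2, one_mul] at h1
  have hxx : x ⬝ᵥ x = ∑ y, x y ^ 2 := Finset.sum_congr rfl fun y _ => (sq _).symm
  have hmm : mp K 0 ≤ m' := perron_mag_ge hK.le h hj
  have hm1 : m' ≤ 1 := by
    rw [← hsum1]
    refine Finset.sum_le_sum fun y _ => ?_
    rcases sx_cases y j with h | h <;> rw [h] <;> nlinarith [sq_nonneg (Ω y)]
  have hcc : c = Real.cosh (t / 2) * P - Real.sinh (t / 2) * Q := by
    rw [hc, hP, hQ, Finset.mul_sum, Finset.mul_sum, ← Finset.sum_sub_distrib]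
    refine Finset.sum_congr rfl fun y _ => ?_
    rw [hy]; simp only [hexp]; ring
  have hyy : y ⬝ᵥ y = Real.cosh t * (x ⬝ᵥ x) - Real.sinh t * R := by
    rw [hxx, hR, Finset.mul_sum, Finset.mul_sum, ← Finset.sum_sub_distrib]
    refine Finset.sum_congr rfl fun y _ => ?_
    have : Real.exp (-(t / 2) * sx y j) * Real.exp (-(t / 2) * sx y j) = Real.cosh t - Real.sinh t * sx y j := by
      rw [← Real.exp_add, ← hexp]; ring_nf
    rw [hy]; simp only; linear_combination x y ^ 2 * this
  have hsq := Real.cosh_sq (t / 2)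
  have hc2 := Real.cosh_two_mul (t / 2)
  have hs2 := Real.sinh_two_mul (t / 2)
  rw [mul_div_cancel₀ t two_ne_zero] at hc2 hs2
  rw [hyy]
  refine tilt_scalar hq0 hq1 (Real.sinh_nonneg_iff.2 ht) (Real.cosh_sq t) (Real.one_le_cosh t) hmm (hmm.trans hm1) hN hRe hQe
    hS' (cs _) (hxx ▸ cs x) ?_
  rw [hcc, hs2, hc2]
  linear_combination (P ^ 2 / 2 - Q ^ 2 / 2) * hsq

lemma lineLD_of_sinh {K : ℝ} (hK : 0 < K) (hs : 1 < Real.sinh (2 * K)) {μ : Measure Cfg2} (hμ : IsPlusPhase K 0 μ) :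
    LineLD μ := by
  have hq := gapq_mem hs
  refine ⟨1 + 2 / (1 - gapq K), ?_, fun t ht k => ?_⟩
  · have : 0 ≤ 2 / (1 - gapq K) := div_nonneg zero_le_two (by linarith [hq.2.2])
    linarith
  rw [Pm_zero_eq hμ hK.le, show 1 - 2 * ((1 - mp K 0) / 2) = mp K 0 by ring]
  refine Ev_tilt_le hμ hK.le ht.le k fun l r Ω h => ?_
  set V : Matrix (Fin (2 * l + 1) → Bool) (Fin (2 * l + 1) → Bool) ℝ := tm K (2 * l + 1) true with hV
  set D : Matrix (Fin (2 * l + 1) → Bool) (Fin (2 * l + 1) → Bool) ℝ :=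
    diagonal (fun y => Real.exp (-(t / 2) * sx y l)) with hD
  set T := Real.cosh t - mp K 0 * Real.sinh t + (1 + 2 / (1 - gapq K)) * Real.sinh t ^ 2
  have hDD : diagonal (fun y : Fin (2 * l + 1) → Bool => Real.exp (-t * sx y l)) = D * D := by
    rw [hD, diagonal_mul_diagonal]
    congr 1; ext y; rw [← Real.exp_add]; ring_nf
  have hVs : V.IsSymm := tm_symm K _ true
  have hDs : D.IsSymm := by rw [Matrix.IsSymm, hD, diagonal_transpose]
  have hDv : ∀ x, D *ᵥ x = fun y => Real.exp (-(t / 2) * sx y l) * x y := fun x => by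
    ext y; rw [hD, mulVec_diagonal]
  have hB : (D * V * D).IsSymm := by
    rw [Matrix.IsSymm, transpose_mul, transpose_mul, hDs.eq, hVs.eq, mul_assoc]
  have hB0 : ∀ i j, 0 ≤ (D * V * D) i j := fun i j => by
    rw [hD, mul_diagonal, diagonal_mul]
    exact mul_nonneg (mul_nonneg (Real.exp_pos _).le (tm_pos K _ true i j).le) (Real.exp_pos _).le
  have hform : ∀ x, x ⬝ᵥ ((D * V * D) *ᵥ x) ≤ r * T * (x ⬝ᵥ x) := fun x => by
    rw [← mulVec_mulVec, ← mulVec_mulVec, dot_mulVec_symm hDs, hDv]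
    exact tilt_form_le hK hs (by omega) h ht.le (by omega) x
  have h1 := form_pow_le hB hB0 hform k (D *ᵥ Ω)
  rw [hDD, diag_pow, ← mulVec_mulVec, ← mulVec_mulVec, dot_mulVec_symm hDs, div_le_iff₀ (pow_pos h.pos k)]
  refine h1.trans ?_
  have h2 : (D *ᵥ Ω) ⬝ᵥ (D *ᵥ Ω) ≤ Real.exp t := by
    have e0 : Real.exp t = Real.exp t * (Ω ⬝ᵥ Ω) := by rw [h.norm, mul_one]
    rw [e0, hDv, dotProduct, dotProduct, Finset.mul_sum]
    refine Finset.sum_le_sum fun y _ => ?_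
    rw [mul_mul_mul_comm, ← Real.exp_add]
    refine mul_le_mul_of_nonneg_right (Real.exp_le_exp.2 ?_) (mul_self_nonneg _)
    rcases sx_cases y l with h | h <;> rw [h] <;> linarith
  have h3 : 0 ≤ (r * T) ^ k := by
    have h4 := hform Ω
    rw [h.norm, mul_one] at h4
    refine pow_nonneg (le_trans ?_ h4) k
    exact Finset.sum_nonneg fun y _ => mul_nonneg (h.vec_pos y).le
      (Finset.sum_nonneg fun y' _ => mul_nonneg (hB0 _ _) (h.vec_pos y').le)
  calc _ ≤ (r * T) ^ k * Real.exp t := mul_le_mul_of_nonneg_left h2 h3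
    _ = _ := by rw [mul_pow]; ring
end

section
open Matrix
variable {β : ℝ} {L : ℕ}

/-- Magnetization at the centre of a box with plus boundary condition. -/
def bmag (β : ℝ) (R : ℕ) : ℝ := Ex β 0 (box R) (fun _ => true) (fun η => sval (η 0))

lemma bmag_shift (R : ℕ) (o : ℤ × ℤ) :
    Ex β 0 ((box R).image (· + o)) (fun _ => true) (fun η => sval (η o)) = bmag β R := by
  rw [Ex_shift]
  congr 1
  ext η
  simp [shiftC]

lemma mp_le_bmag (hβ : 0 ≤ β) (R : ℕ) : mp β 0 ≤ bmag β R := mp_le_Ex hβ 0 (box R)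

lemma Ex_pair_le (hβ : 0 ≤ β) {Λ : Finset (ℤ × ℤ)} {p q : ℤ × ℤ} (R : ℕ) (hp : (box R).image (· + p) ⊆ Λ)
    (hq : (box R).image (· + q) ⊆ Λ) (hpq : p ∉ (box R).image (· + q)) :
    Ex β 0 Λ (fun _ => true) (fun η => sval (η p) * sval (η q)) ≤
      2 * bmag β R + bmag β R ^ 2 - 2 * mp β 0 := by
  have e : (fun η : Cfg2 => (1 + sval (η p)) * (1 + sval (η q))) =
      fun η => (1 + sval (η p)) + (sval (η q) + sval (η p) * sval (η q)) := by ext η; ring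
  have m1 : ∀ o : ℤ × ℤ, Monotone fun η : Cfg2 => 1 + sval (η o) := fun o => (sval_at_mono o).const_add 1
  have n1 : ∀ (o : ℤ × ℤ) (η : Cfg2), 0 ≤ 1 + sval (η o) := fun o η => by cases η o <;> norm_num [sval]
  have hx : ∀ (Λ : Finset (ℤ × ℤ)) (o : ℤ × ℤ), Ex β 0 Λ (fun _ => true) (fun η => 1 + sval (η o)) =
      1 + Ex β 0 Λ (fun _ => true) (fun η => sval (η o)) := fun Λ o => by rw [Ex_add, Ex_const]
  have h1 := Ex_mul_le (h := 0) (σ := fun _ => true) (g := fun η : Cfg2 => 1 + sval (η p)) hβ hq (m1 q)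
    (fun η ζ h => by rw [h p hpq]) (n1 p)
  have h2 := Ex_domain_anti (h := 0) hβ hp (m1 p)
  rw [e, Ex_add (g := fun η => sval (η q) + sval (η p) * sval (η q)), hx, hx, Ex_add, bmag_shift] at h1
  rw [hx, hx, bmag_shift] at h2
  have h3 := mp_le_Ex (h := 0) hβ p Λ
  have h4 := mp_le_Ex (h := 0) hβ q Λ
  have h5 := mp_le_bmag hβ R
  have h6 := mp_zero_nonneg hβ
  nlinarith

lemma strip_pair_le (hβ : 0 ≤ β) {r : ℝ} {Ω : (Fin L → Bool) → ℝ} (h : IsPerron (tm β L true) r Ω) {j j' R : ℕ}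
    (h1 : R ≤ j) (h2 : j + R < j') (h3 : j' + R < L) :
    ∑ y, Ω y ^ 2 * (sx y j * sx y j') ≤ 2 * bmag β R + bmag β R ^ 2 - 2 * mp β 0 := by
  have hl := Ex_rect_limit β (by omega) h (fun y => sx y j * sx y j') 0
  have e : Ω ⬝ᵥ ((diagonal (fun y => sx y j * sx y j') * (tm β L true * diagonal (fun y => sx y j * sx y j')) ^ 0) *ᵥ Ω) / r ^ 0 =
      ∑ y, Ω y ^ 2 * (sx y j * sx y j') := by
    rw [pow_zero, pow_zero, div_one, mul_one]
    simp only [dotProduct, mulVec_diagonal]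
    exact Finset.sum_congr rfl fun y _ => by ring
  rw [e] at hl
  refine le_of_tendsto hl ?_
  filter_upwards [eventually_ge_atTop R] with N hN
  have hj : ∀ i : ℕ, R ≤ i → i + R < L → (box R).image (· + ((N : ℤ), (i : ℤ))) ⊆ rect (N + 0 + N) L := by
    rintro i h1 h2 ⟨a, b⟩ hx
    simp only [Finset.mem_image, box, Finset.mem_product, Finset.mem_Icc, Prod.mk.injEq, Prod.mk_add_mk,
      Prod.exists] at hx
    rw [mem_rect]
    simp only
    obtain ⟨a', b', h⟩ := hx
    omega
  refine le_trans (le_of_eq ?_) (Ex_pair_le hβ R (hj j h1 (by omega)) (hj j' (by omega) h3) ?_)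
  · congr 1
    ext η
    simp [sx, colOf, show j < L by omega, show j' < L by omega]
  · simp only [Finset.mem_image, box, Finset.mem_product, Finset.mem_Icc, Prod.mk.injEq, Prod.mk_add_mk,
      Prod.exists, not_exists]
    intro a b
    omega

/-- Average of `n` spins at mutual distance `R + 1`. -/
def avs {n' : ℕ} (n R g : ℕ) (y : Fin n' → Bool) : ℝ := (∑ a ∈ Finset.range n, sx y (g + a * (R + 1))) / n

lemma avs_conc (hβ : 0 ≤ β) {r : ℝ} {Ω : (Fin L → Bool) → ℝ} (h : IsPerron (tm β L true) r Ω) {n R g : ℕ} (hn : 0 < n)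
    (h1 : R ≤ g) (h2 : g + n * (R + 1) ≤ L) :
    ∑ y, Ω y ^ 2 * (avs n R g y - mp β 0) ^ 2 ≤ 1 / n + (2 * bmag β R + bmag β R ^ 2 - 2 * mp β 0) - mp β 0 ^ 2 := by
  set m := mp β 0
  set B := 2 * bmag β R + bmag β R ^ 2 - 2 * m
  have hn' : (0 : ℝ) < n := Nat.cast_pos.2 hn
  have hsum1 : ∑ y, Ω y ^ 2 = 1 := by rw [← h.norm]; exact Finset.sum_congr rfl fun y _ => sq _
  have hm : 0 ≤ m := mp_zero_nonneg hβ
  have hB : 0 ≤ B := by have := mp_le_bmag hβ R; simp only [B]; nlinarith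
  have hpos : ∀ a ∈ Finset.range n, g + a * (R + 1) + R < L := fun a ha => by
    rw [Finset.mem_range] at ha
    have : (a + 1) * (R + 1) ≤ n * (R + 1) := Nat.mul_le_mul_right _ ha
    nlinarith
  have hlin : m ≤ ∑ y, Ω y ^ 2 * avs n R g y := by
    have : ∑ y, Ω y ^ 2 * avs n R g y = (∑ a ∈ Finset.range n, ∑ y, Ω y ^ 2 * sx y (g + a * (R + 1))) / n := by
      rw [Finset.sum_comm, Finset.sum_div]
      exact Finset.sum_congr rfl fun y _ => by rw [avs, ← Finset.mul_sum, mul_div_assoc]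
    rw [this, le_div_iff₀ hn']
    calc m * n = ∑ a ∈ Finset.range n, m := by simp [mul_comm]
      _ ≤ _ := Finset.sum_le_sum fun a ha => perron_mag_ge hβ h (by have := hpos a ha; omega)
  have hpair : ∀ a ∈ Finset.range n, ∀ b ∈ Finset.range n,
      ∑ y, Ω y ^ 2 * (sx y (g + a * (R + 1)) * sx y (g + b * (R + 1))) ≤ (if a = b then 1 else 0) + B := by
    intro a ha b hb
    have key : ∀ a ∈ Finset.range n, ∀ b ∈ Finset.range n, a < b →
        ∑ y, Ω y ^ 2 * (sx y (g + a * (R + 1)) * sx y (g + b * (R + 1))) ≤ B := fun a ha b hb hab => by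
      refine strip_pair_le hβ h (by omega) ?_ (hpos b hb)
      have : (a + 1) * (R + 1) ≤ b * (R + 1) := Nat.mul_le_mul_right _ hab
      nlinarith
    rcases lt_trichotomy a b with hab | rfl | hab
    · rw [if_neg hab.ne, zero_add]; exact key a ha b hb hab
    · rw [if_pos rfl]
      simp only [sx_sq, mul_one]
      linarith
    · rw [if_neg hab.ne', zero_add]
      simp only [mul_comm (sx _ (g + a * (R + 1)))]
      exact key b hb a ha hab
  have hquad : ∑ y, Ω y ^ 2 * avs n R g y ^ 2 ≤ 1 / n + B := by
    have : ∑ y, Ω y ^ 2 * avs n R g y ^ 2 = (∑ a ∈ Finset.range n, ∑ b ∈ Finset.range n,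
        ∑ y, Ω y ^ 2 * (sx y (g + a * (R + 1)) * sx y (g + b * (R + 1)))) / n ^ 2 := by
      have e1 : ∀ a, ∑ b ∈ Finset.range n, ∑ y, Ω y ^ 2 * (sx y (g + a * (R + 1)) * sx y (g + b * (R + 1))) =
          ∑ y, Ω y ^ 2 * (sx y (g + a * (R + 1)) * ∑ b ∈ Finset.range n, sx y (g + b * (R + 1))) := fun a => by
        rw [Finset.sum_comm]
        exact Finset.sum_congr rfl fun y _ => by rw [← Finset.mul_sum, ← Finset.mul_sum]
      simp only [e1]
      rw [Finset.sum_comm, Finset.sum_div]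
      refine Finset.sum_congr rfl fun y _ => ?_
      rw [avs, ← Finset.mul_sum, ← Finset.sum_mul, div_pow, mul_div_assoc, sq (∑ a ∈ _, _)]
    rw [this, div_le_iff₀ (by positivity)]
    refine (Finset.sum_le_sum fun a ha => Finset.sum_le_sum fun b hb => hpair a ha b hb).trans_eq ?_
    simp only [Finset.sum_add_distrib, Finset.sum_ite_eq, Finset.sum_const, Finset.card_range, nsmul_eq_mul]
    rw [Finset.sum_congr rfl fun a ha => if_pos ha]
    simp only [Finset.sum_const, Finset.card_range, nsmul_eq_mul]
    field_simp
  have : ∑ y, Ω y ^ 2 * (avs n R g y - m) ^ 2 =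
      ∑ y, Ω y ^ 2 * avs n R g y ^ 2 - 2 * m * ∑ y, Ω y ^ 2 * avs n R g y + m ^ 2 * ∑ y, Ω y ^ 2 := by
    rw [Finset.mul_sum, Finset.mul_sum, ← Finset.sum_sub_distrib, ← Finset.sum_add_distrib]
    exact Finset.sum_congr rfl fun y _ => by ring
  rw [this, hsum1]
  nlinarith
end

section
open Matrix
variable {L : ℕ} {K : ℝ}

/-- Euclidean length of a real vector. -/
def len {X : Type*} [Fintype X] (x : X → ℝ) : ℝ := √(x ⬝ᵥ x)

lemma len_nonneg {X : Type*} [Fintype X] (x : X → ℝ) : 0 ≤ len x := Real.sqrt_nonneg _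

lemma len_sq {X : Type*} [Fintype X] (x : X → ℝ) : len x ^ 2 = x ⬝ᵥ x := Real.sq_sqrt (dot_self_nonneg x)

lemma abs_dot_le_len {X : Type*} [Fintype X] (x y : X → ℝ) : |x ⬝ᵥ y| ≤ len x * len y :=
  abs_le_of_sq_le_sq (by rw [mul_pow, len_sq, len_sq]; exact dot_sq_le x y) (mul_nonneg (len_nonneg x) (len_nonneg y))

lemma len_psi_le (w : Bool × Fin (L + 1) → ℝ) (f : (Fin (L + 1) → Bool) → ℝ) :
    len (psi w f) ≤ √2 * (len w * len f) := by
  refine le_of_sq_le_sq ?_ (mul_nonneg (Real.sqrt_nonneg _) (mul_nonneg (len_nonneg _) (len_nonneg _)))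
  rw [mul_pow, mul_pow, len_sq, len_sq, len_sq, Real.sq_sqrt zero_le_two]
  have := psi_norm_add w f
  have := dot_self_nonneg (psi (tau w) f)
  linarith

lemma abs_psi_dot_psi_le (u v : Bool × Fin (L + 1) → ℝ) (f g : (Fin (L + 1) → Bool) → ℝ) :
    |psi u f ⬝ᵥ psi v g| ≤ 2 * (len u * len v) * (len f * len g) := by
  have h2 : √2 * √2 = 2 := Real.mul_self_sqrt zero_le_two
  refine (abs_dot_le_len _ _).trans ((mul_le_mul (len_psi_le u f) (len_psi_le v g) (len_nonneg _)
    ((len_nonneg _).trans (len_psi_le u f))).trans_eq ?_)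
  linear_combination (len u * len v * (len f * len g)) * h2

/-- Truncated two-point form of the Majorana operators. -/
def qH (Φ : (Fin (L + 1) → Bool) → ℝ) (u v : Bool × Fin (L + 1) → ℝ) : ℝ := psi u Φ ⬝ᵥ psi v Φ - u ⬝ᵥ v

/-- The odd part of the evolution of modes. -/
def sZ (K : ℝ) (w : Bool × Fin (L + 1) → ℝ) : Bool × Fin (L + 1) → ℝ := sM K *ᵥ w - tau (sM K *ᵥ tau w)

/-- The energy form of modes. -/
def aF (K : ℝ) (Φ : (Fin (L + 1) → Bool) → ℝ) (u v : Bool × Fin (L + 1) → ℝ) : ℝ := - qH Φ u (sZ K v)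

variable {Φ : (Fin (L + 1) → Bool) → ℝ} (u v w : Bool × Fin (L + 1) → ℝ)

lemma qH_add : qH Φ u (v + w) = qH Φ u v + qH Φ u w := by
  rw [qH, qH, qH, psi_add, dotProduct_add, dotProduct_add]; ring

lemma qH_smul (c : ℝ) : qH Φ u (c • v) = c * qH Φ u v := by
  rw [qH, qH, psi_smul, dotProduct_smul, dotProduct_smul, smul_eq_mul, smul_eq_mul]; ring

lemma qH_sum {ι : Type*} (s : Finset ι) (f : ι → Bool × Fin (L + 1) → ℝ) :
    qH Φ u (∑ i ∈ s, f i) = ∑ i ∈ s, qH Φ u (f i) := by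
  rw [qH, psi_sum, dotProduct_sum, dotProduct_sum, ← Finset.sum_sub_distrib]; rfl

lemma sZ_smul (c : ℝ) : sZ K (c • w) = c • sZ K w := by
  rw [sZ, sZ, mulVec_smul, tau_smul, mulVec_smul, tau_smul, smul_sub]

lemma sZ_sum {ι : Type*} (s : Finset ι) (f : ι → Bool × Fin (L + 1) → ℝ) :
    sZ K (∑ i ∈ s, f i) = ∑ i ∈ s, sZ K (f i) := by
  rw [sZ, mulVec_sum, tau_sum, mulVec_sum, tau_sum, ← Finset.sum_sub_distrib]; rfl

lemma sZ_eig (hK : 0 < K) {z : ℝ} {e : Bool × Fin (L + 1) → ℝ} (he : e ≠ 0) (h : sM K *ᵥ e = z • e) :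
    sZ K e = (z - z⁻¹) • e := by
  rw [sZ, (sM_eig_tau hK he h).2, tau_smul, tau_tau, h, sub_smul]

lemma abs_qH_le (hΦ : Φ ⬝ᵥ Φ = 1) : |qH Φ u v| ≤ 3 * (len u * len v) := by
  have h1 := abs_psi_dot_psi_le u v Φ Φ
  have h2 := abs_dot_le_len u v
  have h3 : len Φ = 1 := by rw [len, hΦ, Real.sqrt_one]
  rw [h3, mul_one, mul_one] at h1
  exact (abs_sub _ _).trans (by linarith)

lemma qH_eig (hK : 0 < K) (hΦ : Φ ⬝ᵥ Φ = 1) (H : ∀ u (z : ℝ), sM K *ᵥ u = z • u → 1 < z → psi u Φ = 0)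
    {z : ℝ} {e : Bool × Fin (L + 1) → ℝ} (he : e ≠ 0) (h : sM K *ᵥ e = z • e) :
    (z - z⁻¹) * qH Φ w e = - (|z - z⁻¹| * (e ⬝ᵥ w)) := by
  obtain ⟨hz, ht⟩ := sM_eig_tau hK he h
  rcases lt_trichotomy z 1 with h1 | rfl | h1
  · have hi := (one_lt_inv₀ hz).2 h1
    have hk := H _ _ ht hi
    have h2 : psi w Φ ⬝ᵥ psi e Φ = 2 * (e ⬝ᵥ w) := by
      have h3 := psi_anticomm (tau e) w Φ
      rw [hk, psi_zero, add_zero, tau_dot_tau] at h3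
      rw [dot_psi, h3, smul_dotProduct, hΦ, smul_eq_mul, mul_one]
    rw [qH, h2, dotProduct_comm w e, abs_of_neg (by linarith)]; ring
  · simp
  · have hi := inv_lt_one_of_one_lt₀ h1
    rw [qH, H e z h h1, dotProduct_zero, dotProduct_comm w e, abs_of_pos (by linarith)]; ring

lemma aF_diag (hK : 0 < K) (hΦ : Φ ⬝ᵥ Φ = 1) (H : ∀ u (z : ℝ), sM K *ᵥ u = z • u → 1 < z → psi u Φ = 0)
    {e : Bool × Fin (L + 1) → Bool × Fin (L + 1) → ℝ} {z : Bool × Fin (L + 1) → ℝ} (h : IsEigenbasis (sM K) e z) :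
    aF K Φ u v = ∑ i, |z i - (z i)⁻¹| * ((e i ⬝ᵥ u) * (e i ⬝ᵥ v)) := by
  rw [aF]
  conv_lhs => rw [h.expand v]
  rw [sZ_sum, qH_sum, ← Finset.sum_neg_distrib]
  refine Finset.sum_congr rfl fun i _ => ?_
  rw [sZ_smul, qH_smul, sZ_eig hK (h.ne_zero i) (h.eig i), qH_smul, qH_eig u hK hΦ H (h.ne_zero i) (h.eig i)]
  ring

lemma aF_comm (hK : 0 < K) (hΦ : Φ ⬝ᵥ Φ = 1) (H : ∀ u (z : ℝ), sM K *ᵥ u = z • u → 1 < z → psi u Φ = 0) :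
    aF K Φ u v = aF K Φ v u := by
  obtain ⟨e, z, h⟩ := exists_eigenbasis (sM_symm (L := L) K)
  rw [aF_diag u v hK hΦ H h, aF_diag v u hK hΦ H h]
  exact Finset.sum_congr rfl fun i _ => by ring

lemma dot_sZ_sq_le (hK : 0 < K) (hΦ : Φ ⬝ᵥ Φ = 1) (H : ∀ u (z : ℝ), sM K *ᵥ u = z • u → 1 < z → psi u Φ = 0) :
    (u ⬝ᵥ sZ K v) ^ 2 ≤ aF K Φ u u * aF K Φ v v := by
  obtain ⟨e, z, h⟩ := exists_eigenbasis (sM_symm (L := L) K)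
  have h1 : u ⬝ᵥ sZ K v = ∑ i, (z i - (z i)⁻¹) * ((e i ⬝ᵥ u) * (e i ⬝ᵥ v)) := by
    conv_lhs => rw [h.expand v]
    rw [sZ_sum, dotProduct_sum]
    refine Finset.sum_congr rfl fun i _ => ?_
    rw [sZ_smul, sZ_eig hK (h.ne_zero i) (h.eig i), dotProduct_smul, dotProduct_smul, dotProduct_comm u, smul_eq_mul,
      smul_eq_mul]
    ring
  rw [h1, aF_diag u u hK hΦ H h, aF_diag v v hK hΦ H h]
  refine Finset.sum_sq_le_sum_mul_sum_of_sq_le_mul _ (fun i _ => mul_nonneg (abs_nonneg _) (mul_self_nonneg _))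
    (fun i _ => mul_nonneg (abs_nonneg _) (mul_self_nonneg _)) fun i _ => ?_
  rw [mul_pow, ← sq_abs (z i - _)]
  exact le_of_eq (by ring)

lemma psi_dot_psi_sep {M : (Fin (L + 1) → Bool) → ℝ} {m : ℝ} (hm : 0 < m) (hΦ : Φ ⬝ᵥ Φ = 1)
    (hu : ∀ f x, psi u (fun x => M x * f x) x = M x * psi u f x)
    (hv : ∀ f x, psi v (fun x => M x * f x) x = - (M x * psi v f x)) :
    |psi u Φ ⬝ᵥ psi v Φ| ≤ 2 / m * (len u * len v) * len (fun x => (M x - m) * Φ x) := by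
  set Δ : (Fin (L + 1) → Bool) → ℝ := fun x => (M x - m) * Φ x with hΔ
  have hΔ' : Δ = (fun x => M x * Φ x) + (-m) • Φ := by ext x; simp [hΔ]; ring
  have h1 : psi u Δ ⬝ᵥ psi v Φ = ∑ x, M x * (psi u Φ x * psi v Φ x) - m * (psi u Φ ⬝ᵥ psi v Φ) := by
    rw [hΔ', psi_add', psi_smul', add_dotProduct, smul_dotProduct, smul_eq_mul, neg_mul, ← sub_eq_add_neg]
    congr 1
    exact Finset.sum_congr rfl fun x _ => by rw [hu]; ring
  have h2 : psi u Φ ⬝ᵥ psi v Δ = - ∑ x, M x * (psi u Φ x * psi v Φ x) - m * (psi u Φ ⬝ᵥ psi v Φ) := by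
    rw [hΔ', psi_add', psi_smul', dotProduct_add, dotProduct_smul, smul_eq_mul, neg_mul, ← sub_eq_add_neg,
      ← Finset.sum_neg_distrib]
    congr 1
    exact Finset.sum_congr rfl fun x _ => by rw [hv]; ring
  have h3 : len Φ = 1 := by rw [len, hΦ, Real.sqrt_one]
  have h4 := abs_psi_dot_psi_le u v Δ Φ
  have h5 := abs_psi_dot_psi_le u v Φ Δ
  rw [h3, mul_one] at h4
  rw [h3, one_mul] at h5
  have h6 : psi u Φ ⬝ᵥ psi v Φ = - (psi u Δ ⬝ᵥ psi v Φ + psi u Φ ⬝ᵥ psi v Δ) / (2 * m) := by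
    rw [h1, h2]; field_simp; ring
  rw [h6, abs_div, abs_neg, abs_of_pos (by linarith : 0 < 2 * m), div_le_iff₀ (by linarith)]
  refine (abs_add_le _ _).trans ((add_le_add h4 h5).trans_eq ?_)
  field_simp; ring
end

section
open Matrix
variable {L : ℕ} {K : ℝ}

lemma exv_kill (hK : 0 < K) (hL : 0 < L) {r : ℝ} {Ω : (Fin L → Bool) → ℝ} (h : IsPerron (tm K L true) r Ω)
    (u : Bool × Fin (L + 1) → ℝ) (z : ℝ) (hu : sM K *ᵥ u = z • u) (hz : 1 < z) : psi u (exv Ω) = 0 := by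
  refine psi_kill hK hL h hu (l := r) ?_ (by nlinarith [h.pos])
  rw [tV_exv, h.eig]
  ext x
  simp [exv]

lemma psi_comm_sx {u : Bool × Fin (L + 1) → ℝ} {g : ℕ} (hu : ∀ b (k : Fin (L + 1)), g ≤ k → u (b, k) = 0)
    (f : (Fin (L + 1) → Bool) → ℝ) (x : Fin (L + 1) → Bool) :
    psi u (fun x => sx x g * f x) x = sx x g * psi u f x := by
  rw [psi, psi, Finset.mul_sum]
  refine Finset.sum_congr rfl fun k _ => ?_
  by_cases hk : g ≤ k
  · simp [acf, hu _ k hk]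
  · rw [sx_fl_gt (by omega)]; ring

lemma psi_anticomm_sx {u : Bool × Fin (L + 1) → ℝ} {g : ℕ} (hu : ∀ b (k : Fin (L + 1)), k < g → u (b, k) = 0)
    (f : (Fin (L + 1) → Bool) → ℝ) (x : Fin (L + 1) → Bool) :
    psi u (fun x => sx x g * f x) x = - (sx x g * psi u f x) := by
  rw [psi, psi, Finset.mul_sum, ← Finset.sum_neg_distrib]
  refine Finset.sum_congr rfl fun k _ => ?_
  by_cases hk : k < g
  · simp [acf, hu _ k hk]
  · rw [sx_fl_le (by omega)]; ring

lemma psi_sum' {ι : Type*} (s : Finset ι) (u : Bool × Fin (L + 1) → ℝ) (f : ι → (Fin (L + 1) → Bool) → ℝ) :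
    psi u (∑ i ∈ s, f i) = ∑ i ∈ s, psi u (f i) := by
  classical
  induction s using Finset.induction_on with
  | empty => simp [psi_zero]
  | insert i s hi ih => rw [Finset.sum_insert hi, Finset.sum_insert hi, psi_add', ih]

lemma avs_mul (n R g : ℕ) (f : (Fin (L + 1) → Bool) → ℝ) : (fun x => avs n R g x * f x) =
    (n : ℝ)⁻¹ • ∑ a ∈ Finset.range n, fun x => sx x (g + a * (R + 1)) * f x := by
  ext x
  rw [Pi.smul_apply, Finset.sum_apply, ← Finset.sum_mul, smul_eq_mul, avs]
  ring

lemma psi_comm_avs {u : Bool × Fin (L + 1) → ℝ} {n R g : ℕ} (hu : ∀ b (k : Fin (L + 1)), g ≤ k → u (b, k) = 0)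
    (f : (Fin (L + 1) → Bool) → ℝ) (x : Fin (L + 1) → Bool) :
    psi u (fun x => avs n R g x * f x) x = avs n R g x * psi u f x := by
  have := congrFun (avs_mul n R g (psi u f)) x
  rw [avs_mul, psi_smul', psi_sum', this, Pi.smul_apply, Pi.smul_apply, Finset.sum_apply, Finset.sum_apply]
  congr 1
  refine Finset.sum_congr rfl fun a _ => psi_comm_sx (fun b k hk => hu b k (by omega)) f x

lemma psi_anticomm_avs {u : Bool × Fin (L + 1) → ℝ} {n R g : ℕ}
    (hu : ∀ b (k : Fin (L + 1)), k < g + n * (R + 1) → u (b, k) = 0)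
    (f : (Fin (L + 1) → Bool) → ℝ) (x : Fin (L + 1) → Bool) :
    psi u (fun x => avs n R g x * f x) x = - (avs n R g x * psi u f x) := by
  have := congrFun (avs_mul n R g (psi u f)) x
  rw [avs_mul, psi_smul', psi_sum', this, Pi.smul_apply, Pi.smul_apply, Finset.sum_apply, Finset.sum_apply,
    ← smul_neg, ← Finset.sum_neg_distrib]
  congr 1
  refine Finset.sum_congr rfl fun a ha => psi_anticomm_sx (fun b k hk => hu b k (hk.trans_le ?_)) f x
  have := Nat.mul_le_mul_right (R + 1) (Finset.mem_range.1 ha).le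
  omega

lemma len_avs_sub {n R g : ℕ} (hg : g + n * (R + 1) ≤ L) (m : ℝ) (Ω : (Fin L → Bool) → ℝ) :
    len (fun x => (avs n R (g + 1) x - m) * exv Ω x) = √(∑ y, Ω y ^ 2 * (avs n R g y - m) ^ 2) := by
  rw [len, dotProduct, sum_cons]
  congr 1
  simp only [exv_cons, if_true, Bool.false_eq_true, if_false, mul_zero, Finset.sum_const_zero, add_zero]
  refine Finset.sum_congr rfl fun y _ => ?_
  have : avs n R (g + 1) (Fin.cons true y : Fin (L + 1) → Bool) = avs n R g y := by
    rw [avs, avs]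
    congr 1
    refine Finset.sum_congr rfl fun a ha => ?_
    have h1 : (a + 1) * (R + 1) ≤ n * (R + 1) := Nat.mul_le_mul_right (R + 1) (Finset.mem_range.1 ha)
    rw [add_mul, one_mul] at h1
    rw [add_right_comm, sx_cons_succ _ _ (by omega)]
  rw [this]; ring

lemma exists_gap (hK : 0 ≤ K) (hm : 0 < mp K 0) {ε : ℝ} (hε : 0 < ε) : ∃ W : ℕ, 0 < W ∧ ∀ (L : ℕ) (r : ℝ)
    (Ω : (Fin L → Bool) → ℝ), IsPerron (tm K L true) r Ω → ∀ i : ℕ, W ≤ i → i + W ≤ L →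
    ∀ u v : Bool × Fin (L + 1) → ℝ, (∀ b (k : Fin (L + 1)), i ≤ k → u (b, k) = 0) →
      (∀ b (k : Fin (L + 1)), k < i + W → v (b, k) = 0) →
      |psi u (exv Ω) ⬝ᵥ psi v (exv Ω)| ≤ ε * (len u * len v) := by
  set m := mp K 0
  have ht : Tendsto (fun R : ℕ => 1 / ((R : ℝ) + 1) + (2 * bmag K R + bmag K R ^ 2 - 2 * m) - m ^ 2) atTop (𝓝 0) := by
    have h1 : Tendsto (bmag K) atTop (𝓝 m) := mp_tendsto hK
    have h2 := ((tendsto_one_div_add_atTop_nhds_zero_nat (𝕜 := ℝ)).add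
      (((h1.const_mul 2).add (h1.pow 2)).sub_const (2 * m))).sub_const (m ^ 2)
    convert h2 using 2
    ring
  obtain ⟨R, hR⟩ := (ht.eventually (gt_mem_nhds (show 0 < (ε * m / 2) ^ 2 by positivity))).exists
  refine ⟨(R + 1) * (R + 1) + 1, by omega, fun L r Ω h i h1 h2 u v hu hv => ?_⟩
  obtain ⟨g, rfl⟩ : ∃ g, i = g + 1 := ⟨i - 1, by omega⟩
  have hg : g + (R + 1) * (R + 1) ≤ L := by omega
  have hRg : R ≤ g := by nlinarith
  have hc := avs_conc hK h (n := R + 1) (Nat.succ_pos R) hRg hg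
  have hs := psi_dot_psi_sep u v hm (Φ := exv Ω) (by rw [dot_exv_exv, h.norm]) (fun f x => psi_comm_avs (n := R + 1) (R := R) hu f x)
    (fun f x => psi_anticomm_avs (fun b k hk => hv b k (by omega)) f x)
  rw [len_avs_sub hg] at hs
  have h3 : √(∑ y, Ω y ^ 2 * (avs (R + 1) R g y - m) ^ 2) ≤ ε * m / 2 := by
    rw [Real.sqrt_le_left (by positivity)]
    push_cast at hc
    exact hc.trans hR.le
  refine hs.trans ?_
  have h4 : 0 ≤ 2 / m * (len u * len v) := mul_nonneg (by positivity) (mul_nonneg (len_nonneg _) (len_nonneg _))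
  refine (mul_le_mul_of_nonneg_left h3 h4).trans_eq ?_
  field_simp
end

section
open Matrix
variable {L : ℕ} {K : ℝ}

/-- Modes from a pair of functions on the line. -/
def pairM (g₁ g₂ : ℤ → ℝ) : Bool × Fin (L + 1) → ℝ := fun i => if i.1 then g₁ (i.2 : ℕ) else g₂ (i.2 : ℕ)

lemma R1_pairM (g₁ g₂ : ℤ → ℝ) : R1 K (pairM g₁ g₂ : Bool × Fin (L + 1) → ℝ) =
    pairM (fun j => Real.cosh K * g₁ j - Real.sinh K * g₂ j) (fun j => Real.cosh K * g₂ j - Real.sinh K * g₁ j) := by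
  ext ⟨b, k⟩
  cases b <;> simp [R1, pairM]

lemma tau_pairM (g₁ g₂ : ℤ → ℝ) : tau (pairM g₁ g₂ : Bool × Fin (L + 1) → ℝ) = pairM g₁ (fun j => - g₂ j) := by
  ext ⟨b, k⟩
  cases b <;> simp [tau, pairM]

lemma R2_pairM (hs : Real.sinh (2 * K) = 1) {g₁ g₂ : ℤ → ℝ} (h1 : g₁ L = 0) (h2 : g₂ 0 = 0) (h3 : g₁ (-1) = 0)
    (h4 : g₂ (L + 1) = 0) : R2 K (pairM g₁ g₂ : Bool × Fin (L + 1) → ℝ) =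
      pairM (fun j => Real.cosh (2 * K) * g₁ j + g₂ (j + 1)) (fun j => Real.cosh (2 * K) * g₂ j + g₁ (j - 1)) := by
  refine modes_ext ?_ ?_ fun k => ⟨?_, ?_⟩
  · rw [R2_false_zero]; simp [pairM, h2, h3]
  · rw [R2_true_last]; simp [pairM, h1, h4]
  · rw [R2_true_castSucc, hs]; simp [pairM]
  · rw [R2_false_succ, hs]; simp [pairM]

/-- Weighted second difference. -/
def dif (a b : ℝ) (g : ℤ → ℝ) (j : ℤ) : ℝ := a * (g (j - 1) - g j) + b * (g (j + 1) - g j)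

/-- Modes of a single type. -/
def emb (o : Bool) (g : ℤ → ℝ) : Bool × Fin (L + 1) → ℝ := fun i => if i.1 = o then g (i.2 : ℕ) else 0

/-- Functions vanishing at both ends of the line. -/
def EndZ (L : ℕ) (g : ℤ → ℝ) : Prop := g 0 = 0 ∧ g (-1) = 0 ∧ g L = 0 ∧ g (L + 1) = 0

lemma sM_pairM (hs : Real.sinh (2 * K) = 1) {g₁ g₂ : ℤ → ℝ} (h₁ : EndZ L g₁) (h₂ : EndZ L g₂) :
    sM K *ᵥ (pairM g₁ g₂ : Bool × Fin (L + 1) → ℝ) = pairM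
      (fun j => Real.cosh K * (Real.cosh (2 * K) * (Real.cosh K * g₁ j - Real.sinh K * g₂ j) +
          (Real.cosh K * g₂ (j + 1) - Real.sinh K * g₁ (j + 1))) -
        Real.sinh K * (Real.cosh (2 * K) * (Real.cosh K * g₂ j - Real.sinh K * g₁ j) +
          (Real.cosh K * g₁ (j - 1) - Real.sinh K * g₂ (j - 1))))
      (fun j => Real.cosh K * (Real.cosh (2 * K) * (Real.cosh K * g₂ j - Real.sinh K * g₁ j) +
          (Real.cosh K * g₁ (j - 1) - Real.sinh K * g₂ (j - 1))) -
        Real.sinh K * (Real.cosh (2 * K) * (Real.cosh K * g₁ j - Real.sinh K * g₂ j) +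
          (Real.cosh K * g₂ (j + 1) - Real.sinh K * g₁ (j + 1)))) := by
  obtain ⟨a1, a2, a3, a4⟩ := h₁
  obtain ⟨b1, b2, b3, b4⟩ := h₂
  rw [sM_mulVec, R1_pairM, R2_pairM hs, R1_pairM] <;> simp [a1, a2, a3, a4, b1, b2, b3, b4]

lemma sZ_emb (hs : Real.sinh (2 * K) = 1) (o : Bool) {g : ℤ → ℝ} (h : EndZ L g) :
    sZ K (emb o g : Bool × Fin (L + 1) → ℝ) = (2 : ℝ) • emb (!o)
      (dif (if o then Real.cosh K ^ 2 else Real.sinh K ^ 2) (if o then Real.sinh K ^ 2 else Real.cosh K ^ 2) g) := by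
  have h0 : EndZ L (fun _ => 0) := ⟨rfl, rfl, rfl, rfl⟩
  have e1 : 2 * Real.sinh K * Real.cosh K = 1 := by rw [← Real.sinh_two_mul, hs]
  have e2 : Real.cosh (2 * K) = Real.cosh K ^ 2 + Real.sinh K ^ 2 := Real.cosh_two_mul K
  cases o
  · have hg : (emb false g : Bool × Fin (L + 1) → ℝ) = pairM (fun _ => 0) g := by
      ext ⟨b, k⟩; cases b <;> simp [emb, pairM]
    have hn : EndZ L (fun j => - g j) := ⟨by simp [h.1], by simp [h.2.1], by simp [h.2.2.1], by simp [h.2.2.2]⟩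
    rw [hg, sZ, tau_pairM, sM_pairM hs h0 h, sM_pairM hs h0 hn, tau_pairM]
    ext ⟨b, k⟩
    cases b
    · simp [pairM, emb]; ring
    · simp [pairM, emb, dif]
      rw [e2]
      linear_combination (-2 * (Real.cosh K ^ 2 + Real.sinh K ^ 2) * g (k : ℕ)) * e1
  · have hg : (emb true g : Bool × Fin (L + 1) → ℝ) = pairM g (fun _ => 0) := by
      ext ⟨b, k⟩; cases b <;> simp [emb, pairM]
    have hg' : tau (emb true g : Bool × Fin (L + 1) → ℝ) = emb true g := by
      ext ⟨b, k⟩; cases b <;> simp [emb, tau]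
    rw [sZ, hg', hg, sM_pairM hs h h0, tau_pairM]
    ext ⟨b, k⟩
    cases b
    · simp [pairM, emb, dif]
      rw [e2]
      linear_combination (-2 * (Real.cosh K ^ 2 + Real.sinh K ^ 2) * g (k : ℕ)) * e1
    · simp [pairM, emb]
end

section
open Matrix
variable {L : ℕ} {K : ℝ}

/-- The linear ramp from `0` at `p` to `1` at `p + l`. -/
def ramp (l : ℕ) (p : ℤ) (j : ℤ) : ℝ := max 0 (min 1 (((j : ℝ) - p) / l))

lemma ramp_nonneg (l : ℕ) (p j : ℤ) : 0 ≤ ramp l p j := le_max_left _ _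

lemma ramp_le_one (l : ℕ) (p j : ℤ) : ramp l p j ≤ 1 := max_le zero_le_one (min_le_left _ _)

lemma ramp_eq_zero {l : ℕ} {p j : ℤ} (h : j ≤ p) : ramp l p j = 0 := by
  have : (j : ℝ) ≤ p := by exact_mod_cast h
  exact max_eq_left ((min_le_right _ _).trans (div_nonpos_of_nonpos_of_nonneg (by linarith) (Nat.cast_nonneg l)))

lemma ramp_eq_one {l : ℕ} (hl : 0 < l) {p j : ℤ} (h : p + l ≤ j) : ramp l p j = 1 := by
  have h1 : (p : ℝ) + l ≤ j := by exact_mod_cast h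
  have h2 : (0 : ℝ) < l := Nat.cast_pos.2 hl
  rw [ramp, min_eq_left ((one_le_div h2).2 (by linarith)), max_eq_right zero_le_one]

lemma ramp_succ {l : ℕ} (hl : 0 < l) (p j : ℤ) : 0 ≤ ramp l p (j + 1) - ramp l p j ∧ ramp l p (j + 1) - ramp l p j ≤ 1 / l := by
  have h2 : (0 : ℝ) < l := Nat.cast_pos.2 hl
  have e : (((j + 1 : ℤ) : ℝ) - p) / l = ((j : ℝ) - p) / l + 1 / l := by push_cast; ring
  have h3 : 0 < 1 / (l : ℝ) := by positivity
  rw [ramp, ramp, e]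
  generalize ((j : ℝ) - p) / l = x at *
  generalize 1 / (l : ℝ) = y at *
  rcases max_cases 0 (min 1 (x + y)) with h | h <;> rcases max_cases 0 (min 1 x) with h' | h' <;>
    rcases min_cases 1 (x + y) with h5 | h5 <;> rcases min_cases 1 x with h6 | h6 <;>
    constructor <;> linarith

lemma dif_ramp_eq_zero {l : ℕ} (hl : 0 < l) (a b : ℝ) {p j : ℤ} (h : j < p ∨ p + l < j) : dif a b (ramp l p) j = 0 := by
  rw [dif]
  rcases h with h | h
  · rw [ramp_eq_zero (by omega), ramp_eq_zero (by omega), ramp_eq_zero (by omega)]; ring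
  · rw [ramp_eq_one hl (by omega), ramp_eq_one hl (by omega), ramp_eq_one hl (by omega)]; ring

lemma abs_dif_ramp_le {l : ℕ} (hl : 0 < l) {a b : ℝ} (ha : 0 ≤ a) (hb : 0 ≤ b) (p j : ℤ) :
    |dif a b (ramp l p) j| ≤ (a + b) / l := by
  have h1 := ramp_succ hl p (j - 1)
  have h2 := ramp_succ hl p j
  rw [sub_add_cancel] at h1
  have e : (a + b) / (l : ℝ) = a * (1 / l) + b * (1 / l) := by ring
  rw [dif, e, abs_le]
  constructor <;> nlinarith

lemma sum_dif (a b : ℝ) (g : ℤ → ℝ) (n : ℕ) :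
    ∑ k ∈ Finset.range n, dif a b g k = a * (g (-1) - g (n - 1)) + b * (g n - g 0) := by
  induction n with
  | zero => simp
  | succ n ih =>
    rw [Finset.sum_range_succ, ih, dif]
    push_cast
    rw [add_sub_cancel_right]
    ring

/-- A trapezoid. -/
def trap (l : ℕ) (p q : ℤ) (j : ℤ) : ℝ := ramp l p j - ramp l q j

lemma abs_trap_le (l : ℕ) (p q j : ℤ) : |trap l p q j| ≤ 1 := by
  rw [trap, abs_le]
  have := ramp_nonneg l p j
  have := ramp_nonneg l q j
  have := ramp_le_one l p j
  have := ramp_le_one l q j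
  constructor <;> linarith

lemma trap_eq_zero {l : ℕ} (hl : 0 < l) {p q j : ℤ} (hpq : p ≤ q) (h : j ≤ p ∨ q + l ≤ j) : trap l p q j = 0 := by
  rw [trap]
  rcases h with h | h
  · rw [ramp_eq_zero h, ramp_eq_zero (by omega), sub_zero]
  · rw [ramp_eq_one hl h, ramp_eq_one hl (by omega), sub_self]

lemma trap_eq_one {l : ℕ} (hl : 0 < l) {p q j : ℤ} (h : p + l ≤ j) (h' : j ≤ q) : trap l p q j = 1 := by
  rw [trap, ramp_eq_one hl h, ramp_eq_zero h', sub_zero]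

lemma endZ_trap {l : ℕ} (hl : 0 < l) {p q : ℤ} (hp : 0 ≤ p) (hpq : p ≤ q) (hq : q + l ≤ L) : EndZ L (trap l p q) := by
  refine ⟨?_, ?_, ?_, ?_⟩ <;> exact trap_eq_zero hl hpq (by omega)

lemma dif_trap (a b : ℝ) (l : ℕ) (p q : ℤ) : dif a b (trap l p q) = fun j => dif a b (ramp l p) j - dif a b (ramp l q) j := by
  ext j; simp only [dif, trap]; ring

lemma emb_dot_emb (o : Bool) (f g : ℤ → ℝ) :
    (emb o f : Bool × Fin (L + 1) → ℝ) ⬝ᵥ emb o g = ∑ k ∈ Finset.range (L + 1), f k * g k := by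
  rw [dot_modes, Finset.sum_range]
  refine Finset.sum_congr rfl fun k _ => ?_
  cases o <;> simp [emb]

lemma emb_dot_emb_not (o : Bool) (f g : ℤ → ℝ) : (emb o f : Bool × Fin (L + 1) → ℝ) ⬝ᵥ emb (!o) g = 0 := by
  rw [dot_modes]
  refine Finset.sum_eq_zero fun k _ => ?_
  cases o <;> simp [emb]

lemma emb_sub (o : Bool) (f g : ℤ → ℝ) : (emb o (fun j => f j - g j) : Bool × Fin (L + 1) → ℝ) = emb o f - emb o g := by
  ext i; simp only [emb, Pi.sub_apply]; split_ifs <;> simp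

lemma emb_dot_self_le (o : Bool) {g : ℤ → ℝ} {c : ℝ} {p w : ℕ} (hc : ∀ j, |g j| ≤ c)
    (hg : ∀ j : ℤ, j < p ∨ p + w < j → g j = 0) :
    (emb o g : Bool × Fin (L + 1) → ℝ) ⬝ᵥ emb o g ≤ (w + 1) * c ^ 2 := by
  rw [emb_dot_emb]
  calc ∑ k ∈ Finset.range (L + 1), g k * g k ≤ ∑ k ∈ Finset.range (L + 1), if k ∈ Finset.Icc p (p + w) then c ^ 2 else 0 := by
        refine Finset.sum_le_sum fun k _ => ?_
        split_ifs with h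
        · rw [← sq, ← sq_abs]; exact pow_le_pow_left₀ (abs_nonneg _) (hc _) 2
        · rw [hg k (by rw [Finset.mem_Icc] at h; omega), mul_zero]
    _ = ((Finset.range (L + 1)).filter (· ∈ Finset.Icc p (p + w))).card * c ^ 2 := by
        rw [← Finset.sum_filter, Finset.sum_const, nsmul_eq_mul]
    _ ≤ (w + 1) * c ^ 2 := by
        refine mul_le_mul_of_nonneg_right ?_ (sq_nonneg c)
        have h1 : ((Finset.range (L + 1)).filter (· ∈ Finset.Icc p (p + w))).card ≤ (Finset.Icc p (p + w)).card :=
          Finset.card_le_card fun x hx => (Finset.mem_filter.1 hx).2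
        rw [Nat.card_Icc] at h1
        exact_mod_cast h1.trans (by omega)
end

section
open Matrix
variable {L : ℕ} {K : ℝ}

lemma sZ_trap (hs : Real.sinh (2 * K) = 1) (o : Bool) : ∃ a b : ℝ, 0 ≤ a ∧ 0 ≤ b ∧ (a + b) ^ 2 = 2 ∧ (b - a) ^ 2 = 1 ∧
    ∀ (L l p q : ℕ), 0 < l → p ≤ q → q + l ≤ L → sZ K (emb o (trap l p q) : Bool × Fin (L + 1) → ℝ) =
      (2 : ℝ) • (emb (!o) (dif a b (ramp l p)) - emb (!o) (dif a b (ramp l q))) := by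
  have h1 : Real.cosh (2 * K) ^ 2 = 2 := by rw [Real.cosh_sq, hs]; norm_num
  have h2 := Real.cosh_two_mul K
  have h3 := Real.cosh_sq K
  refine ⟨if o then Real.cosh K ^ 2 else Real.sinh K ^ 2, if o then Real.sinh K ^ 2 else Real.cosh K ^ 2,
    by split_ifs <;> positivity, by split_ifs <;> positivity, ?_, ?_, fun L l p q hl hpq hq => ?_⟩
  · rw [← h1, h2]; split_ifs <;> ring
  · rw [h3]; split_ifs <;> ring
  · rw [sZ_emb hs o (endZ_trap hl (by omega) (by omega) (by omega)), dif_trap, emb_sub]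

lemma len_trap_mul_le {l p q D : ℕ} (hl : 0 < l) (hpq : p ≤ q) (hD : q + l + 1 ≤ p + D) {a b C : ℝ} (ha : 0 ≤ a) (hb : 0 ≤ b)
    (hab : (a + b) ^ 2 = 2) (hC : 0 ≤ C) (hDC : 4 * D ≤ C ^ 2 * l) (o o' : Bool) (r : ℕ) :
    len (emb o (trap l p q) : Bool × Fin (L + 1) → ℝ) * len (emb o' (dif a b (ramp l r)) : Bool × Fin (L + 1) → ℝ) ≤ C := by
  have hl0 : (1 : ℝ) ≤ l := by exact_mod_cast hl
  have h1 : len (emb o (trap l p q) : Bool × Fin (L + 1) → ℝ) ^ 2 ≤ D := by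
    rw [len_sq]
    refine (emb_dot_self_le o (c := 1) (p := p) (w := q + l - p) (abs_trap_le l p q)
      fun j hj => trap_eq_zero hl (by omega) (by omega)).trans ?_
    rw [one_pow, mul_one]
    exact_mod_cast (by omega : q + l - p + 1 ≤ D)
  have h2 : len (emb o' (dif a b (ramp l r)) : Bool × Fin (L + 1) → ℝ) ^ 2 ≤ 4 / l := by
    rw [len_sq]
    refine (emb_dot_self_le o' (p := r) (w := l) (abs_dif_ramp_le hl ha hb r)
      fun j hj => dif_ramp_eq_zero hl a b (by omega)).trans ?_
    rw [div_pow, hab, ← mul_div_assoc, div_le_div_iff₀ (by positivity) (by positivity)]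
    nlinarith
  refine abs_le_of_sq_le_sq' ?_ hC |>.2
  rw [mul_pow]
  calc _ ≤ (D : ℝ) * (4 / l) := mul_le_mul h1 h2 (sq_nonneg _) (Nat.cast_nonneg _)
    _ ≤ C ^ 2 := by
      rw [← mul_div_assoc, div_le_iff₀ (by positivity)]
      linarith

variable {Φ : (Fin (L + 1) → Bool) → ℝ}

/-- Decoupling, with rate `ε`, of modes separated by at least `l` sites. -/
def Decoupled (Φ : (Fin (L + 1) → Bool) → ℝ) (l : ℕ) (ε : ℝ) : Prop := ∀ i : ℕ, l ≤ i → i + l ≤ L →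
    ∀ u v : Bool × Fin (L + 1) → ℝ, (∀ b (k : Fin (L + 1)), i ≤ k → u (b, k) = 0) →
      (∀ b (k : Fin (L + 1)), k < i + l → v (b, k) = 0) →
      |psi u Φ ⬝ᵥ psi v Φ| ≤ ε * (len u * len v)

lemma Decoupled.qH_le {l : ℕ} {ε : ℝ} (G : Decoupled Φ l ε) {i : ℕ} (hi : l ≤ i) (hi' : i + l ≤ L) {o : Bool} {f g : ℤ → ℝ}
    (hf : ∀ j : ℤ, i ≤ j → f j = 0) (hg : ∀ j : ℤ, j < i + l → g j = 0) :
    |qH Φ (emb o f) (emb (!o) g)| ≤ ε * (len (emb o f : Bool × Fin (L + 1) → ℝ) * len (emb (!o) g : Bool × Fin (L + 1) → ℝ)) := by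
  rw [qH, emb_dot_emb_not, sub_zero]
  refine G i hi hi' _ _ (fun b k hk => ?_) fun b k hk => ?_
  · rw [emb, hf _ (by exact_mod_cast hk), ite_self]
  · rw [emb, hg _ (by exact_mod_cast hk), ite_self]

lemma Decoupled.qH_le' {l : ℕ} {ε : ℝ} (G : Decoupled Φ l ε) {i : ℕ} (hi : l ≤ i) (hi' : i + l ≤ L) {o : Bool} {f g : ℤ → ℝ}
    (hf : ∀ j : ℤ, i ≤ j → f j = 0) (hg : ∀ j : ℤ, j < i + l → g j = 0) :
    |qH Φ (emb o g) (emb (!o) f)| ≤ ε * (len (emb o g : Bool × Fin (L + 1) → ℝ) * len (emb (!o) f : Bool × Fin (L + 1) → ℝ)) := by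
  rw [qH, emb_dot_emb_not, sub_zero, dotProduct_comm, mul_comm (len _)]
  refine G i hi hi' _ _ (fun b k hk => ?_) fun b k hk => ?_
  · rw [emb, hf _ (by exact_mod_cast hk), ite_self]
  · rw [emb, hg _ (by exact_mod_cast hk), ite_self]

lemma aF_trap {a b : ℝ} {o : Bool} {l p q : ℕ} (h : sZ K (emb o (trap l p q) : Bool × Fin (L + 1) → ℝ) =
      (2 : ℝ) • (emb (!o) (dif a b (ramp l p)) - emb (!o) (dif a b (ramp l q)))) (u : Bool × Fin (L + 1) → ℝ) :
    aF K Φ u (emb o (trap l p q)) = 2 * (qH Φ u (emb (!o) (dif a b (ramp l q))) - qH Φ u (emb (!o) (dif a b (ramp l p)))) := by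
  rw [aF, h, qH_smul, sub_eq_add_neg, qH_add, ← neg_one_smul ℝ (emb _ _), qH_smul]
  ring

lemma aF_trap_le (hs : Real.sinh (2 * K) = 1) (hΦ : Φ ⬝ᵥ Φ = 1) {o : Bool} {l p q p' q' D : ℕ} {C : ℝ} (hl : 0 < l)
    (hpq : p ≤ q) (hq : q + l ≤ L) (hD : q' + l + 1 ≤ p' + D) (hpq' : p' ≤ q') (hC : 0 ≤ C) (hDC : 4 * D ≤ C ^ 2 * l) :
    aF K Φ (emb o (trap l p' q')) (emb o (trap l p q)) ≤ 12 * C := by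
  obtain ⟨a, b, ha, hb, hab, -, h⟩ := sZ_trap hs o
  rw [aF_trap (h L l p q hl hpq hq)]
  have h1 := abs_le.1 ((abs_qH_le (emb o (trap l p' q')) (emb (!o) (dif a b (ramp l q))) hΦ).trans
    (mul_le_mul_of_nonneg_left (len_trap_mul_le hl hpq' hD ha hb hab hC hDC o (!o) q) (by norm_num)))
  have h2 := abs_le.1 ((abs_qH_le (emb o (trap l p' q')) (emb (!o) (dif a b (ramp l p))) hΦ).trans
    (mul_le_mul_of_nonneg_left (len_trap_mul_le hl hpq' hD ha hb hab hC hDC o (!o) p) (by norm_num)))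
  linarith

lemma aF_trap_nested_le (hs : Real.sinh (2 * K) = 1) {o : Bool} {l p q p' q' D : ℕ} {C ε : ℝ} (hε : 0 ≤ ε)
    (G : Decoupled Φ l ε) (hl : 0 < l) (hpp : p + 2 * l ≤ p') (hqq : q' + 2 * l ≤ q)
    (hq : q + l ≤ L) (hD : q' + l + 1 ≤ p' + D) (hpq' : p' ≤ q') (hC : 0 ≤ C) (hDC : 4 * D ≤ C ^ 2 * l) :
    aF K Φ (emb o (trap l p' q')) (emb o (trap l p q)) ≤ 4 * (ε * C) := by
  obtain ⟨a, b, ha, hb, hab, -, h⟩ := sZ_trap hs o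
  rw [aF_trap (h L l p q hl (by omega) hq)]
  have h1 : |qH Φ (emb o (trap l p' q')) (emb (!o) (dif a b (ramp l q)))| ≤ ε * C :=
    (G.qH_le (i := q' + l) (by omega) (by omega) (fun j hj => trap_eq_zero hl (by omega) (by push_cast at hj; omega))
      fun j hj => dif_ramp_eq_zero hl a b (by push_cast at hj; omega)).trans
    (mul_le_mul_of_nonneg_left (len_trap_mul_le hl hpq' hD ha hb hab hC hDC o (!o) q) hε)
  have h2 : |qH Φ (emb o (trap l p' q')) (emb (!o) (dif a b (ramp l p)))| ≤ ε * C :=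
    (G.qH_le' (i := p + l + 1) (by omega) (by omega) (fun j hj => dif_ramp_eq_zero hl a b (by push_cast at hj; omega))
      fun j hj => trap_eq_zero hl (by omega) (by push_cast at hj; omega)).trans
    (mul_le_mul_of_nonneg_left (len_trap_mul_le hl hpq' hD ha hb hab hC hDC o (!o) p) hε)
  have h1 := abs_le.1 h1
  have h2 := abs_le.1 h2
  linarith

/-- A sum of `N` nested trapezoids. -/
def trapSum (o : Bool) (l N c d : ℕ) : Bool × Fin (L + 1) → ℝ :=
  ∑ k ∈ Finset.range N, emb o (trap l (c + 2 * (l * k) : ℕ) (d - 2 * (l * k) : ℕ))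

lemma aF_self_nonneg (u : Bool × Fin (L + 1) → ℝ) (hK : 0 < K) (hΦ : Φ ⬝ᵥ Φ = 1)
    (H : ∀ u (z : ℝ), sM K *ᵥ u = z • u → 1 < z → psi u Φ = 0) : 0 ≤ aF K Φ u u := by
  obtain ⟨e, z, h⟩ := exists_eigenbasis (sM_symm (L := L) K)
  rw [aF_diag u u hK hΦ H h]
  exact Finset.sum_nonneg fun i _ => mul_nonneg (abs_nonneg _) (mul_self_nonneg _)

lemma aF_sum_sum {ι : Type*} (s : Finset ι) (f : ι → Bool × Fin (L + 1) → ℝ) (hK : 0 < K) (hΦ : Φ ⬝ᵥ Φ = 1)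
    (H : ∀ u (z : ℝ), sM K *ᵥ u = z • u → 1 < z → psi u Φ = 0) :
    aF K Φ (∑ i ∈ s, f i) (∑ i ∈ s, f i) = ∑ i ∈ s, ∑ j ∈ s, aF K Φ (f i) (f j) := by
  have h : ∀ u, aF K Φ u (∑ i ∈ s, f i) = ∑ i ∈ s, aF K Φ u (f i) := fun u => by
    simp only [aF, sZ_sum, qH_sum, Finset.sum_neg_distrib]
  rw [h]
  refine Finset.sum_congr rfl fun i _ => ?_
  rw [aF_comm _ _ hK hΦ H, h]

lemma aF_trapSum_le (hK : 0 < K) (hs : Real.sinh (2 * K) = 1) (hΦ : Φ ⬝ᵥ Φ = 1)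
    (H : ∀ u (z : ℝ), sM K *ᵥ u = z • u → 1 < z → psi u Φ = 0) {l N c d D : ℕ} {C ε : ℝ} (hε : 0 ≤ ε)
    (G : Decoupled Φ l ε) (hl : 0 < l) (hcd : c + 4 * (l * N) ≤ d) (hd : d + l ≤ L) (hD : d + l + 1 ≤ c + D)
    (hC : 0 ≤ C) (hDC : 4 * D ≤ C ^ 2 * l) (o : Bool) :
    aF K Φ (trapSum o l N c d) (trapSum o l N c d) ≤ N * (12 * C) + N ^ 2 * (4 * (ε * C)) := by
  have hfar : ∀ k k', k < k' → k' < N → aF K Φ (emb o (trap l (c + 2 * (l * k') : ℕ) (d - 2 * (l * k') : ℕ)))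
      (emb o (trap l (c + 2 * (l * k) : ℕ) (d - 2 * (l * k) : ℕ))) ≤ 4 * (ε * C) := fun k k' h h' => by
    have e1 : l * (k + 1) ≤ l * k' := Nat.mul_le_mul_left _ h
    have e2 : l * k' ≤ l * N := Nat.mul_le_mul_left _ h'.le
    rw [mul_add] at e1
    exact aF_trap_nested_le hs hε G hl (by omega) (by omega) (by omega) (D := D) (by omega) (by omega) hC hDC
  have key : ∀ k ∈ Finset.range N, ∀ k' ∈ Finset.range N, aF K Φ (emb o (trap l (c + 2 * (l * k) : ℕ) (d - 2 * (l * k) : ℕ)))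
      (emb o (trap l (c + 2 * (l * k') : ℕ) (d - 2 * (l * k') : ℕ))) ≤ (if k = k' then 12 * C else 0) + 4 * (ε * C) := by
    intro k hk k' hk'
    have hεC := mul_nonneg hε hC
    rw [Finset.mem_range] at hk hk'
    rcases lt_trichotomy k k' with h | h | h
    · rw [aF_comm _ _ hK hΦ H, if_neg h.ne, zero_add]; exact hfar k k' h hk'
    · subst h
      have e2 : l * k ≤ l * N := Nat.mul_le_mul_left _ hk.le
      rw [if_pos rfl]
      have := aF_trap_le (o := o) hs hΦ (p := c + 2 * (l * k)) (q := d - 2 * (l * k)) (p' := c + 2 * (l * k))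
        (q' := d - 2 * (l * k)) (D := D) hl (by omega) (by omega) (by omega) (by omega) hC hDC
      linarith
    · rw [if_neg h.ne', zero_add]; exact hfar k' k h hk
  rw [trapSum, aF_sum_sum _ _ hK hΦ H]
  refine (Finset.sum_le_sum fun k hk => Finset.sum_le_sum (key k hk)).trans (le_of_eq ?_)
  rw [Finset.sum_congr rfl fun k hk => by rw [Finset.sum_add_distrib, Finset.sum_ite_eq, if_pos hk]]
  simp only [Finset.sum_const, Finset.card_range, nsmul_eq_mul]
  ring

lemma trapSum_dot_sZ (hs : Real.sinh (2 * K) = 1) {l N B : ℕ} (hl : 0 < l) (hB : B = 2 * (l * N)) (hL : 5 * B + l ≤ L) :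
    ((trapSum false l N 0 (3 * B) : Bool × Fin (L + 1) → ℝ) ⬝ᵥ sZ K (trapSum true l N B (5 * B))) ^ 2 = (2 * N ^ 2) ^ 2 := by
  obtain ⟨a, b, ha, hb, -, hab, h⟩ := sZ_trap hs true
  have key : ∀ k ∈ Finset.range N, ∀ k' ∈ Finset.range N,
      (emb false (trap l (0 + 2 * (l * k) : ℕ) (3 * B - 2 * (l * k) : ℕ)) : Bool × Fin (L + 1) → ℝ) ⬝ᵥ
        sZ K (emb true (trap l (B + 2 * (l * k') : ℕ) (5 * B - 2 * (l * k') : ℕ))) = 2 * (b - a) := by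
    intro k hk k' hk'
    rw [Finset.mem_range] at hk hk'
    have e1 : l * (k + 1) ≤ l * N := Nat.mul_le_mul_left _ hk
    have e2 : l * (k' + 1) ≤ l * N := Nat.mul_le_mul_left _ hk'
    rw [mul_add] at e1 e2
    rw [h L l _ _ hl (by omega) (by omega), dotProduct_smul, dotProduct_sub, smul_eq_mul, Bool.not_true, emb_dot_emb, emb_dot_emb]
    congr 1
    have s1 : ∑ j ∈ Finset.range (L + 1), trap l (0 + 2 * (l * k) : ℕ) (3 * B - 2 * (l * k) : ℕ) j *
        dif a b (ramp l (B + 2 * (l * k') : ℕ)) j = b - a := by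
      trans ∑ j ∈ Finset.range (L + 1), dif a b (ramp l (B + 2 * (l * k') : ℕ)) j
      · refine Finset.sum_congr rfl fun j _ => ?_
        by_cases hj : (j : ℤ) < (B + 2 * (l * k') : ℕ) ∨ ((B + 2 * (l * k') : ℕ) : ℤ) + l < j
        · rw [dif_ramp_eq_zero hl a b hj, mul_zero]
        · rw [trap_eq_one hl (by omega) (by omega), one_mul]
      · rw [sum_dif, ramp_eq_zero (by omega), ramp_eq_one hl (by push_cast; omega), ramp_eq_one hl (by push_cast; omega),
          ramp_eq_zero (by omega)]
        ring
    have s2 : ∑ j ∈ Finset.range (L + 1), trap l (0 + 2 * (l * k) : ℕ) (3 * B - 2 * (l * k) : ℕ) j *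
        dif a b (ramp l (5 * B - 2 * (l * k') : ℕ)) j = 0 := by
      refine Finset.sum_eq_zero fun j _ => ?_
      by_cases hj : (j : ℤ) < (5 * B - 2 * (l * k') : ℕ)
      · rw [dif_ramp_eq_zero hl a b (Or.inl hj), mul_zero]
      · rw [trap_eq_zero hl (by omega) (by omega), zero_mul]
    rw [s1, s2, sub_zero]
  have : (trapSum false l N 0 (3 * B) : Bool × Fin (L + 1) → ℝ) ⬝ᵥ sZ K (trapSum true l N B (5 * B)) = N ^ 2 * (2 * (b - a)) := by
    rw [trapSum, trapSum, sZ_sum, sum_dotProduct, Finset.sum_congr rfl fun k hk => by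
      rw [dotProduct_sum, Finset.sum_congr rfl (key k hk)]]
    simp only [Finset.sum_const, Finset.card_range, nsmul_eq_mul]
    ring
  rw [this]
  linear_combination 4 * (N : ℝ) ^ 4 * hab

/-- At the self-dual point there is no spontaneous magnetization. -/
theorem mp_self_dual (hK : 0 < K) (hs : Real.sinh (2 * K) = 1) : mp K 0 ≤ 0 := by
  by_contra hm
  obtain ⟨l, hl, G⟩ := exists_gap hK.le (not_le.1 hm) (ε := 1 / (64 * 96)) (by norm_num)
  obtain ⟨N, hN⟩ : ∃ N : ℕ, N = 96 ^ 2 := ⟨_, rfl⟩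
  obtain ⟨B, hB⟩ : ∃ B : ℕ, B = 2 * (l * N) := ⟨_, rfl⟩
  obtain ⟨L, hL⟩ : ∃ L : ℕ, L = 5 * B + l := ⟨_, rfl⟩
  obtain ⟨r, Ω, hΩ⟩ := exists_perron (tm_symm K L true) (tm_pos K _ true)
  have hΦ : exv Ω ⬝ᵥ exv Ω = 1 := by rw [dot_exv_exv, hΩ.norm]
  have H := exv_kill hK (by omega) hΩ
  have hG : Decoupled (exv Ω) l (1 / (64 * 96)) := G L r Ω hΩ
  have hlN : l ≤ l * N := Nat.le_mul_of_pos_right _ (by omega)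
  have hDC : 4 * ((16 * (l * N) : ℕ) : ℝ) ≤ (8 * 96) ^ 2 * l := by
    rw [hN]; push_cast; linarith
  have h1 := aF_trapSum_le hK hs hΦ H (by norm_num) hG hl (N := N) (c := 0) (d := 3 * B) (D := 16 * (l * N))
    (by omega) (by omega) (by omega) (by norm_num) hDC false
  have h2 := aF_trapSum_le hK hs hΦ H (by norm_num) hG hl (N := N) (c := B) (d := 5 * B) (D := 16 * (l * N))
    (by omega) (by omega) (by omega) (by norm_num) hDC true
  have h3 := dot_sZ_sq_le (trapSum false l N 0 (3 * B)) (trapSum true l N B (5 * B)) hK hΦ H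
  have h0 : 0 ≤ aF K (exv Ω) (trapSum true l N B (5 * B)) (trapSum true l N B (5 * B)) := aF_self_nonneg _ hK hΦ H
  have h4 := h3.trans (mul_le_mul h1 h2 h0 (by positivity))
  rw [trapSum_dot_sZ hs hl hB (by omega), ← sq] at h4
  have h5 := abs_le_of_sq_le_sq' h4 (by positivity) |>.2
  rw [hN] at h5
  norm_num at h5

end

/-- At zero field and up to the self-dual point the plus phase has no magnetization. -/
lemma mp_nonpos_of_sinh {β : ℝ} (hβ : 0 < β) (hs : Real.sinh (2 * β) ≤ 1) : mp β 0 ≤ 0 := by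
  have h1 : Real.sinh (2 * (Real.arsinh 1 / 2)) = 1 := by rw [mul_div_cancel₀ _ two_ne_zero, Real.sinh_arsinh]
  have h2 : β ≤ Real.arsinh 1 / 2 := by
    rw [← h1, Real.sinh_le_sinh] at hs
    linarith
  exact (mp_mono_beta hβ.le h2).trans (mp_self_dual (hβ.trans_le h2) h1)

theorem siteConv_plus {β h : ℝ} (hβ : 0 < β) {μ : Measure Cfg2} (hμ : IsPlusPhase β h μ) : SiteConv μ 0 := by
  by_cases hh : h = 0
  · subst hh
    rcases le_or_gt (Real.sinh (2 * β)) 1 with hs | hs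
    · have := mp_nonpos_of_sinh hβ hs
      exact siteConv_of_mp hμ hβ.le (by rw [neg_zero]; linarith)
    · exact siteConv_of_lineLD hμ hβ.le (lineLD_of_sinh hβ hs hμ)
  · exact siteConv_of_mp hμ hβ.le (mp_field_ne_zero hβ.le hh)

end

/-- For every `β > 0` and `h`, the iterated weak limits
`lim_n lim_m μ⁺(·|η(i,0) = −1, i ∈ {−m,…,−n})` exist and equal `μ_{β,h}^+`. In particular,
for `h = 0` and `β ≥ β_c`, `ν_{β,0}^{+,-} = ν_{β,0}^{+,+}`. -/
theorem conditioned_plus_phase_recovers_plus_phase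
    (β h : ℝ) (hβ : 0 < β) (μp : Measure Cfg2) (hμp : IsPlusPhase β h μp) :
    (∃ μseq : ℕ → Measure Cfg2,
        (∀ n, CylTendsto (fun m => μp[|lineMinusEvt n m]) (μseq n)) ∧
        CylTendsto μseq μp) ∧
    (h = 0 → betaCrit ≤ β →
      ∀ νm νp : Measure (ZSeq Bool),
        IsCondLimitMeasure (schonmann μp) false νm →
        IsCondLimitMeasure (schonmann μp) true νp → νm = νp) := by
  have h0 := siteConv_plus hβ hμp
  exact ⟨exists_iterated_limit hμp hβ h0, fun _ _ νm νp hm hp => condLimits_eq hμp hβ h0 hm hp⟩
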